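/- Let ε > 0 be fixed. There exist an absolute constant c0 > 0 and a constant C(ε) > 0 such that for every x > 10 there exists a prime p0 with (log log x)/2 ≤ p0 ≤ x satisfying ∑_{q < x^{1/2−ε}, gcd(q, p0) = 1} sup_{(a,q)=1, x' ≤ x} |π(x'; q, a) − π(x')/φ(q)| ≤ C(ε) · x · exp(−c0·√(log x)). -/

import Mathlib

/-- `piR x` is the number of primes `p ≤ x`. -/
noncomputable def piR (x : ℝ) : ℕ := {p : ℕ | p.Prime ∧ (p : ℝ) ≤ x}.ncard

/-- `piAP x q a` is the number of primes `p ≤ x` with `p ≡ a (mod q)`. -/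
noncomputable def piAP (x : ℝ) (q a : ℕ) : ℕ :=
  {p : ℕ | p.Prime ∧ (p : ℝ) ≤ x ∧ p % q = a % q}.ncard

/-- `Eerr x q = sup_{(a,q)=1, x' ≤ x} |π(x';q,a) − π(x')/φ(q)|`. -/
noncomputable def Eerr (x : ℝ) (q : ℕ) : ℝ :=
  sSup {r : ℝ | ∃ a : ℕ, ∃ x' : ℝ, Nat.Coprime a q ∧ x' ≤ x ∧
    r = |(piAP x' q a : ℝ) - (piR x' : ℝ) / (Nat.totient q : ℝ)|}

open Complex Filter Topology MeasureTheory

/-- partial sums of a character -/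
noncomputable def chiSum {q : ℕ} (χ : DirichletCharacter ℂ q) (N : ℕ) : ℂ :=
  ∑ k ∈ Finset.Icc 1 N, χ (k : ZMod q)

theorem sum_range_char_period {q : ℕ} [NeZero q] (χ : DirichletCharacter ℂ q) (hχ : χ ≠ 1) (m : ℕ) :
    ∑ k ∈ Finset.range q, χ ((m + k : ℕ) : ZMod q) = 0 := by
  have h1 : ∑ k ∈ Finset.range q, χ ((m + k : ℕ) : ZMod q) = ∑ a : ZMod q, χ (m + a) := by
    refine Finset.sum_bij (fun k _ => (k : ZMod q)) (by simp) ?_ ?_ (by simp)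
    · intro a ha b hb h
      rw [ZMod.natCast_eq_natCast_iff', Nat.mod_eq_of_lt (Finset.mem_range.1 ha),
        Nat.mod_eq_of_lt (Finset.mem_range.1 hb)] at h
      exact h
    · intro b _
      exact ⟨b.val, Finset.mem_range.2 (ZMod.val_lt b), by simp⟩
  rw [h1, Fintype.sum_equiv (Equiv.addLeft (m : ZMod q)) _ (fun a => χ a) (by simp)]
  exact MulChar.sum_eq_zero_of_ne_one hχ

theorem norm_char_le_one' {q : ℕ} (χ : DirichletCharacter ℂ q) (a : ZMod q) : ‖χ a‖ ≤ 1 :=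
  χ.norm_le_one a

theorem norm_sum_range_char_le {q : ℕ} [NeZero q] (χ : DirichletCharacter ℂ q) (hχ : χ ≠ 1) (N : ℕ) :
    ‖∑ k ∈ Finset.range N, χ (k : ZMod q)‖ ≤ q := by
  induction N using Nat.strong_induction_on with
  | _ N ih =>
    by_cases h : N < q
    · refine (norm_sum_le _ _).trans ((Finset.sum_le_sum fun (k : ℕ) _ => norm_char_le_one' χ (k : ZMod q)).trans ?_)
      simpa using h.le
    · push Not at h
      have hq : 0 < q := NeZero.pos q
      have := ih (N - q) (by omega)
      rw [show N = (N - q) + q by omega, Finset.sum_range_add, sum_range_char_period χ hχ, add_zero]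
      exact this

theorem chiSum_eq_range {q : ℕ} [NeZero q] (χ : DirichletCharacter ℂ q) (hχ : χ ≠ 1) (N : ℕ) :
    chiSum χ N = ∑ k ∈ Finset.range (N + 1), χ (k : ZMod q) := by
  have hq : q ≠ 1 := fun h => hχ (DirichletCharacter.level_one' χ h)
  rw [chiSum, Finset.sum_range_succ']
  simp only [Nat.cast_zero, DirichletCharacter.map_zero' χ hq, add_zero]
  rw [show Finset.Icc 1 N = Finset.Ico 1 (N + 1) from rfl, Finset.sum_Ico_eq_sum_range]
  simp [add_comm]

theorem norm_chiSum_le {q : ℕ} [NeZero q] (χ : DirichletCharacter ℂ q) (hχ : χ ≠ 1) (N : ℕ) :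
    ‖chiSum χ N‖ ≤ q := by
  rw [chiSum_eq_range χ hχ]; exact norm_sum_range_char_le χ hχ _

theorem norm_chiSum_le' {q : ℕ} (χ : DirichletCharacter ℂ q) (N : ℕ) :
    ‖chiSum χ N‖ ≤ N := by
  rw [chiSum]
  refine (norm_sum_le _ _).trans ((Finset.sum_le_sum fun (k : ℕ) _ => norm_char_le_one' χ (k : ZMod q)).trans ?_)
  simp

theorem differentiableOn_tail (f : ℝ → ℂ) (hm : Measurable f) (C : ℝ) (hC : ∀ t, ‖f t‖ ≤ C) :
    DifferentiableOn ℂ (fun s : ℂ => ∫ t in Set.Ioi (1 : ℝ), f t * (t : ℂ) ^ (-(s + 1)))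
      {s | 0 < s.re} := by
  set F : ℝ → ℂ := Set.indicator (Set.Ioi 1) f with hF
  have hFm : Measurable F := hm.indicator measurableSet_Ioi
  have hC0 : 0 ≤ C := (norm_nonneg _).trans (hC 0)
  have hFC : ∀ t, ‖F t‖ ≤ C := fun t => (norm_indicator_le_norm_self f t).trans (hC t)
  have heq : (fun s : ℂ => ∫ t in Set.Ioi (1 : ℝ), f t * (t : ℂ) ^ (-(s + 1))) =
      fun s => mellin F (-s) := by
    funext s
    rw [mellin]
    have : ∀ t : ℝ, (t : ℂ) ^ (-s - 1) • F t
        = Set.indicator (Set.Ioi 1) (fun t : ℝ => f t * (t : ℂ) ^ (-(s + 1))) t := by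
      intro t
      simp only [hF, Set.indicator]
      split_ifs
      · rw [smul_eq_mul, mul_comm, show -s - 1 = -(s + 1) by ring]
      · simp
    simp_rw [this]
    rw [setIntegral_indicator measurableSet_Ioi]
    congr 2
    ext t; simp
  rw [heq]
  intro s hs
  have hs' : 0 < s.re := hs
  have h1 : DifferentiableAt ℂ (mellin F) (-s) := by
    refine mellin_differentiableAt_of_isBigO_rpow (a := 0) (b := -s.re - 1) ?_ ?_ (by simpa using hs') ?_ (by simp)
    · have : LocallyIntegrable F := by
        refine LocallyIntegrable.mono (f := fun _ : ℝ => C) (locallyIntegrable_const C) hFm.aestronglyMeasurable ?_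
        exact Eventually.of_forall (fun t => (hFC t).trans (by simpa using le_abs_self C))
      exact this.locallyIntegrableOn _
    · refine Asymptotics.IsBigO.of_bound C (Eventually.of_forall fun t => ?_)
      simpa using hFC t
    · refine Asymptotics.IsBigO.of_bound 1 ?_
      have : Set.Iio (1 : ℝ) ∈ 𝓝[>] (0 : ℝ) := mem_nhdsWithin_of_mem_nhds (Iio_mem_nhds one_pos)
      filter_upwards [this] with t ht
      have : F t = 0 := by
        rw [hF, Set.indicator_of_notMem]
        simp only [Set.mem_Ioi, not_lt]; exact le_of_lt ht
      rw [this]; simp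
  exact (h1.comp s (differentiable_neg s)).differentiableWithinAt

theorem isPreconnected_re_pos : IsPreconnected {s : ℂ | 0 < s.re} :=
  (convex_halfSpace_re_gt 0).isPreconnected

theorem measurable_floor_fun (g : ℕ → ℂ) : Measurable (fun t : ℝ => g ⌊t⌋₊) :=
  (measurable_from_nat (f := g)).comp Nat.measurable_floor

/-- integral representation of `L(s,χ)` for `re s > 0` -/
theorem LFunction_eq_integral {q : ℕ} [NeZero q] (χ : DirichletCharacter ℂ q) (hχ : χ ≠ 1) {s : ℂ}
    (hs : 0 < s.re) :
    χ.LFunction s = s * ∫ t in Set.Ioi (1 : ℝ), chiSum χ ⌊t⌋₊ * (t : ℂ) ^ (-(s + 1)) := by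
  have hd := differentiableOn_tail (fun t => chiSum χ ⌊t⌋₊) (measurable_floor_fun _) q
    (fun t => norm_chiSum_le χ hχ _)
  have hop : IsOpen {s : ℂ | 0 < s.re} := isOpen_lt continuous_const continuous_re
  have := AnalyticOnNhd.eqOn_of_preconnected_of_eventuallyEq (𝕜 := ℂ) (z₀ := (2 : ℂ))
    (f := χ.LFunction)
    (g := fun s => s * ∫ t in Set.Ioi (1 : ℝ), chiSum χ ⌊t⌋₊ * (t : ℂ) ^ (-(s + 1)))
    ((DirichletCharacter.differentiable_LFunction hχ).differentiableOn.analyticOnNhd hop)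
    ((differentiableOn_id.mul hd).analyticOnNhd hop) isPreconnected_re_pos (by simp) ?_
  · exact this hs
  · have hn : {s : ℂ | 1 < s.re} ∈ 𝓝 (2 : ℂ) :=
      (isOpen_lt continuous_const continuous_re).mem_nhds (by simp)
    filter_upwards [hn] with s hs
    have hs' : 1 < s.re := hs
    rw [DirichletCharacter.LFunction_eq_LSeries χ hs',
      LSeries_eq_mul_integral (fun n => χ n) (r := 0) le_rfl (by linarith)
        (χ.LSeriesSummable_of_one_lt_re hs')]
    · rfl
    · refine Asymptotics.IsBigO.of_bound q (Eventually.of_forall fun n => ?_)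
      have := norm_chiSum_le χ hχ n
      simpa [chiSum] using this

theorem norm_integral_tail_le (f : ℝ → ℂ) {C b : ℝ} (hC : ∀ t : ℝ, 1 < t → ‖f t‖ ≤ C * t ^ b) {s : ℂ}
    (hs : b < s.re) :
    ‖∫ t in Set.Ioi (1 : ℝ), f t * (t : ℂ) ^ (-(s + 1))‖ ≤ C / (s.re - b) := by
  have h1 : ‖∫ t in Set.Ioi (1 : ℝ), f t * (t : ℂ) ^ (-(s + 1))‖
      ≤ ∫ t in Set.Ioi (1 : ℝ), C * t ^ (b - s.re - 1) := by
    refine norm_integral_le_of_norm_le ((integrableOn_Ioi_rpow_of_lt (by linarith) one_pos).const_mul C) ?_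
    rw [ae_restrict_iff' measurableSet_Ioi]
    refine Eventually.of_forall fun t ht => ?_
    have ht' : 1 < t := ht
    rw [norm_mul, norm_cpow_eq_rpow_re_of_pos (by linarith)]
    have e : t ^ (b - s.re - 1) = t ^ b * t ^ (-(s + 1)).re := by
      rw [← Real.rpow_add (by linarith)]; congr 1; simp; ring
    rw [e, ← mul_assoc]
    gcongr
    exact hC t ht'
  refine h1.trans (le_of_eq ?_)
  rw [integral_const_mul, integral_Ioi_rpow_of_lt (by linarith) one_pos]
  simp only [Real.one_rpow]
  rw [show b - s.re - 1 + 1 = -(s.re - b) by ring, neg_div_neg_eq, mul_one_div]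

theorem norm_LFunction_le {q : ℕ} [NeZero q] (χ : DirichletCharacter ℂ q) (hχ : χ ≠ 1) {a : ℝ}
    (ha0 : 0 ≤ a) (ha1 : a ≤ 1) {s : ℂ} (hs : 1 - a < s.re) :
    ‖χ.LFunction s‖ ≤ ‖s‖ * ((q : ℝ) ^ a / (s.re + a - 1)) := by
  have hs0 : 0 < s.re := by linarith
  rw [LFunction_eq_integral χ hχ hs0, norm_mul]
  refine mul_le_mul_of_nonneg_left ?_ (norm_nonneg _)
  have hq : (0 : ℝ) < q := by exact_mod_cast NeZero.pos q
  refine (norm_integral_tail_le (C := (q : ℝ) ^ a) (b := 1 - a) _ ?_ hs).trans (le_of_eq ?_)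
  · intro t ht
    have h1 := norm_chiSum_le χ hχ ⌊t⌋₊
    have h2 : ‖chiSum χ ⌊t⌋₊‖ ≤ t := (norm_chiSum_le' χ ⌊t⌋₊).trans (Nat.floor_le (by linarith))
    have h3 : ‖chiSum χ ⌊t⌋₊‖ = ‖chiSum χ ⌊t⌋₊‖ ^ a * ‖chiSum χ ⌊t⌋₊‖ ^ (1 - a) := by
      rw [← Real.rpow_add' (norm_nonneg _) (by norm_num)]; simp
    rw [h3]
    gcongr
  · congr 1; ring

/-- bound for `(s-1) ζ(s)` -/
theorem norm_zeta₁_le {s : ℂ} (hs : 0 < s.re) :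
    ‖DirichletCharacter.LFunctionTrivChar₁ 1 s‖ ≤ ‖s‖ + ‖s‖ * ‖s - 1‖ / s.re := by
  have hd := differentiableOn_tail (fun t => ((Int.fract t : ℝ) : ℂ)) (by fun_prop) 1
    (fun t => by
      rw [norm_real, Real.norm_eq_abs, abs_of_nonneg (Int.fract_nonneg t)]
      exact (Int.fract_lt_one t).le)
  have hop : IsOpen {s : ℂ | 0 < s.re} := isOpen_lt continuous_const continuous_re
  have key := AnalyticOnNhd.eqOn_of_preconnected_of_eventuallyEq (𝕜 := ℂ) (z₀ := (2 : ℂ))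
    (f := DirichletCharacter.LFunctionTrivChar₁ 1)
    (g := fun s => s - s * (s - 1) * ∫ t in Set.Ioi (1 : ℝ), ((Int.fract t : ℝ) : ℂ) * (t : ℂ) ^ (-(s + 1)))
    ((DirichletCharacter.differentiable_LFunctionTrivChar₁ 1).differentiableOn.analyticOnNhd hop)
    ((differentiableOn_id.sub ((differentiableOn_id.mul (differentiableOn_id.sub_const 1)).mul hd)).analyticOnNhd hop)
    isPreconnected_re_pos (by simp) ?_
  · rw [key hs]
    refine (norm_sub_le _ _).trans ?_
    gcongr
    rw [norm_mul, norm_mul, mul_div_assoc]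
    refine mul_le_mul_of_nonneg_left ?_ (by positivity) |>.trans (le_of_eq (mul_div_assoc _ _ _))
    refine (norm_integral_tail_le (C := 1) (b := 0) _ ?_ hs).trans (le_of_eq ?_)
    · intro t ht
      rw [norm_real, Real.norm_eq_abs, abs_of_nonneg (Int.fract_nonneg t)]
      simpa using (Int.fract_lt_one t).le
    · simp
  · have hn : {s : ℂ | 1 < s.re} ∈ 𝓝 (2 : ℂ) :=
      (isOpen_lt continuous_const continuous_re).mem_nhds (by simp)
    filter_upwards [hn] with s hs
    have hs' : 1 < s.re := hs
    have hs1 : s ≠ 1 := by rintro rfl; simp at hs'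
    have hs1' : s - 1 ≠ 0 := sub_ne_zero.2 hs1
    rw [DirichletCharacter.LFunctionTrivChar₁, Function.update_of_ne hs1]
    have e1 : (1 : DirichletCharacter ℂ 1).LFunction s = riemannZeta s := by
      rw [DirichletCharacter.LFunction_modOne_eq]
    have e2 : riemannZeta s = s * ∫ t in Set.Ioi (1 : ℝ), (⌊t⌋₊ : ℂ) * (t : ℂ) ^ (-(s + 1)) := by
      rw [← LSeries_one_eq_riemannZeta hs',
        LSeries_eq_mul_integral 1 (r := 1) zero_le_one hs' (LSeriesSummable_one_iff.2 hs')]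
      · simp
      · refine Asymptotics.IsBigO.of_bound 1 (Eventually.of_forall fun n => ?_)
        simp
    have i1 : IntegrableOn (fun t : ℝ => (t : ℂ) ^ (-s)) (Set.Ioi 1) :=
      integrableOn_Ioi_cpow_of_lt (by simpa using hs') one_pos
    have i2 : IntegrableOn (fun t : ℝ => ((Int.fract t : ℝ) : ℂ) * (t : ℂ) ^ (-(s + 1))) (Set.Ioi 1) := by
      refine (integrableOn_Ioi_cpow_of_lt (a := -(s+1)) (by simp; linarith) one_pos).bdd_mul (c := 1) (by fun_prop) ?_
      refine Eventually.of_forall fun t => ?_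
      rw [norm_real, Real.norm_eq_abs, abs_of_nonneg (Int.fract_nonneg t)]
      exact (Int.fract_lt_one t).le
    have e3 : ∫ t in Set.Ioi (1 : ℝ), (⌊t⌋₊ : ℂ) * (t : ℂ) ^ (-(s + 1)) =
        (∫ t in Set.Ioi (1 : ℝ), (t : ℂ) ^ (-s)) -
          ∫ t in Set.Ioi (1 : ℝ), ((Int.fract t : ℝ) : ℂ) * (t : ℂ) ^ (-(s + 1)) := by
      rw [← integral_sub i1 i2]
      refine setIntegral_congr_fun measurableSet_Ioi fun t ht => ?_
      have ht' : (1 : ℝ) < t := ht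
      have ht0 : (t : ℂ) ≠ 0 := by exact_mod_cast (by linarith : t ≠ 0)
      have : (t : ℂ) ^ (-s) = (t : ℂ) * (t : ℂ) ^ (-(s + 1)) := by
        rw [show -s = 1 + (-(s + 1)) by ring, cpow_add _ _ ht0, cpow_one]
      simp only [this]
      rw [← sub_mul]
      congr 1
      have h5 : ((⌊t⌋₊ : ℕ) : ℝ) = t - Int.fract t := by
        rw [natCast_floor_eq_intCast_floor (by linarith), Int.self_sub_fract]
      rw [← ofReal_sub, ← h5]; simp
    have e4 : ∫ t in Set.Ioi (1 : ℝ), (t : ℂ) ^ (-s) = 1 / (s - 1) := by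
      rw [integral_Ioi_cpow_of_lt (by simpa using hs') one_pos]
      simp only [ofReal_one, one_cpow]
      rw [show -s + 1 = -(s - 1) by ring, neg_div_neg_eq]
    simp only [DirichletCharacter.LFunctionTrivChar]
    rw [e1, e2, e3, e4]
    field_simp

open Complex Metric

/-- Borel–Carathéodory for the logarithmic derivative of a zero-free function. -/
theorem logDeriv_le_of_zero_free {f : ℂ → ℂ} {R M : ℝ} (hR : 0 < R) (hM : 0 < M)
    (hf : DifferentiableOn ℂ f (ball 0 R)) (hne : ∀ z ∈ ball (0 : ℂ) R, f z ≠ 0)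
    (hb : ∀ z ∈ ball (0 : ℂ) R, ‖f z‖ ≤ Real.exp M * ‖f 0‖) {z : ℂ} (hz : ‖z‖ ≤ 3 / 4 * R) :
    ‖deriv f z / f z‖ ≤ 112 * M / R := by
  have h0 : (0 : ℂ) ∈ ball (0 : ℂ) R := by simpa using hR
  have hdf : DifferentiableOn ℂ (deriv f) (ball 0 R) := hf.deriv isOpen_ball
  obtain ⟨g, hg⟩ : ∃ g : ℂ → ℂ, ∀ w ∈ ball (0 : ℂ) R, HasDerivAt g (deriv f w / f w) w := by
    have := (hdf.div hf hne).isExactOn_ball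
    obtain ⟨g, hg⟩ := this
    exact ⟨g, fun w hw => by simpa using hg w hw⟩
  -- `exp (g - g 0) = f / f 0`
  have hexp : ∀ w ∈ ball (0 : ℂ) R, exp (g w - g 0) = f w / f 0 := by
    intro w hw
    have hconst : ∀ w ∈ ball (0 : ℂ) R, HasDerivAt (fun w => exp (-(g w)) * f w) 0 w := by
      intro w hw
      have h1 := ((hg w hw).neg.cexp).mul
        ((hf.differentiableAt (isOpen_ball.mem_nhds hw)).hasDerivAt)
      refine h1.congr_deriv ?_
      have := hne w hw
      simp only [Pi.neg_apply]
      field_simp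
      ring
    have := (convex_ball (0 : ℂ) R).is_const_of_fderivWithin_eq_zero (𝕜 := ℂ)
      (f := fun w => exp (-(g w)) * f w)
      (fun w hw => (hconst w hw).differentiableAt.differentiableWithinAt)
      (fun w hw => by
        have := (hconst w hw).hasFDerivAt.hasFDerivWithinAt.fderivWithin
          (isOpen_ball.uniqueDiffWithinAt hw) (s := ball (0:ℂ) R)
        rw [this]; ext; simp) hw h0
    have hf0 := hne 0 h0
    rw [eq_div_iff hf0, exp_sub]
    simp only [exp_neg] at this
    have e1 := exp_ne_zero (g w)
    have e2 := exp_ne_zero (g 0)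
    field_simp at this ⊢
    linear_combination -this
  have hB : ∀ w ∈ ball (0 : ℂ) R, ‖g w - g 0‖ ≤ 2 * M * ‖w‖ / (R - ‖w‖) := by
    intro w hw
    refine borelCaratheodory_zero (f := fun w => g w - g 0) hM ?_ ?_ hR hw (by simp)
    · exact fun w hw => ((hg w hw).differentiableAt.sub_const _).differentiableWithinAt
    · intro w hw
      have h1 : ‖exp (g w - g 0)‖ ≤ Real.exp M := by
        rw [hexp w hw, norm_div, div_le_iff₀ (norm_pos_iff.2 (hne 0 h0))]
        exact hb w hw
      rw [norm_exp] at h1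
      simpa using Real.exp_le_exp.1 h1
  have hzR : z ∈ ball (0 : ℂ) R := by simp; linarith
  have hsub : closedBall z (R / 8) ⊆ ball (0 : ℂ) R := by
    intro w hw
    simp only [mem_closedBall, mem_ball, dist_eq_norm, sub_zero] at hw ⊢
    have : ‖w‖ ≤ ‖w - z‖ + ‖z‖ := by simpa using norm_add_le (w - z) z
    linarith
  have hd : DifferentiableOn ℂ (fun w => g w - g 0) (closedBall z (R / 8)) :=
    fun w hw => ((hg w (hsub hw)).differentiableAt.sub_const _).differentiableWithinAt
  have hD := norm_deriv_le_of_forall_mem_sphere_norm_le (c := z) (R := R / 8) (C := 14 * M)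
    (f := fun w => g w - g 0) (by positivity)
    (by
      refine DifferentiableOn.diffContOnCl ?_
      rw [closure_ball z (by positivity)]; exact hd) (by
      intro w hw
      have hw' := hsub (sphere_subset_closedBall hw)
      refine (hB w hw').trans ?_
      have : ‖w‖ ≤ ‖w - z‖ + ‖z‖ := by simpa using norm_add_le (w - z) z
      have hw2 : ‖w - z‖ = R / 8 := by simpa [dist_eq_norm] using hw
      have hw3 : ‖w‖ ≤ 7 / 8 * R := by linarith
      rw [div_le_iff₀ (by linarith)]
      nlinarith)
  have hder : deriv (fun w => g w - g 0) z = deriv f z / f z := ((hg z hzR).sub_const _).deriv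
  rw [hder] at hD
  refine hD.trans (le_of_eq ?_)
  field_simp
  ring

/-- dividing out a zero by a Blaschke factor -/
theorem exists_blaschke_quotient {f : ℂ → ℂ} (hf : Differentiable ℂ f) {r B : ℝ} (hr : 0 < r)
    (hB : ∀ z, ‖z‖ = r → ‖f z‖ ≤ B) (h0 : f 0 ≠ 0) {w : ℂ} (hw : f w = 0) (hwr : ‖w‖ < r / 2) :
    ∃ g : ℂ → ℂ, Differentiable ℂ g ∧ (∀ z, ‖z‖ = r → ‖g z‖ ≤ B) ∧ 2 * ‖f 0‖ ≤ ‖g 0‖ ∧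
      (∀ z, ‖z‖ < r / 2 → g z = 0 → f z = 0) ∧
      (deriv f 0 / f 0).re = (deriv g 0 / g 0).re - w.re * (1 / ‖w‖ ^ 2 - 1 / r ^ 2) := by
  have hw0 : w ≠ 0 := by rintro rfl; exact h0 hw
  have hds : ∀ z, f z = (z - w) * dslope f w z := by
    intro z
    have := sub_smul_dslope f w z
    simp [hw] at this
    exact this.symm
  have hdd : Differentiable ℂ (dslope f w) := by
    rw [← differentiableOn_univ] at hf ⊢
    exact (differentiableOn_dslope Filter.univ_mem).2 hf
  refine ⟨fun z => dslope f w z * ((r ^ 2 - (starRingEnd ℂ) w * z) / r), ?_, ?_, ?_, ?_, ?_⟩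
  · fun_prop
  · intro z hz
    have hzw : z - w ≠ 0 := by
      intro h
      have : z = w := sub_eq_zero.1 h
      rw [this] at hz; linarith
    have := norm_canonicalFactor_eval_circle_eq_one (R := r) (w := w) (z := z)
      (by simp; linarith) (by simpa using hz)
    rw [canonicalFactor_apply, norm_div, norm_mul] at this
    have h1 : ‖f z‖ = ‖z - w‖ * ‖dslope f w z‖ := by rw [← norm_mul, ← hds]
    have h2 := hB z hz
    have h3 : 0 < ‖z - w‖ := norm_pos_iff.2 hzw
    have h4 : 0 < ‖(r : ℂ)‖ := by simpa using hr.ne'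
    rw [div_eq_one_iff_eq (by positivity)] at this
    rw [norm_mul, norm_div, this]
    rw [show ‖dslope f w z‖ * (‖(r : ℂ)‖ * ‖z - w‖ / ‖(r : ℂ)‖) = ‖z - w‖ * ‖dslope f w z‖ by
      field_simp]
    linarith
  · have h1 : ‖f 0‖ = ‖w‖ * ‖dslope f w 0‖ := by rw [← norm_neg w, ← norm_mul]; simpa using congrArg norm (hds 0)
    have h3 : 0 < ‖w‖ := norm_pos_iff.2 hw0
    simp only [mul_zero, sub_zero, norm_mul, norm_div, norm_pow, norm_real, Real.norm_eq_abs, abs_of_pos hr]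
    rw [h1, show ‖dslope f w 0‖ * (r ^ 2 / r) = r * ‖dslope f w 0‖ by field_simp]
    nlinarith [norm_nonneg (dslope f w 0)]
  · intro z hz hgz
    rcases mul_eq_zero.1 hgz with h | h
    · rw [hds, h, mul_zero]
    · exfalso
      rw [div_eq_zero_iff] at h
      rcases h with h | h
      · have : (r : ℂ) ^ 2 = (starRingEnd ℂ) w * z := sub_eq_zero.1 h
        have h5 := congrArg norm this
        simp [abs_of_pos hr] at h5
        nlinarith [norm_nonneg z, norm_nonneg w]
      · exact hr.ne' (by exact_mod_cast h)
  · have hd0 : dslope f w 0 ≠ 0 := by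
      intro h; apply h0; rw [hds, h, mul_zero]
    have hfd : deriv f 0 = dslope f w 0 + (0 - w) * deriv (dslope f w) 0 := by
      have h1 : HasDerivAt (fun z => (z - w) * dslope f w z)
          (1 * dslope f w 0 + (0 - w) * deriv (dslope f w) 0) 0 :=
        ((hasDerivAt_id (0 : ℂ)).sub_const w).mul (hdd 0).hasDerivAt
      rw [show f = fun z => (z - w) * dslope f w z from funext hds] 
      rw [h1.deriv, one_mul]
      rw [← show f = fun z => (z - w) * dslope f w z from funext hds] 
    have hgd : deriv (fun z => dslope f w z * ((r ^ 2 - (starRingEnd ℂ) w * z) / r)) 0 =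
        deriv (dslope f w) 0 * r + dslope f w 0 * (-(starRingEnd ℂ) w / r) := by
      have h2 : HasDerivAt (fun z : ℂ => ((r ^ 2 - (starRingEnd ℂ) w * z) / r)) (-(starRingEnd ℂ) w / r) 0 := by
        have := (((hasDerivAt_id (0 : ℂ)).const_mul ((starRingEnd ℂ) w)).const_sub ((r:ℂ)^2)).div_const (r:ℂ)
        simpa using this
      have h1 := ((hdd 0).hasDerivAt).mul h2
      refine h1.deriv.trans ?_
      have : (r : ℂ) ≠ 0 := by exact_mod_cast hr.ne'
      field_simp
      simp
    rw [hfd, hgd]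
    have hr' : (r : ℂ) ≠ 0 := by exact_mod_cast hr.ne'
    have e1 : (dslope f w 0 + (0 - w) * deriv (dslope f w) 0) / f 0
        = deriv (dslope f w) 0 / dslope f w 0 - w⁻¹ := by
      rw [hds 0]; field_simp; ring
    have e2 : (deriv (dslope f w) 0 * r + dslope f w 0 * (-(starRingEnd ℂ) w / r)) /
        (dslope f w 0 * ((r ^ 2 - (starRingEnd ℂ) w * 0) / r))
        = deriv (dslope f w) 0 / dslope f w 0 - (starRingEnd ℂ) w / (r ^ 2 : ℝ) := by
      push_cast
      field_simp; ring
    rw [e1, e2]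
    rw [sub_re, sub_re, inv_re, div_ofReal_re, conj_re, normSq_eq_norm_sq]
    ring

theorem neg_logDeriv_le_aux (r : ℝ) (hr : 0 < r) (B : ℝ) (k : ℕ) : ∀ f : ℂ → ℂ, Differentiable ℂ f →
    (∀ z, ‖z‖ = r → ‖f z‖ ≤ B) → f 0 ≠ 0 → (∀ z, ‖z‖ < r / 2 → f z = 0 → z.re ≤ 0) →
    B < 2 ^ k * ‖f 0‖ → ∀ M : ℝ, 0 < M → B ≤ Real.exp M * ‖f 0‖ →
    -(deriv f 0 / f 0).re ≤ 224 * M / r := by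
  have hmax : ∀ f : ℂ → ℂ, Differentiable ℂ f →
    (∀ z, ‖z‖ = r → ‖f z‖ ≤ B) → ∀ z, ‖z‖ ≤ r → ‖f z‖ ≤ B := by
    intro f hf hB z hz
    refine norm_le_of_forall_mem_frontier_norm_le (U := ball (0 : ℂ) r) isBounded_ball
      hf.diffContOnCl (fun z hz => hB z ?_) ?_
    · rw [frontier_ball _ hr.ne'] at hz; simpa using hz
    · rw [closure_ball _ hr.ne']; simpa using hz
  induction k with
  | zero =>
    intro f hf hB h0 hz hlt
    exfalso
    have := hmax f hf hB 0 (by simpa using hr.le)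
    simp at hlt; linarith
  | succ k ih =>
    intro f hf hB h0 hz hlt M hM hBM
    by_cases hzero : ∃ w, ‖w‖ < r / 2 ∧ f w = 0
    · obtain ⟨w, hwr, hw⟩ := hzero
      obtain ⟨g, hg, hgB, hg0, hgz, hre⟩ := exists_blaschke_quotient hf hr hB h0 hw hwr
      have hf0 : 0 < ‖f 0‖ := norm_pos_iff.2 h0
      have hg0' : g 0 ≠ 0 := norm_pos_iff.1 (by linarith)
      have := ih g hg hgB hg0' (fun z hz1 hz2 => hz z hz1 (hgz z hz1 hz2))
        (lt_of_lt_of_le hlt (by rw [pow_succ]; nlinarith [pow_pos (two_pos (α := ℝ)) k])) M hM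
        (hBM.trans (by gcongr; linarith))
      rw [hre]
      have hwre := hz w hwr hw
      have hw0 : 0 < ‖w‖ := norm_pos_iff.2 (by rintro rfl; exact h0 hw)
      have : 0 ≤ 1 / ‖w‖ ^ 2 - 1 / r ^ 2 := by
        rw [sub_nonneg]
        apply one_div_le_one_div_of_le (by positivity)
        gcongr; linarith
      nlinarith
    · push Not at hzero
      have := logDeriv_le_of_zero_free (f := f) (R := r / 2) (M := M) (by positivity) hM
        hf.differentiableOn (fun z hz => hzero z (by simpa using hz))
        (fun z hz => (hmax f hf hB z (by simp at hz; linarith)).trans hBM) (z := 0) (by simp; positivity)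
      have h2 := (abs_re_le_norm (deriv f 0 / f 0))
      have h3 := neg_le_abs (deriv f 0 / f 0).re
      calc _ ≤ 112 * M / (r / 2) := by linarith
        _ = _ := by field_simp; ring

/-- Lemma A, no zeros kept. -/
theorem neg_logDeriv_le {f : ℂ → ℂ} (hf : Differentiable ℂ f) {r B M : ℝ} (hr : 0 < r)
    (hB : ∀ z, ‖z‖ = r → ‖f z‖ ≤ B) (h0 : f 0 ≠ 0) (hz : ∀ z, ‖z‖ < r / 2 → f z = 0 → z.re ≤ 0)
    (hM : 0 < M) (hBM : B ≤ Real.exp M * ‖f 0‖) :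
    -(deriv f 0 / f 0).re ≤ 224 * M / r := by
  have hf0 : 0 < ‖f 0‖ := norm_pos_iff.2 h0
  obtain ⟨k, hk⟩ := pow_unbounded_of_one_lt (B / ‖f 0‖) (one_lt_two (α := ℝ))
  rw [div_lt_iff₀ hf0] at hk
  exact neg_logDeriv_le_aux r hr B k f hf hB h0 hz hk M hM hBM

/-- Lemma A, one zero kept. -/
theorem neg_logDeriv_le_of_zero {f : ℂ → ℂ} (hf : Differentiable ℂ f) {r B M : ℝ} (hr : 0 < r)
    (hB : ∀ z, ‖z‖ = r → ‖f z‖ ≤ B) (h0 : f 0 ≠ 0) (hz : ∀ z, ‖z‖ < r / 2 → f z = 0 → z.re ≤ 0)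
    (hM : 0 < M) (hBM : B ≤ Real.exp M * ‖f 0‖) {d : ℝ} (hd : 0 < d) (hdr : d < r / 2)
    (hfd : f (-d) = 0) :
    -(deriv f 0 / f 0).re ≤ 224 * M / r - 1 / d + d / r ^ 2 := by
  obtain ⟨g, hg, hgB, hg0, hgz, hre⟩ := exists_blaschke_quotient hf hr hB h0 hfd
    (by simpa [abs_of_pos hd] using hdr)
  have hf0 : 0 < ‖f 0‖ := norm_pos_iff.2 h0
  have := neg_logDeriv_le hg hr hgB (norm_pos_iff.1 (by linarith))
    (fun z hz1 hz2 => hz z hz1 (hgz z hz1 hz2)) hM (hBM.trans (by gcongr; linarith))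
  rw [hre]
  simp only [norm_neg, norm_real, Real.norm_eq_abs, sq_abs, neg_re, ofReal_re]
  have : d * (1 / d ^ 2 - 1 / r ^ 2) = 1 / d - d / r ^ 2 := by field_simp
  linarith

open Complex Filter Topology MeasureTheory

/-- the real number `- Re L'/L(σ+it, χ)` -/
noncomputable def vK {q : ℕ} [NeZero q] (χ : DirichletCharacter ℂ q) (σ t : ℝ) : ℝ :=
  -(deriv χ.LFunction (σ + t * I) / χ.LFunction (σ + t * I)).re

theorem hasSum_vK {q : ℕ} [NeZero q] (χ : DirichletCharacter ℂ q) {σ : ℝ} (hσ : 1 < σ) (t : ℝ) :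
    HasSum (fun n : ℕ => ArithmeticFunction.vonMangoldt n * (n : ℝ) ^ (-σ) *
      (χ n * (n : ℂ) ^ (-(t * I))).re) (vK χ σ t) := by
  have hs : 1 < ((σ : ℂ) + t * I).re := by simpa using hσ
  have h := (DirichletCharacter.LSeriesSummable_twist_vonMangoldt χ hs).hasSum
  have h2 := Complex.hasSum_re h
  have e : ∑' n, LSeries.term ((fun n : ℕ => χ n) * fun n => ((ArithmeticFunction.vonMangoldt n : ℝ) : ℂ)) (σ + t * I) n
      = -(deriv χ.LFunction (σ + t * I) / χ.LFunction (σ + t * I)) := by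
    have := DirichletCharacter.LSeries_twist_vonMangoldt_eq χ hs
    rw [LSeries] at this
    rw [this, DirichletCharacter.deriv_LFunction_eq_deriv_LSeries χ hs, DirichletCharacter.LFunction_eq_LSeries χ hs,
      neg_div]
  rw [e, neg_re] at h2
  rw [vK]
  convert h2 using 2 with n
  rcases eq_or_ne n 0 with rfl | hn
  · simp
  · rw [LSeries.term_of_ne_zero hn, div_eq_mul_inv, ← cpow_neg,
      show -((σ : ℂ) + t * I) = ((-σ : ℝ) : ℂ) + (-(t * I)) by push_cast; ring,
      cpow_add _ _ (by exact_mod_cast hn), ← ofReal_natCast, ← ofReal_cpow (by positivity)]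
    simp only [Pi.mul_apply]
    rw [← re_ofReal_mul]
    congr 1
    push_cast; ring

theorem norm_LFunction_ge {q : ℕ} [NeZero q] (χ : DirichletCharacter ℂ q) {s : ℂ} (hs : 1 < s.re)
    (hs2 : s.re ≤ 2) : (s.re - 1) / 3 ≤ ‖χ.LFunction s‖ := by
  have h1 := DirichletCharacter.LSeries.mul_mu_eq_one χ hs
  rw [← DirichletCharacter.LFunction_eq_LSeries χ hs] at h1
  set m := LSeries ((fun n : ℕ => χ n) * fun n => (ArithmeticFunction.moebius n : ℂ)) s with hm
  have hsum : Summable (fun n : ℕ => 1 / (n : ℝ) ^ s.re) := Real.summable_one_div_nat_rpow.2 hs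
  have hz : riemannZeta (s.re : ℂ) = ((∑' n : ℕ, 1 / (n : ℝ) ^ s.re : ℝ) : ℂ) := by
    rw [zeta_eq_tsum_one_div_nat_cpow (by simpa using hs)]
    push_cast
    congr 1; funext n
    rw [ofReal_cpow (by positivity)]; simp
  have hb : ‖m‖ ≤ ∑' n : ℕ, 1 / (n : ℝ) ^ s.re := by
    rw [hm, LSeries]
    refine tsum_of_norm_bounded hsum.hasSum fun n => ?_
    rw [LSeries.norm_term_eq]
    split_ifs with h0
    · positivity
    · gcongr
      simp only [Pi.mul_apply, norm_mul]
      refine mul_le_one₀ (χ.norm_le_one _) (norm_nonneg _) ?_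
      rw [norm_intCast]
      exact_mod_cast ArithmeticFunction.abs_moebius_le_one
  have hz2 : (s.re - 1) * ∑' n : ℕ, 1 / (n : ℝ) ^ s.re ≤ 3 := by
    have h3 := norm_zeta₁_le (s := (s.re : ℂ)) (by simp; linarith)
    have hne : (s.re : ℂ) ≠ 1 := by exact_mod_cast hs.ne'
    rw [DirichletCharacter.LFunctionTrivChar₁, Function.update_of_ne hne, DirichletCharacter.LFunctionTrivChar,
      DirichletCharacter.LFunction_modOne_eq, hz, norm_mul, norm_real] at h3
    have e1 : ‖(s.re : ℂ) - 1‖ = s.re - 1 := by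
      rw [← ofReal_one, ← ofReal_sub, norm_real, Real.norm_eq_abs, abs_of_pos (by linarith)]
    rw [e1, norm_real, Real.norm_eq_abs, Real.norm_eq_abs, abs_of_pos (by linarith : 0 < s.re),
      abs_of_nonneg (tsum_nonneg fun n => by positivity), ofReal_re, mul_div_right_comm, div_self (by linarith : s.re ≠ 0)] at h3
    linarith
  have h4 : ‖χ.LFunction s‖ * ‖m‖ = 1 := by rw [← norm_mul, h1, norm_one]
  have h5 : 0 ≤ ‖χ.LFunction s‖ := norm_nonneg _
  have h6 : (s.re - 1) * ‖m‖ ≤ 3 := (mul_le_mul_of_nonneg_left hb (by linarith)).trans hz2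
  have h7 := mul_le_mul_of_nonneg_left h6 h5
  nlinarith

theorem exists_vK_one_le : ∃ C : ℝ, 0 < C ∧ ∀ σ : ℝ, 1 < σ → σ ≤ 2 →
    vK (1 : DirichletCharacter ℂ 1) σ 0 ≤ 1 / (σ - 1) + C := by
  have h := (DirichletCharacter.continuousOn_neg_logDeriv_LFunctionTrivChar₁ 1)
  have hc : ContinuousOn (fun σ : ℝ => ‖-deriv (DirichletCharacter.LFunctionTrivChar₁ 1) (σ : ℂ) /
      DirichletCharacter.LFunctionTrivChar₁ 1 (σ : ℂ)‖) (Set.Icc 1 2) := by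
    refine ContinuousOn.norm (h.comp continuous_ofReal.continuousOn ?_)
    intro σ hσ
    by_cases h1 : (σ : ℂ) = 1
    · exact Or.inl h1
    · exact Or.inr (DirichletCharacter.LFunction_ne_zero_of_one_le_re _ (Or.inr h1) (by simpa using hσ.1))
  obtain ⟨C, hC⟩ := isCompact_Icc.bddAbove_image hc
  refine ⟨max C 1, by positivity, fun σ h1 h2 => ?_⟩
  have hb := hC ⟨σ, ⟨h1.le, h2⟩, rfl⟩
  have hne : (σ : ℂ) ≠ 1 := by exact_mod_cast h1.ne'
  have hne' : (σ : ℂ) - 1 ≠ 0 := sub_ne_zero.2 hne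
  have hL : (DirichletCharacter.LFunctionTrivChar 1) (σ : ℂ) ≠ 0 :=
    DirichletCharacter.LFunction_ne_zero_of_one_le_re _ (Or.inr hne) (by simpa using h1.le)
  simp only at hb
  rw [DirichletCharacter.deriv_LFunctionTrivChar₁_apply_of_ne_one 1 hne, DirichletCharacter.LFunctionTrivChar₁, Function.update_of_ne hne] at hb
  have e : -((σ - 1) * deriv (DirichletCharacter.LFunctionTrivChar 1) σ + DirichletCharacter.LFunctionTrivChar 1 σ) /
      ((σ - 1) * DirichletCharacter.LFunctionTrivChar 1 (σ : ℂ)) =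
      -(deriv (DirichletCharacter.LFunctionTrivChar 1) σ / DirichletCharacter.LFunctionTrivChar 1 (σ : ℂ)) - ((1 / (σ - 1) : ℝ) : ℂ) := by
    push_cast; field_simp; ring
  rw [e] at hb
  have h8 := (re_le_norm _).trans hb
  rw [sub_re, neg_re, ofReal_re] at h8
  rw [vK]
  simp only [ofReal_zero, zero_mul, add_zero]
  have := le_max_left C 1
  change -(deriv (DirichletCharacter.LFunctionTrivChar 1) (σ:ℂ) / DirichletCharacter.LFunctionTrivChar 1 (σ : ℂ)).re ≤ _
  linarith

/-- on the disc of radius 1/2 -/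
theorem norm_le_on_disc {q : ℕ} [NeZero q] (χ : DirichletCharacter ℂ q) (hχ : χ ≠ 1) {σ t : ℝ}
    (h1 : 1 < σ) (h2 : σ ≤ 2) {z : ℂ} (hz : ‖z‖ ≤ 1 / 2) :
    ‖χ.LFunction (σ + t * I + z)‖ ≤ 2 * q * (|t| + 3) := by
  have hre : |z.re| ≤ 1 / 2 := (abs_re_le_norm z).trans hz
  have hre' := abs_le.1 hre
  have e : ((σ : ℂ) + t * I + z).re = σ + z.re := by simp
  have hb := norm_LFunction_le χ hχ (a := 1) zero_le_one le_rfl (s := σ + t * I + z) (by rw [e]; linarith)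
  have hn : ‖(σ : ℂ) + t * I + z‖ ≤ |t| + 3 := by
    refine (norm_add₃_le).trans ?_
    have e1 : ‖(t : ℂ) * I‖ = |t| := by simp
    have e2 : ‖(σ : ℂ)‖ = σ := by simp [abs_of_pos (by linarith : 0 < σ)]
    rw [e1, e2]; linarith
  refine hb.trans ?_
  rw [Real.rpow_one, e]
  have hq : (0 : ℝ) ≤ q := by positivity
  have : (q : ℝ) / (σ + z.re + 1 - 1) ≤ 2 * q := by
    rw [div_le_iff₀ (by linarith)]; nlinarith
  calc _ ≤ (|t| + 3) * (2 * q) := mul_le_mul hn this (div_nonneg hq (by linarith)) (by positivity)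
    _ = _ := by ring

theorem deriv_shift (f : ℂ → ℂ) (s : ℂ) : deriv (fun z => f (s + z)) 0 = deriv f s := by
  rw [deriv_comp_const_add, add_zero]

theorem vK_le {q : ℕ} [NeZero q] (χ : DirichletCharacter ℂ q) (hχ : χ ≠ 1) {σ t M : ℝ}
    (h1 : 1 < σ) (h2 : σ ≤ 2) (hM : 0 < M) (hM' : 6 * q * (|t| + 3) / (σ - 1) ≤ Real.exp M) :
    vK χ σ t ≤ 448 * M := by
  have hre : ((σ : ℂ) + t * I).re = σ := by simp
  have h := neg_logDeriv_le (f := fun z => χ.LFunction (σ + t * I + z)) (r := 1 / 2)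
    (B := 2 * q * (|t| + 3)) (M := M)
    ((DirichletCharacter.differentiable_LFunction hχ).comp (by fun_prop)) (by norm_num)
    (fun z hz => norm_le_on_disc χ hχ h1 h2 hz.le)
    (by
      rw [add_zero]
      exact DirichletCharacter.LFunction_ne_zero_of_one_le_re _ (Or.inl hχ) (by rw [hre]; exact h1.le))
    (by
      intro z _ hz
      by_contra hcon
      push Not at hcon
      exact DirichletCharacter.LFunction_ne_zero_of_one_le_re _ (Or.inl hχ) (by simp; linarith) hz)
    hM (by
      have hL := norm_LFunction_ge χ (s := σ + t * I) (by rw [hre]; exact h1) (by rw [hre]; exact h2)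
      rw [hre] at hL
      simp only [add_zero]
      calc 2 * (q : ℝ) * (|t| + 3) = 6 * q * (|t| + 3) / (σ - 1) * ((σ - 1) / 3) := by
            have : σ - 1 ≠ 0 := by linarith
            field_simp; ring
        _ ≤ _ := mul_le_mul hM' hL (by linarith) (Real.exp_pos _).le)
  rw [deriv_shift χ.LFunction] at h
  simp only [add_zero] at h
  rw [vK]; linarith

theorem vK_le_of_zero {q : ℕ} [NeZero q] (χ : DirichletCharacter ℂ q) (hχ : χ ≠ 1) {σ t M β : ℝ}
    (h1 : 1 < σ) (h2 : σ ≤ 2) (hM : 0 < M) (hM' : 6 * q * (|t| + 3) / (σ - 1) ≤ Real.exp M)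
    (hβ : β < σ) (hβ' : σ - 1 / 4 < β) (hz : χ.LFunction (β + t * I) = 0) :
    vK χ σ t ≤ 448 * M - 1 / (σ - β) + 1 := by
  have hre : ((σ : ℂ) + t * I).re = σ := by simp
  have h := neg_logDeriv_le_of_zero (f := fun z => χ.LFunction (σ + t * I + z)) (r := 1 / 2)
    (B := 2 * q * (|t| + 3)) (M := M)
    ((DirichletCharacter.differentiable_LFunction hχ).comp (by fun_prop)) (by norm_num)
    (fun z hz => norm_le_on_disc χ hχ h1 h2 hz.le)
    (by
      rw [add_zero]
      exact DirichletCharacter.LFunction_ne_zero_of_one_le_re _ (Or.inl hχ) (by rw [hre]; exact h1.le))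
    (by
      intro z _ hz
      by_contra hcon
      push Not at hcon
      exact DirichletCharacter.LFunction_ne_zero_of_one_le_re _ (Or.inl hχ) (by simp; linarith) hz)
    hM (by
      have hL := norm_LFunction_ge χ (s := σ + t * I) (by rw [hre]; exact h1) (by rw [hre]; exact h2)
      rw [hre] at hL
      simp only [add_zero]
      calc 2 * (q : ℝ) * (|t| + 3) = 6 * q * (|t| + 3) / (σ - 1) * ((σ - 1) / 3) := by
            have : σ - 1 ≠ 0 := by linarith
            field_simp; ring
        _ ≤ _ := mul_le_mul hM' hL (by linarith) (Real.exp_pos _).le)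
    (d := σ - β) (by linarith) (by linarith)
    (by rw [← hz]; congr 1; push_cast; ring)
  rw [deriv_shift χ.LFunction] at h
  simp only [add_zero] at h
  have h10 : (σ - β) / (1 / 2) ^ 2 ≤ 1 := by norm_num; linarith
  rw [vK]; linarith

theorem vK_one_le {σ t M : ℝ}
    (h1 : 1 < σ) (h2 : σ ≤ 2) (hM : 0 < M) (hM' : 9 * (|t| + 3) ^ 2 / (σ - 1) ^ 2 ≤ Real.exp M) :
    vK (1 : DirichletCharacter ℂ 1) σ t ≤ 448 * M + (σ - 1) / ((σ - 1) ^ 2 + t ^ 2) := by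
  set s : ℂ := σ + t * I with hs
  have hre : s.re = σ := by simp [hs]
  have hne : ∀ w : ℂ, 1 ≤ w.re → DirichletCharacter.LFunctionTrivChar₁ 1 w ≠ 0 := by
    intro w hw
    by_cases hw1 : w = 1
    · rw [hw1]; exact DirichletCharacter.LFunctionTrivChar₁_apply_one_ne_zero 1
    · rw [DirichletCharacter.LFunctionTrivChar₁, Function.update_of_ne hw1]
      exact mul_ne_zero (sub_ne_zero.2 hw1)
        (DirichletCharacter.LFunction_ne_zero_of_one_le_re _ (Or.inr hw1) hw)
  have hs1 : s ≠ 1 := by intro h; rw [h] at hre; simp at hre; linarith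
  have hs1' : s - 1 ≠ 0 := sub_ne_zero.2 hs1
  have hns : (σ - 1) ≤ ‖s - 1‖ := by
    have := re_le_norm (s - 1)
    rw [sub_re, hre] at this; simpa using this
  have h := neg_logDeriv_le (f := fun z => DirichletCharacter.LFunctionTrivChar₁ 1 (s + z)) (r := 1 / 2)
    (B := 3 * (|t| + 3) ^ 2) (M := M)
    ((DirichletCharacter.differentiable_LFunctionTrivChar₁ 1).comp (by fun_prop)) (by norm_num)
    (by
      intro z hz
      have hzre : |z.re| ≤ 1 / 2 := (abs_re_le_norm z).trans hz.le
      have hre' := abs_le.1 hzre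
      have e : (s + z).re = σ + z.re := by simp [hre]
      refine (norm_zeta₁_le (by rw [e]; linarith)).trans ?_
      rw [e]
      have e1 : ‖(t : ℂ) * I‖ = |t| := by simp
      have e2 : ‖(σ : ℂ)‖ = σ := by simp [abs_of_pos (by linarith : 0 < σ)]
      have hn : ‖s + z‖ ≤ |t| + 3 := by
        refine (norm_add₃_le).trans ?_
        rw [e1, e2]; linarith
      have hn1 : ‖s + z - 1‖ ≤ |t| + 2 := by
        have : s + z - 1 = ((σ - 1 : ℝ) : ℂ) + t * I + z := by rw [hs]; push_cast; ring
        rw [this]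
        refine (norm_add₃_le).trans ?_
        rw [e1, hz, norm_real, Real.norm_eq_abs, abs_of_pos (by linarith)]; linarith
      have ht := abs_nonneg t
      have : ‖s + z‖ * ‖s + z - 1‖ / (σ + z.re) ≤ 2 * ((|t| + 3) * (|t| + 2)) := by
        rw [div_le_iff₀ (by linarith)]
        have : ‖s + z‖ * ‖s + z - 1‖ ≤ (|t| + 3) * (|t| + 2) := by gcongr
        nlinarith [mul_nonneg (by linarith : 0 ≤ |t| + 3) (by linarith : 0 ≤ |t| + 2)]
      nlinarith)
    (by rw [add_zero]; exact hne _ (by rw [hre]; exact h1.le))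
    (by
      intro z _ hz
      by_contra hcon
      push Not at hcon
      exact hne _ (by simp only [add_re, hre]; linarith) hz)
    hM (by
      have hL := norm_LFunction_ge (1 : DirichletCharacter ℂ 1) (s := s) (by rw [hre]; exact h1) (by rw [hre]; exact h2)
      rw [hre] at hL
      simp only [add_zero]
      rw [DirichletCharacter.LFunctionTrivChar₁, Function.update_of_ne hs1, norm_mul]
      have h9 : (σ - 1) * ((σ - 1) / 3) ≤ ‖s - 1‖ * ‖DirichletCharacter.LFunctionTrivChar 1 s‖ :=
        mul_le_mul hns hL (by linarith) (norm_nonneg _)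
      calc 3 * (|t| + 3) ^ 2 = 9 * (|t| + 3) ^ 2 / (σ - 1) ^ 2 * ((σ - 1) * ((σ - 1) / 3)) := by
            have : σ - 1 ≠ 0 := by linarith
            field_simp; ring
        _ ≤ _ := mul_le_mul hM' h9 (by nlinarith) (Real.exp_pos _).le)
  rw [deriv_shift (DirichletCharacter.LFunctionTrivChar₁ 1)] at h
  simp only [add_zero] at h
  rw [DirichletCharacter.deriv_LFunctionTrivChar₁_apply_of_ne_one 1 hs1, DirichletCharacter.LFunctionTrivChar₁,
    Function.update_of_ne hs1] at h
  have hL : (DirichletCharacter.LFunctionTrivChar 1) s ≠ 0 :=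
    DirichletCharacter.LFunction_ne_zero_of_one_le_re _ (Or.inr hs1) (by rw [hre]; exact h1.le)
  have e : ((s - 1) * deriv (DirichletCharacter.LFunctionTrivChar 1) s + DirichletCharacter.LFunctionTrivChar 1 s) /
      ((s - 1) * DirichletCharacter.LFunctionTrivChar 1 s) =
      (deriv (DirichletCharacter.LFunctionTrivChar 1) s / DirichletCharacter.LFunctionTrivChar 1 s) + (s - 1)⁻¹ := by
    field_simp
  rw [e, add_re, inv_re] at h
  have e5 : normSq (s - 1) = (σ - 1) ^ 2 + t ^ 2 := by
    rw [normSq_apply]; simp [hs]; ring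
  rw [e5, sub_re, hre, one_re] at h
  rw [vK, ← hs]
  change -(deriv (DirichletCharacter.LFunctionTrivChar 1) s / DirichletCharacter.LFunctionTrivChar 1 s).re ≤ _
  linarith

open Complex Filter Topology MeasureTheory

theorem changeLevel_natCast {n m : ℕ} (χ : DirichletCharacter ℂ n) (h : n ∣ m) {k : ℕ} (hk : k.Coprime m) :
    DirichletCharacter.changeLevel h χ (k : ZMod m) = χ (k : ZMod n) := by
  obtain ⟨u, hu⟩ := (ZMod.isUnit_iff_coprime k m).2 hk
  rw [← hu, DirichletCharacter.changeLevel_eq_cast_of_dvd, hu, ZMod.cast_natCast h]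

theorem char_eq_zero {n : ℕ} (χ : DirichletCharacter ℂ n) {k : ℕ} (hk : ¬ k.Coprime n) :
    χ (k : ZMod n) = 0 :=
  MulChar.map_nonunit χ (fun h => hk ((ZMod.isUnit_iff_coprime k n).1 h))

theorem char_inv_eq_conj {n : ℕ} [NeZero n] (χ : DirichletCharacter ℂ n) (a : ZMod n) :
    χ⁻¹ a = (starRingEnd ℂ) (χ a) :=
  (MulChar.star_apply' χ a).symm

/-- the product character -/
noncomputable def prodChar {q₁ q₂ : ℕ} (χ₁ : DirichletCharacter ℂ q₁) (χ₂ : DirichletCharacter ℂ q₂) :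
    DirichletCharacter ℂ (q₁ * q₂) :=
  DirichletCharacter.changeLevel (dvd_mul_right q₁ q₂) χ₁ *
    (DirichletCharacter.changeLevel (dvd_mul_left q₂ q₁) χ₂)⁻¹

theorem prodChar_apply {q₁ q₂ : ℕ} [NeZero q₁] [NeZero q₂] (χ₁ : DirichletCharacter ℂ q₁)
    (χ₂ : DirichletCharacter ℂ q₂) (k : ℕ) :
    prodChar χ₁ χ₂ (k : ZMod (q₁ * q₂)) = χ₁ (k : ZMod q₁) * (starRingEnd ℂ) (χ₂ (k : ZMod q₂)) := by
  by_cases h : k.Coprime (q₁ * q₂)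
  · rw [prodChar, MulChar.mul_apply, char_inv_eq_conj, changeLevel_natCast _ _ h, changeLevel_natCast _ _ h]
  · rw [char_eq_zero _ h]
    rw [Nat.coprime_mul_iff_right] at h
    by_cases h1 : k.Coprime q₁
    · rw [char_eq_zero χ₂ (fun h2 => h ⟨h1, h2⟩)]; simp
    · rw [char_eq_zero χ₁ h1]; simp

theorem two_char_pos {q₁ q₂ : ℕ} [NeZero q₁] [NeZero q₂] (χ₁ : DirichletCharacter ℂ q₁)
    (χ₂ : DirichletCharacter ℂ q₂) {σ : ℝ} (hσ : 1 < σ) (γ₁ γ₂ : ℝ) :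
    0 ≤ 3 * vK (1 : DirichletCharacter ℂ 1) σ 0 + 2 * vK χ₁ σ γ₁ + 2 * vK χ₂ σ γ₂
      + 2 * vK (prodChar χ₁ χ₂) σ (γ₁ - γ₂) := by
  have h := ((((hasSum_vK (1 : DirichletCharacter ℂ 1) hσ 0).mul_left 3).add
    ((hasSum_vK χ₁ hσ γ₁).mul_left 2)).add ((hasSum_vK χ₂ hσ γ₂).mul_left 2)).add
    ((hasSum_vK (prodChar χ₁ χ₂) hσ (γ₁ - γ₂)).mul_left 2)
  refine h.nonneg fun n => ?_
  rcases Nat.eq_zero_or_pos n with rfl | hn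
  · simp
  set w₁ : ℂ := (n : ℂ) ^ (-(γ₁ * I)) with hw₁
  set w₂ : ℂ := (n : ℂ) ^ (-(γ₂ * I)) with hw₂
  have hn0 : (n : ℂ) ≠ 0 := by exact_mod_cast hn.ne'
  have n1 : ‖w₁‖ = 1 := by rw [hw₁, norm_natCast_cpow_of_pos hn]; simp
  have n2 : ‖w₂‖ = 1 := by rw [hw₂, norm_natCast_cpow_of_pos hn]; simp
  have e3 : (n : ℂ) ^ (-(((γ₁ - γ₂ : ℝ) : ℂ) * I)) = w₁ * (starRingEnd ℂ) w₂ := by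
    rw [← inv_eq_conj n2, hw₁, hw₂, ← cpow_neg, ← cpow_add _ _ hn0]
    congr 1; push_cast; ring
  have e1 : (1 : DirichletCharacter ℂ 1) (n : ZMod 1) = 1 :=
    MulChar.one_apply (isUnit_of_subsingleton _)
  rw [e3, prodChar_apply, e1]
  simp only [ofReal_zero, zero_mul, neg_zero, cpow_zero, mul_one, one_re]
  set f₁ := χ₁ (n : ZMod q₁) * w₁ with hf₁
  set f₂ := χ₂ (n : ZMod q₂) * w₂ with hf₂
  have m1 : ‖f₁‖ ≤ 1 := by rw [hf₁, norm_mul, n1, mul_one]; exact χ₁.norm_le_one _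
  have m2 : ‖f₂‖ ≤ 1 := by rw [hf₂, norm_mul, n2, mul_one]; exact χ₂.norm_le_one _
  have e4 : χ₁ (n : ZMod q₁) * (starRingEnd ℂ) (χ₂ (n : ZMod q₂)) * (w₁ * (starRingEnd ℂ) w₂)
      = f₁ * (starRingEnd ℂ) f₂ := by
    rw [hf₁, hf₂, map_mul]; ring
  rw [e4]
  have k1 : f₁.re ^ 2 + f₁.im ^ 2 ≤ 1 := by
    have := normSq_eq_norm_sq f₁
    rw [normSq_apply] at this
    nlinarith [norm_nonneg f₁]
  have k2 : f₂.re ^ 2 + f₂.im ^ 2 ≤ 1 := by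
    have := normSq_eq_norm_sq f₂
    rw [normSq_apply] at this
    nlinarith [norm_nonneg f₂]
  have k3 : (f₁ * (starRingEnd ℂ) f₂).re = f₁.re * f₂.re + f₁.im * f₂.im := by simp
  rw [k3]
  have hL : 0 ≤ ArithmeticFunction.vonMangoldt n * (n : ℝ) ^ (-σ) :=
    mul_nonneg ArithmeticFunction.vonMangoldt_nonneg (by positivity)
  have : 0 ≤ 3 + 2 * f₁.re + 2 * f₂.re + 2 * (f₁.re * f₂.re + f₁.im * f₂.im) := by
    nlinarith [sq_nonneg (1 + f₁.re + f₂.re), sq_nonneg (f₁.im + f₂.im)]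
  nlinarith [mul_nonneg hL this]

theorem real_char_pos {q : ℕ} [NeZero q] (χ : DirichletCharacter ℂ q) (hχ : χ ^ 2 = 1)
    {σ : ℝ} (hσ : 1 < σ) (γ : ℝ) :
    0 ≤ 3 * vK (1 : DirichletCharacter ℂ 1) σ 0 + 4 * vK χ σ γ + vK (1 : DirichletCharacter ℂ 1) σ (2 * γ) := by
  have h := ((((hasSum_vK (1 : DirichletCharacter ℂ 1) hσ 0).mul_left 3).add
    ((hasSum_vK χ hσ γ).mul_left 4)).add (hasSum_vK (1 : DirichletCharacter ℂ 1) hσ (2 * γ)))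
  refine h.nonneg fun n => ?_
  rcases Nat.eq_zero_or_pos n with rfl | hn
  · simp
  set w : ℂ := (n : ℂ) ^ (-(γ * I)) with hw
  have hn0 : (n : ℂ) ≠ 0 := by exact_mod_cast hn.ne'
  have n1 : ‖w‖ = 1 := by rw [hw, norm_natCast_cpow_of_pos hn]; simp
  have e3 : (n : ℂ) ^ (-(((2 * γ : ℝ) : ℂ) * I)) = w * w := by
    rw [hw, ← cpow_add _ _ hn0]
    congr 1; push_cast; ring
  have e1 : (1 : DirichletCharacter ℂ 1) (n : ZMod 1) = 1 :=
    MulChar.one_apply (isUnit_of_subsingleton _)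
  rw [e3, e1]
  simp only [ofReal_zero, zero_mul, neg_zero, cpow_zero, mul_one, one_mul, one_re]
  have hL : 0 ≤ ArithmeticFunction.vonMangoldt n * (n : ℝ) ^ (-σ) :=
    mul_nonneg ArithmeticFunction.vonMangoldt_nonneg (by positivity)
  have k1 : w.re ^ 2 + w.im ^ 2 = 1 := by
    have := normSq_eq_norm_sq w
    rw [normSq_apply, n1] at this
    linarith
  have : 0 ≤ 3 + 4 * (χ (n : ZMod q) * w).re + (w * w).re := by
    rw [mul_re w w]
    by_cases hc : n.Coprime q
    · have hs : (χ (n : ZMod q)) ^ 2 = 1 := by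
        rw [← MulChar.pow_apply' χ two_ne_zero, hχ]
        exact MulChar.one_apply ((ZMod.isUnit_iff_coprime n q).2 hc)
      rcases mul_self_eq_one_iff.1 ((sq _).symm.trans hs) with h1 | h1
      · rw [h1, one_mul]; nlinarith [sq_nonneg (1 + w.re)]
      · rw [h1, neg_one_mul, neg_re]; nlinarith [sq_nonneg (1 - w.re)]
    · rw [char_eq_zero χ hc]; simp; nlinarith
  nlinarith [mul_nonneg hL this]

/-- complex conjugation -/
theorem LFunction_conj {q : ℕ} [NeZero q] (χ : DirichletCharacter ℂ q) (hχ : χ ≠ 1) {s : ℂ} (hs : 0 < s.re) :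
    χ⁻¹.LFunction ((starRingEnd ℂ) s) = (starRingEnd ℂ) (χ.LFunction s) := by
  rw [LFunction_eq_integral χ hχ hs, LFunction_eq_integral χ⁻¹ (by simpa using hχ) (by simpa using hs), map_mul,
    ← integral_conj]
  congr 1
  refine setIntegral_congr_fun measurableSet_Ioi fun t ht => ?_
  have ht' : (1 : ℝ) < t := ht
  have h2 : chiSum χ⁻¹ ⌊t⌋₊ = (starRingEnd ℂ) (chiSum χ ⌊t⌋₊) := by
    rw [chiSum, chiSum, map_sum]
    exact Finset.sum_congr rfl fun k _ => char_inv_eq_conj χ _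
  simp only [map_mul, h2]
  congr 1
  rw [show -((starRingEnd ℂ) s + 1) = (starRingEnd ℂ) (-(s + 1)) by simp, cpow_conj, conj_ofReal]
  rw [arg_ofReal_of_nonneg (by linarith)]
  exact Real.pi_ne_zero.symm

theorem prodChar_ne_one {q₁ q₂ : ℕ} [NeZero q₁] [NeZero q₂] (χ₁ : DirichletCharacter ℂ q₁)
    (χ₂ : DirichletCharacter ℂ q₂) (h1 : χ₁.IsPrimitive) (h2 : χ₂.IsPrimitive) (h : q₁ ≠ q₂) :
    prodChar χ₁ χ₂ ≠ 1 := by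
  intro hp
  rw [prodChar, mul_inv_eq_one] at hp
  have := congrArg DirichletCharacter.conductor hp
  rw [DirichletCharacter.conductor_changeLevel, DirichletCharacter.conductor_changeLevel, h1, h2] at this
  exact h this

theorem prodChar_ne_one' {q : ℕ} [NeZero q] (χ₁ χ₂ : DirichletCharacter ℂ q) (h : χ₁ ≠ χ₂) :
    prodChar χ₁ χ₂ ≠ 1 := by
  intro hp
  rw [prodChar, mul_inv_eq_one] at hp
  exact h (DirichletCharacter.changeLevel_injective _ hp)

theorem exists_lam (A : ℝ) : ∃ l₀ : ℝ, 1 ≤ l₀ ∧ ∀ l, l₀ ≤ l → A ≤ Real.exp l :=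
  ⟨max 1 A, le_max_left _ _, fun l hl => by
    have := Real.add_one_le_exp l
    have := le_max_right 1 A
    linarith⟩

set_option maxHeartbeats 1000000 in
/-- zero repulsion constants -/
theorem repulsion : ∃ κ : ℝ, 0 < κ ∧ κ ≤ 1 / 100 ∧ ∃ l₀ : ℝ, 1 ≤ l₀ ∧ ∀ l : ℝ, l₀ ≤ l →
    (∀ (q₁ q₂ : ℕ) [NeZero q₁] [NeZero q₂] (χ₁ : DirichletCharacter ℂ q₁) (χ₂ : DirichletCharacter ℂ q₂)
      (β₁ γ₁ β₂ γ₂ : ℝ), (q₁ : ℝ) ≤ Real.exp l → (q₂ : ℝ) ≤ Real.exp l → χ₁ ≠ 1 → χ₂ ≠ 1 →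
      prodChar χ₁ χ₂ ≠ 1 → χ₁.LFunction (β₁ + γ₁ * I) = 0 → χ₂.LFunction (β₂ + γ₂ * I) = 0 →
      |γ₁| ≤ 2 * Real.exp l → |γ₂| ≤ 2 * Real.exp l → 1 - κ / l ≤ β₁ → 1 - κ / l ≤ β₂ → False) ∧
    (∀ (q : ℕ) [NeZero q] (χ : DirichletCharacter ℂ q) (β γ : ℝ), (q : ℝ) ≤ Real.exp l → χ ≠ 1 → χ ^ 2 = 1 →
      χ.LFunction (β + γ * I) = 0 → |γ| ≤ 2 * Real.exp l → 7 * κ / l ≤ |γ| → 1 - κ / l ≤ β → False) := by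
  obtain ⟨C0, hC0, hC⟩ := exists_vK_one_le
  set A : ℝ := 3 * C0 + 16132 with hA
  have hA0 : 0 < A := by positivity
  set κ : ℝ := 1 / (100 * A) with hκ
  have hκ0 : 0 < κ := by positivity
  have hκA : κ * A = 1 / 100 := by rw [hκ]; field_simp
  have hκ1 : κ ≤ 1 / 100 := by
    rw [hκ]; gcongr; nlinarith
  obtain ⟨l₀, hl₀, hl₀'⟩ := exists_lam (36 / κ)
  refine ⟨κ, hκ0, hκ1, l₀, hl₀, fun l hl => ?_⟩
  have hl1 : 1 ≤ l := hl₀.trans hl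
  have hE := hl₀' l hl
  set E := Real.exp l with hEdef
  have hlE : l ≤ E := by have := Real.add_one_le_exp l; linarith
  have hE1 : 1 ≤ E := hl1.trans hlE
  set δ : ℝ := 7 * κ / l with hδ
  have hδ0 : 0 < δ := by positivity
  have hδ1 : δ ≤ 1 / 10 := by
    rw [hδ, div_le_iff₀ (by linarith)]; nlinarith
  have hinv : 1 / δ = l / (7 * κ) := by rw [hδ, one_div_div]
  have hinvE : 1 / δ ≤ E ^ 2 / 252 := by
    rw [hinv]
    have : l / (7 * κ) = (36 / κ) * l / 252 := by field_simp; norm_num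
    rw [this]
    have : (36 / κ) * l ≤ E * E := mul_le_mul hE hlE (by linarith) (by linarith)
    nlinarith
  have hM6 : Real.exp (6 * l) = E ^ 6 := by rw [hEdef, ← Real.exp_nat_mul]; norm_num
  have hσ1 : 1 < 1 + δ := by linarith
  have hσ2 : 1 + δ ≤ 2 := by linarith
  have hl0 : 0 < 6 * l := by linarith
  have hbig : A * l * δ ≤ 7 / 100 := by
    rw [hδ]
    have : A * l * (7 * κ / l) = 7 * (κ * A) := by field_simp
    rw [this, hκA]; norm_num
  have hz := hC (1 + δ) hσ1 hσ2
  have hMq : ∀ (Q t : ℝ), 0 ≤ Q → Q ≤ E ^ 2 → |t| ≤ 4 * E → 6 * Q * (|t| + 3) / (1 + δ - 1) ≤ Real.exp (6 * l) := by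
    intro Q t hQ0 hQ ht
    rw [hM6, add_sub_cancel_left, div_eq_mul_one_div]
    have h1 : |t| + 3 ≤ 7 * E := by linarith
    calc 6 * Q * (|t| + 3) * (1 / δ) ≤ 6 * E ^ 2 * (7 * E) * (E ^ 2 / 252) := by gcongr
      _ ≤ E ^ 5 * 1 := by nlinarith [pow_pos (by linarith : 0 < E) 5]
      _ ≤ E ^ 5 * E := by gcongr
      _ = E ^ 6 := by ring
  have hdist : ∀ β : ℝ, 1 - κ / l ≤ β → β < 1 → 1 + δ - 1 / 4 < β ∧ 7 / (8 * δ) ≤ 1 / (1 + δ - β) := by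
    intro β hβ hβ1
    have h1 : κ / l = δ / 7 := by rw [hδ]; field_simp
    rw [h1] at hβ
    refine ⟨by linarith, ?_⟩
    rw [div_le_div_iff₀ (by positivity) (by linarith)]
    linarith
  have hzero : ∀ (q : ℕ) [NeZero q] (χ : DirichletCharacter ℂ q) (β γ : ℝ), (q : ℝ) ≤ E → χ ≠ 1 →
      χ.LFunction (β + γ * I) = 0 → |γ| ≤ 2 * E → 1 - κ / l ≤ β →
      vK χ (1 + δ) γ ≤ 448 * (6 * l) - 7 / (8 * δ) + 1 := by
    intro q _ χ β γ hq hχ h0 hγ hβ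
    have hβ1 : β < 1 := by
      by_contra hcon
      push Not at hcon
      exact DirichletCharacter.LFunction_ne_zero_of_one_le_re χ (Or.inl hχ) (by simpa using hcon) h0
    obtain ⟨d1, d2⟩ := hdist β hβ hβ1
    have := vK_le_of_zero χ hχ hσ1 hσ2 hl0 (hMq q γ (by positivity) (by nlinarith) (by linarith))
      (by linarith) d1 h0
    linarith
  have hδinv : 0 < 1 / δ := by positivity
  have e78 : 7 / (8 * δ) = 7 / 8 * (1 / δ) := by field_simp
  have hfin : A * l ≤ 7 / 100 * (1 / δ) := by
    rw [mul_one_div, le_div_iff₀ hδ0]; exact hbig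
  have hAl : A * l = 3 * C0 * l + 16132 * l := by rw [hA]; ring
  have hCl : C0 ≤ C0 * l := by nlinarith
  constructor
  · intro q₁ q₂ _ _ χ₁ χ₂ β₁ γ₁ β₂ γ₂ hq1 hq2 h1 h2 hp z1 z2 g1 g2 b1 b2
    have k1 := hzero q₁ χ₁ β₁ γ₁ hq1 h1 z1 g1 b1
    have k2 := hzero q₂ χ₂ β₂ γ₂ hq2 h2 z2 g2 b2
    have hg : |γ₁ - γ₂| ≤ 4 * E := by
      have := abs_sub γ₁ γ₂
      linarith
    have hq12 : ((q₁ * q₂ : ℕ) : ℝ) ≤ E ^ 2 := by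
      push_cast
      rw [sq]; exact mul_le_mul hq1 hq2 (by positivity) (by linarith)
    have k3 := vK_le (prodChar χ₁ χ₂) hp hσ1 hσ2 hl0 (hMq ((q₁ * q₂ : ℕ) : ℝ) (γ₁ - γ₂) (by positivity) hq12 hg)
    have k4 := two_char_pos χ₁ χ₂ hσ1 γ₁ γ₂
    rw [e78] at k1 k2
    rw [add_sub_cancel_left] at hz
    linarith
  · intro q _ χ β γ hq h1 h2 z g gl b
    have k1 := hzero q χ β γ hq h1 z g b
    have k4 := real_char_pos χ h2 hσ1 γ
    have k3 := vK_one_le (σ := 1 + δ) (t := 2 * γ) (M := 6 * l) hσ1 hσ2 hl0 (by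
      rw [hM6, add_sub_cancel_left, div_eq_mul_one_div, ← one_div_pow]
      have h1 : |2 * γ| + 3 ≤ 7 * E := by rw [abs_mul, abs_two]; linarith
      calc 9 * (|2 * γ| + 3) ^ 2 * (1 / δ) ^ 2 ≤ 9 * (7 * E) ^ 2 * (E ^ 2 / 252) ^ 2 := by gcongr
        _ = E ^ 6 * (441 / 63504) := by ring
        _ ≤ E ^ 6 := by have := pow_pos (by linarith : 0 < E) 6; linarith)
    have k5 : (1 + δ - 1) / ((1 + δ - 1) ^ 2 + (2 * γ) ^ 2) ≤ 1 / 5 * (1 / δ) := by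
      have h9 : δ ^ 2 ≤ γ ^ 2 := by rw [← sq_abs γ]; gcongr
      rw [add_sub_cancel_left, div_le_iff₀ (by positivity)]
      calc δ = 1 / 5 * (1 / δ) * (δ ^ 2 + (2 * δ) ^ 2) := by field_simp; norm_num
        _ ≤ 1 / 5 * (1 / δ) * (δ ^ 2 + (2 * γ) ^ 2) := by
          have : (2 * δ) ^ 2 ≤ (2 * γ) ^ 2 := by rw [mul_pow, mul_pow]; linarith
          gcongr
    rw [e78] at k1
    rw [add_sub_cancel_left] at hz
    linarith

open Complex Filter Topology

/-- additive exponential -/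
noncomputable def ee (x : ℝ) : ℂ := exp (2 * Real.pi * I * x)

theorem ee_add (x y : ℝ) : ee (x + y) = ee x * ee y := by
  rw [ee, ee, ee, ← exp_add]; congr 1; push_cast; ring

theorem ee_eq (x : ℝ) : ee x = exp ((2 * Real.pi * x : ℝ) * I) := by
  rw [ee]; congr 1; push_cast; ring

theorem norm_ee (x : ℝ) : ‖ee x‖ = 1 := by
  rw [ee_eq, norm_exp_ofReal_mul_I]

theorem ee_nat_mul (n : ℕ) (x : ℝ) : ee (n * x) = ee x ^ n := by
  rw [ee, ee, ← exp_nat_mul]; congr 1; push_cast; ring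

theorem ee_neg (x : ℝ) : ee (-x) = (starRingEnd ℂ) (ee x) := by
  rw [ee_eq, ee_eq, ← exp_conj, map_mul, conj_ofReal, conj_I]; congr 1; push_cast; ring

theorem ee_int (m : ℤ) : ee m = 1 := by
  rw [ee, show (2 * Real.pi * I * ((m : ℝ) : ℂ)) = m * (2 * Real.pi * I) by push_cast; ring]
  exact exp_int_mul_two_pi_mul_I m

theorem norm_ee_sub_one (x : ℝ) : 4 * |x - round x| ≤ ‖ee x - 1‖ := by
  set y := x - round x with hy
  have h1 : ee x = ee y := by
    rw [show x = y + (round x : ℝ) by rw [hy]; ring, ee_add, ee_int, mul_one]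
  have hy2 : |y| ≤ 1 / 2 := abs_sub_round x
  have h2 : ‖ee y - 1‖ = |2 * Real.sin (Real.pi * y)| := by
    rw [ee_eq, mul_comm, Complex.norm_exp_I_mul_ofReal_sub_one, Real.norm_eq_abs]
    congr 3; ring
  rw [h1, h2, abs_mul, abs_two]
  have h3 : |Real.sin (Real.pi * y)| = Real.sin (Real.pi * |y|) := by
    rcases le_or_gt 0 y with h | h
    · rw [abs_of_nonneg h, abs_of_nonneg]
      rw [abs_of_nonneg h] at hy2
      exact Real.sin_nonneg_of_nonneg_of_le_pi (by positivity) (by nlinarith [Real.pi_pos])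
    · rw [abs_of_neg h, mul_neg, Real.sin_neg, abs_of_nonpos]
      rw [abs_of_neg h] at hy2
      have := Real.sin_nonneg_of_nonneg_of_le_pi (x := Real.pi * (-y)) (by nlinarith [Real.pi_pos]) (by nlinarith [Real.pi_pos])
      rw [mul_neg, Real.sin_neg] at this
      linarith
  rw [h3]
  have h4 := Real.mul_le_sin (x := Real.pi * |y|) (by positivity) (by nlinarith [Real.pi_pos])
  rw [← mul_assoc, div_mul_cancel₀ _ Real.pi_ne_zero] at h4
  linarith

theorem norm_sum_ee_le {x : ℝ} (hx : 0 < |x - round x|) (N : ℕ) :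
    ‖∑ n ∈ Finset.range N, ee (n * x)‖ ≤ 1 / (2 * |x - round x|) := by
  have h1 := norm_ee_sub_one x
  have hne : ee x ≠ 1 := by
    intro h; rw [h, sub_self, norm_zero] at h1; linarith
  simp_rw [ee_nat_mul]
  rw [geom_sum_eq hne, norm_div, div_le_div_iff₀ (by linarith) (by positivity)]
  have : ‖ee x ^ N - 1‖ ≤ 2 := by
    refine (norm_sub_le _ _).trans ?_
    rw [norm_pow, norm_ee, one_pow, norm_one]; norm_num
  nlinarith

theorem abs_sub_round_ge {x : ℝ} {m : ℝ} (h0 : m ≤ x) (h1 : m ≤ 1 - x) : m ≤ |x - round x| := by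
  rcases le_or_gt (round x) 0 with h | h
  · have : ((round x : ℤ) : ℝ) ≤ 0 := by exact_mod_cast h
    have := le_abs_self (x - round x); linarith
  · have : (1 : ℝ) ≤ ((round x : ℤ) : ℝ) := by exact_mod_cast h
    have := neg_abs_le (x - round x); linarith

theorem sum_zmod_eq_range {q : ℕ} [NeZero q] {α : Type*} [AddCommMonoid α] (f : ZMod q → α) :
    ∑ a : ZMod q, f a = ∑ k ∈ Finset.range q, f (k : ZMod q) := by
  symm
  refine Finset.sum_bij (fun k _ => (k : ZMod q)) (by simp) ?_ ?_ (by simp)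
  · intro a ha b hb h
    rw [ZMod.natCast_eq_natCast_iff', Nat.mod_eq_of_lt (Finset.mem_range.1 ha),
      Nat.mod_eq_of_lt (Finset.mem_range.1 hb)] at h
    exact h
  · intro b _
    exact ⟨b.val, Finset.mem_range.2 (ZMod.val_lt b), by simp⟩

theorem stdAddChar_nat_mul {q : ℕ} [NeZero q] (a n : ℕ) :
    (ZMod.stdAddChar ((a : ZMod q) * (n : ZMod q)) : ℂ) = ee (n * ((a : ℝ) / q)) := by
  have := ZMod.stdAddChar_coe (N := q) ((a * n : ℕ) : ℤ)
  push_cast at this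
  rw [this, ee]
  congr 1; push_cast; ring

/-- squared norm of the Gauss sum of a primitive character -/
theorem norm_gaussSum_sq {q : ℕ} [NeZero q] (χ : DirichletCharacter ℂ q) (hχ : χ.IsPrimitive) :
    ‖gaussSum χ ZMod.stdAddChar‖ ^ 2 = q := by
  classical
  set τ := gaussSum χ ZMod.stdAddChar with hτ
  have h1 : ∀ b : ZMod q, ∑ a, χ a * ZMod.stdAddChar (b * a) = χ⁻¹ b * τ := by
    intro b
    have := gaussSum_mulShift_of_isPrimitive (ZMod.stdAddChar (N := q)) hχ b
    rw [gaussSum] at this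
    simpa [AddChar.mulShift_apply] using this
  have h2 : ∑ b : ZMod q, (χ⁻¹ b * τ) * (starRingEnd ℂ) (χ⁻¹ b * τ) = (∑ b : ZMod q, χ b * χ⁻¹ b) * (‖τ‖ ^ 2 : ℝ) := by
    rw [Finset.sum_mul]
    refine Finset.sum_congr rfl fun b _ => ?_
    have : (starRingEnd ℂ) (χ⁻¹ b) = χ b := by rw [char_inv_eq_conj, conj_conj]
    rw [map_mul, this]
    have : τ * (starRingEnd ℂ) τ = (‖τ‖ ^ 2 : ℝ) := by rw [mul_conj, normSq_eq_norm_sq]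
    linear_combination χ b * χ⁻¹ b * this
  have h3 : ∑ b : ZMod q, (χ⁻¹ b * τ) * (starRingEnd ℂ) (χ⁻¹ b * τ) = (∑ b : ZMod q, χ b * χ⁻¹ b) * q := by
    simp_rw [← h1, map_sum, Finset.sum_mul_sum]
    rw [Finset.sum_comm]
    rw [Finset.sum_mul]
    refine Finset.sum_congr rfl fun a _ => ?_
    rw [Finset.sum_comm]
    have : ∀ a' : ZMod q, ∑ b : ZMod q, χ a * ZMod.stdAddChar (b * a) *
        (starRingEnd ℂ) (χ a' * ZMod.stdAddChar (b * a')) =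
        χ a * χ⁻¹ a' * ∑ b : ZMod q, ZMod.stdAddChar (b * (a - a')) := by
      intro a'
      rw [Finset.mul_sum]
      refine Finset.sum_congr rfl fun b _ => ?_
      rw [map_mul (starRingEnd ℂ), ← char_inv_eq_conj, mul_sub, sub_eq_add_neg, AddChar.map_add_eq_mul, AddChar.map_neg_eq_conj]
      ring
    simp_rw [this, AddChar.sum_mulShift _ (ZMod.isPrimitive_stdAddChar q), sub_eq_zero]
    simp
  have h4 : (∑ b : ZMod q, χ b * χ⁻¹ b) ≠ 0 := by
    have : ∀ b : ZMod q, χ b * χ⁻¹ b = ((‖χ b‖ ^ 2 : ℝ) : ℂ) := by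
      intro b; rw [char_inv_eq_conj, mul_conj, normSq_eq_norm_sq]
    simp_rw [this]
    rw [← ofReal_sum]
    have : 0 < ∑ b : ZMod q, ‖χ b‖ ^ 2 := by
      refine Finset.sum_pos' (fun b _ => by positivity) ⟨1, Finset.mem_univ _, by simp⟩
    exact_mod_cast this.ne'
  rw [h2] at h3
  have := mul_left_cancel₀ h4 h3
  exact_mod_cast this

theorem chiSum_mul_gauss {q : ℕ} [NeZero q] (χ : DirichletCharacter ℂ q) (hχ : χ.IsPrimitive) (n : ℕ) :
    χ⁻¹ (n : ZMod q) * gaussSum χ ZMod.stdAddChar = ∑ a ∈ Finset.range q, χ (a : ZMod q) * ee (n * ((a : ℝ) / q)) := by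
  have := gaussSum_mulShift_of_isPrimitive (ZMod.stdAddChar (N := q)) hχ n
  rw [← this, gaussSum, sum_zmod_eq_range]
  refine Finset.sum_congr rfl fun a _ => ?_
  rw [AddChar.mulShift_apply, mul_comm (n : ZMod q), stdAddChar_nat_mul]

theorem harmonic_le (n : ℕ) : ∑ a ∈ Finset.range n, (1 : ℝ) / (a + 1) ≤ 1 + Real.log n := by
  have h := harmonic_le_one_add_log n
  rw [harmonic] at h
  push_cast at h
  simpa using h

theorem polya_vinogradov {q : ℕ} [NeZero q] (χ : DirichletCharacter ℂ q) (hχ : χ.IsPrimitive) (h1 : χ ≠ 1) (N : ℕ) :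
    ‖chiSum χ N‖ ≤ Real.sqrt q * (1 + Real.log q) := by
  have hq : 0 < q := NeZero.pos q
  have hqR : (0 : ℝ) < q := by exact_mod_cast hq
  have hq1 : q ≠ 1 := fun h => h1 (DirichletCharacter.level_one' χ h)
  set τ := gaussSum χ ZMod.stdAddChar with hτ
  have hτn : ‖τ‖ = Real.sqrt q := by
    rw [← norm_gaussSum_sq χ hχ, Real.sqrt_sq (norm_nonneg _)]
  have e1 : (starRingEnd ℂ) (chiSum χ N) * τ =
      ∑ a ∈ Finset.range q, χ (a : ZMod q) * ∑ n ∈ Finset.range (N + 1), ee (n * ((a : ℝ) / q)) := by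
    rw [chiSum_eq_range χ h1, map_sum, Finset.sum_mul]
    simp_rw [← char_inv_eq_conj, hτ, chiSum_mul_gauss χ hχ, Finset.mul_sum]
    rw [Finset.sum_comm]
  have e2 : ‖∑ a ∈ Finset.range q, χ (a : ZMod q) * ∑ n ∈ Finset.range (N + 1), ee (n * ((a : ℝ) / q))‖
      ≤ q * (1 + Real.log q) := by
    obtain ⟨m, hm⟩ : ∃ m, q = m + 1 := ⟨q - 1, by omega⟩
    have hr : Finset.range q = Finset.range (m + 1) := by rw [hm]
    rw [hr, Finset.sum_range_succ']
    simp only [Nat.cast_zero, DirichletCharacter.map_zero' χ hq1, zero_mul, add_zero]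
    have hb : ∀ a ∈ Finset.range m, ‖χ ((a + 1 : ℕ) : ZMod q) * ∑ n ∈ Finset.range (N + 1), ee (n * (((a + 1 : ℕ) : ℝ) / q))‖
        ≤ q / 2 * (1 / ((a : ℝ) + 1)) + q / 2 * (1 / (((m - 1 - a : ℕ) : ℝ) + 1)) := by
      intro a ha
      have ha' := Finset.mem_range.1 ha
      have c1 : (((m - 1 - a : ℕ) : ℝ) + 1) = q - (a + 1) := by
        have : m - 1 - a + 1 + (a + 1) = q := by omega
        have : (((m - 1 - a + 1 + (a + 1) : ℕ)) : ℝ) = q := by rw [this]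
        push_cast at this; linarith
      set u : ℝ := (a : ℝ) + 1 with hu
      set v : ℝ := (((m - 1 - a : ℕ) : ℝ) + 1) with hv
      have hu0 : 0 < u := by positivity
      have hv0 : 0 < v := by positivity
      have hx : min u v / q ≤ |((a + 1 : ℕ) : ℝ) / q - round (((a + 1 : ℕ) : ℝ) / q)| := by
        refine abs_sub_round_ge ?_ ?_
        · push_cast; gcongr; exact min_le_left _ _
        · rw [div_le_iff₀ hqR, sub_mul, div_mul_cancel₀ _ hqR.ne']; push_cast
          have := min_le_right u v; linarith
      have hmin : 0 < min u v := lt_min hu0 hv0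
      have hx0 : 0 < |((a + 1 : ℕ) : ℝ) / q - round (((a + 1 : ℕ) : ℝ) / q)| := lt_of_lt_of_le (by positivity) hx
      rw [norm_mul]
      calc _ ≤ 1 * (1 / (2 * |((a + 1 : ℕ) : ℝ) / q - round (((a + 1 : ℕ) : ℝ) / q)|)) :=
            mul_le_mul (norm_char_le_one' χ _) (norm_sum_ee_le hx0 _) (norm_nonneg _) zero_le_one
        _ ≤ 1 * (1 / (2 * (min u v / q))) := by gcongr
        _ = q / 2 * (1 / min u v) := by field_simp
        _ ≤ _ := by
          rw [← mul_add]
          refine mul_le_mul_of_nonneg_left ?_ (by positivity)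
          rcases min_choice u v with h | h <;> rw [h]
          · have : 0 < 1 / v := by positivity
            linarith
          · have : 0 < 1 / u := by positivity
            linarith
    refine (norm_sum_le_of_le _ hb).trans ?_
    rw [Finset.sum_add_distrib, ← Finset.mul_sum, ← Finset.mul_sum,
      Finset.sum_range_reflect (fun a : ℕ => 1 / ((a : ℝ) + 1)) m, ← add_mul, add_halves]
    refine mul_le_mul_of_nonneg_left ((harmonic_le m).trans ?_) hqR.le
    rcases Nat.eq_zero_or_pos m with h | h
    · omega
    · gcongr; omega
  rw [← e1, norm_mul, RCLike.norm_conj, hτn] at e2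
  have hs : 0 < Real.sqrt q := Real.sqrt_pos.2 hqR
  have hss : Real.sqrt q * Real.sqrt q = q := Real.mul_self_sqrt hqR.le
  refine le_of_mul_le_mul_right (e2.trans (le_of_eq ?_)) hs
  rw [mul_right_comm, hss]

open Complex Filter Topology MeasureTheory

theorem abel_bound (f : ℕ → ℝ) (a : ℕ → ℂ) {S B : ℝ} (hf : Monotone f ∨ Antitone f) (hB : ∀ k, |f k| ≤ B)
    (hS : ∀ n, ‖∑ k ∈ Finset.range n, a k‖ ≤ S) (n : ℕ) :
    ‖∑ k ∈ Finset.range n, (f k : ℂ) * a k‖ ≤ 3 * S * B := by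
  have hS0 : 0 ≤ S := (norm_nonneg _).trans (hS 0)
  have hB0 : 0 ≤ B := (abs_nonneg _).trans (hB 0)
  have h := Finset.sum_range_by_parts (fun k => (f k : ℂ)) a n
  simp only [smul_eq_mul] at h
  rw [h]
  have hv : ∀ m, ∑ i ∈ Finset.range m, |f (i + 1) - f i| ≤ 2 * B := by
    intro m
    have h0 := abs_le.1 (hB 0)
    have hm := abs_le.1 (hB m)
    rcases hf with hf | hf
    · rw [Finset.sum_congr rfl fun i _ => abs_of_nonneg (sub_nonneg.2 (hf (Nat.le_succ i))),
        Finset.sum_range_sub]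
      linarith
    · rw [Finset.sum_congr rfl fun i _ => abs_of_nonpos (sub_nonpos.2 (hf (Nat.le_succ i))),
        Finset.sum_neg_distrib, Finset.sum_range_sub]
      linarith
  refine (norm_sub_le _ _).trans ?_
  have h1 : ‖(f (n - 1) : ℂ) * ∑ i ∈ Finset.range n, a i‖ ≤ B * S := by
    rw [norm_mul, norm_real]
    exact mul_le_mul (hB _) (hS _) (norm_nonneg _) hB0
  have h2 : ‖∑ i ∈ Finset.range (n - 1), ((f (i + 1) : ℂ) - f i) * ∑ i ∈ Finset.range (i + 1), a i‖
      ≤ 2 * B * S := by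
    refine (norm_sum_le _ _).trans ?_
    calc _ ≤ ∑ i ∈ Finset.range (n - 1), |f (i + 1) - f i| * S := by
          refine Finset.sum_le_sum fun i _ => ?_
          rw [norm_mul, ← ofReal_sub, norm_real]
          exact mul_le_mul_of_nonneg_left (hS _) (abs_nonneg _)
      _ = (∑ i ∈ Finset.range (n - 1), |f (i + 1) - f i|) * S := by rw [Finset.sum_mul]
      _ ≤ 2 * B * S := mul_le_mul_of_nonneg_right (hv _) hS0
  linarith

theorem tendsto_LFunction_one {q : ℕ} [NeZero q] (χ : DirichletCharacter ℂ q) (hχ : χ ≠ 1) :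
    Tendsto (fun N : ℕ => ∑ d ∈ Finset.range N, χ ((d + 1 : ℕ) : ZMod q) / ((d + 1 : ℕ) : ℂ)) atTop
      (𝓝 (χ.LFunction 1)) := by
  have hq : q ≠ 1 := fun h => hχ (DirichletCharacter.level_one' χ h)
  have hL := LFunction_eq_integral χ hχ (s := 1) (by simp)
  rw [one_mul] at hL
  have hrp : ∀ t : ℝ, 1 < t → (t : ℂ) ^ (-(1 + 1 : ℂ)) = ((t ^ 2 : ℝ) : ℂ)⁻¹ := by
    intro t ht
    rw [show (-(1 + 1 : ℂ)) = -((2 : ℕ) : ℂ) by push_cast; ring, cpow_neg, cpow_natCast]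
    push_cast; rfl
  have hL' : χ.LFunction 1 = ∫ t in Set.Ioi (1 : ℝ), chiSum χ ⌊t⌋₊ * ((t ^ 2 : ℝ) : ℂ)⁻¹ := by
    rw [hL]
    exact setIntegral_congr_fun measurableSet_Ioi fun t ht => by simp only [hrp t ht]
  have hIntg : IntegrableOn (fun t : ℝ => chiSum χ ⌊t⌋₊ * ((t ^ 2 : ℝ) : ℂ)⁻¹) (Set.Ioi 1) := by
    refine Integrable.mono' ((integrableOn_Ioi_rpow_of_lt (a := -2) (by norm_num) one_pos).const_mul (q : ℝ))
      ?_ ?_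
    · refine Measurable.aestronglyMeasurable ((measurable_floor_fun _).mul ?_)
      fun_prop
    · rw [ae_restrict_iff' measurableSet_Ioi]
      refine ae_of_all _ fun t ht => ?_
      have ht : (1 : ℝ) < t := ht
      rw [norm_mul, norm_inv, norm_real, Real.norm_of_nonneg (by positivity),
        Real.rpow_neg (by linarith), show (2 : ℝ) = ((2 : ℕ) : ℝ) by norm_num, Real.rpow_natCast]
      exact mul_le_mul_of_nonneg_right (norm_chiSum_le χ hχ _) (by positivity)
  have hpart : ∀ N : ℕ, 1 ≤ N → ∑ d ∈ Finset.range N, χ ((d + 1 : ℕ) : ZMod q) / ((d + 1 : ℕ) : ℂ) =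
      (N : ℂ)⁻¹ * chiSum χ N + ∫ t in (1 : ℝ)..N, chiSum χ ⌊t⌋₊ * ((t ^ 2 : ℝ) : ℂ)⁻¹ := by
    intro N hN
    have hc0 : χ ((0 : ℕ) : ZMod q) = 0 := by simpa using DirichletCharacter.map_zero' χ hq
    have hsum : ∀ M : ℕ, ∑ k ∈ Finset.Icc 0 M, χ (k : ZMod q) = chiSum χ M := by
      intro M
      rw [chiSum_eq_range χ hχ, Nat.range_succ_eq_Icc_zero]
    have hd : ∀ t : ℝ, t ≠ 0 → HasDerivAt (fun t : ℝ => (t : ℂ)⁻¹) (-((t ^ 2 : ℝ) : ℂ)⁻¹) t := by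
      intro t ht
      have := (hasDerivAt_inv ht).ofReal_comp
      simpa using this
    have h := sum_mul_eq_sub_integral_mul₀ (𝕜 := ℂ) (fun k => χ (k : ZMod q)) (f := fun t : ℝ => (t : ℂ)⁻¹)
      hc0 (N : ℝ) (fun t ht => (hd t (by linarith [ht.1])).differentiableAt) (by
        have hc : ContinuousOn (fun t : ℝ => -((t ^ 2 : ℝ) : ℂ)⁻¹) (Set.Icc 1 N) := by
          refine ContinuousOn.neg (ContinuousOn.inv₀ (by fun_prop) ?_)
          intro t ht
          have : (0 : ℝ) < t := by linarith [ht.1]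
          exact_mod_cast (by positivity : t ^ 2 ≠ 0)
        refine (hc.integrableOn_Icc).congr_fun ?_ measurableSet_Icc
        intro t ht
        exact ((hd t (by linarith [ht.1])).deriv).symm)
    rw [Nat.floor_natCast, hsum] at h
    rw [← Nat.range_succ_eq_Icc_zero, Finset.sum_range_succ'] at h
    simp only [hc0, mul_zero, add_zero] at h
    rw [intervalIntegral.integral_of_le (by exact_mod_cast hN)]
    rw [show ∑ d ∈ Finset.range N, χ ((d + 1 : ℕ) : ZMod q) / ((d + 1 : ℕ) : ℂ) =
      ∑ k ∈ Finset.range N, (((k + 1 : ℕ) : ℝ) : ℂ)⁻¹ * χ ((k + 1 : ℕ) : ZMod q) from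
        Finset.sum_congr rfl fun d _ => by push_cast; rw [div_eq_inv_mul], h, sub_eq_add_neg,
        ← integral_neg]
    congr 1
    refine setIntegral_congr_fun measurableSet_Ioc fun t ht => ?_
    simp only [hsum]
    rw [(hd t (by linarith [ht.1])).deriv]
    ring
  have h1 : Tendsto (fun N : ℕ => (N : ℂ)⁻¹ * chiSum χ N) atTop (𝓝 0) := by
    refine squeeze_zero_norm (a := fun N : ℕ => (q : ℝ) * (N : ℝ)⁻¹) (fun N => ?_) ?_
    · rw [norm_mul, mul_comm, norm_inv, norm_natCast]
      exact mul_le_mul_of_nonneg_right (norm_chiSum_le χ hχ _) (by positivity)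
    · simpa using (tendsto_inv_atTop_nhds_zero_nat (𝕜 := ℝ)).const_mul (q : ℝ)
  have h2 := intervalIntegral_tendsto_integral_Ioi 1 hIntg (tendsto_natCast_atTop_atTop (R := ℝ))
  have h3 := h1.add h2
  rw [zero_add, ← hL'] at h3
  refine h3.congr' ?_
  filter_upwards [eventually_ge_atTop 1] with N hN
  exact (hpart N hN).symm

open scoped ComplexOrder in
theorem zetaMul_sq_ge {q : ℕ} (χ : DirichletCharacter ℂ q) (hχ : χ ^ 2 = 1) {m : ℕ} (hm : m ≠ 0) :
    1 ≤ (DirichletCharacter.zetaMul χ (m ^ 2)).re := by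
  have hpp : ∀ p : ℕ, p.Prime → ∀ k : ℕ, (1 : ℂ) ≤ DirichletCharacter.zetaMul χ (p ^ (2 * k)) := by
    intro p hp k
    have e : DirichletCharacter.zetaMul χ (p ^ (2 * k)) = ∑ i ∈ Finset.range (2 * k + 1), (χ (p : ZMod q)) ^ i := by
      rw [DirichletCharacter.zetaMul, ArithmeticFunction.coe_zeta_mul_apply, Nat.sum_divisors_prime_pow hp]
      refine Finset.sum_congr rfl fun i _ => ?_
      simp [toArithmeticFunction, hp.ne_zero]
    rw [e]
    rcases MulChar.isQuadratic_iff_sq_eq_one.mpr hχ (p : ZMod q) with h | h | h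
    · rw [h, Finset.sum_range_succ']; simp
    · rw [h]
      have : (0 : ℂ) ≤ ((2 * k : ℕ) : ℂ) := Nat.cast_nonneg _
      simpa using this
    · rw [h, neg_one_geom_sum]; simp
  have key : (1 : ℂ) ≤ DirichletCharacter.zetaMul χ (m ^ 2) := by
    rw [χ.isMultiplicative_zetaMul.multiplicative_factorization _ (pow_ne_zero 2 hm), Finsupp.prod]
    have hind : ∀ s : Finset ℕ, (∀ p ∈ s, p.Prime) →
        (1 : ℂ) ≤ ∏ p ∈ s, DirichletCharacter.zetaMul χ (p ^ (m ^ 2).factorization p) := by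
      intro s
      induction s using Finset.induction_on with
      | empty => simp
      | insert a s ha ih =>
        intro h
        rw [Finset.prod_insert ha]
        refine one_le_mul_of_one_le_of_one_le ?_ (ih fun p hp => h p (Finset.mem_insert_of_mem hp))
        rw [Nat.factorization_pow]
        exact hpp a (h a (Finset.mem_insert_self _ _)) _
    exact hind _ fun p hp => Nat.prime_of_mem_primeFactors hp
  exact (Complex.le_def.1 key).1

theorem lambert_eq {q : ℕ} (χ : DirichletCharacter ℂ q) {r : ℝ} (h0 : 0 < r) (h1 : r < 1) :
    Summable (fun n : ℕ+ => DirichletCharacter.zetaMul χ n * (r : ℂ) ^ (n : ℕ)) ∧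
    HasSum (fun d : ℕ => χ ((d + 1 : ℕ) : ZMod q) * ((r ^ (d + 1) / (1 - r ^ (d + 1)) : ℝ) : ℂ))
      (∑' n : ℕ+, DirichletCharacter.zetaMul χ n * (r : ℂ) ^ (n : ℕ)) := by
  have hr : ‖(r : ℂ)‖ < 1 := by rw [norm_real, Real.norm_of_nonneg h0.le]; exact h1
  have hs := summable_prod_mul_pow 0 hr
  have hs' : Summable fun c : (ℕ+ × ℕ+) ↦ χ ((c.1 : ℕ) : ZMod q) * ((r : ℂ) ^ (c.1 * c.2 : ℕ)) := by
    refine Summable.of_norm_bounded hs.norm fun c => ?_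
    rw [norm_mul, pow_zero, one_mul]
    exact mul_le_of_le_one_left (norm_nonneg _) (norm_char_le_one' _ _)
  have hsig := (sigmaAntidiagonalEquivProd.summable_iff).2 hs'
  have hsig2 := hsig.hasSum.sigma (fun n => (hasSum_fintype _))
  have hval : ∀ n : ℕ+, ∑ c : Nat.divisorsAntidiagonal n, ((fun c : (ℕ+ × ℕ+) ↦ χ ((c.1 : ℕ) : ZMod q) * ((r : ℂ) ^ (c.1 * c.2 : ℕ))) ∘ sigmaAntidiagonalEquivProd) ⟨n, c⟩ = DirichletCharacter.zetaMul χ n * (r : ℂ) ^ (n : ℕ) := by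
    intro n
    have : ∀ c : Nat.divisorsAntidiagonal n, ((fun c : (ℕ+ × ℕ+) ↦ χ ((c.1 : ℕ) : ZMod q) * ((r : ℂ) ^ (c.1 * c.2 : ℕ))) ∘ sigmaAntidiagonalEquivProd) ⟨n, c⟩ = χ ((c.1.1 : ℕ) : ZMod q) * (r : ℂ) ^ (n : ℕ) := by
      intro c
      have := divisorsAntidiagonalFactors_eq c
      change χ (((divisorsAntidiagonalFactors n c).1 : ℕ) : ZMod q) * (r : ℂ) ^ (((divisorsAntidiagonalFactors n c).1 : ℕ) * ((divisorsAntidiagonalFactors n c).2 : ℕ)) = _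
      rw [show ((divisorsAntidiagonalFactors n c).1 : ℕ) * ((divisorsAntidiagonalFactors n c).2 : ℕ) = n from this]
      rfl
    rw [Finset.sum_congr rfl fun c _ => this c, ← Finset.sum_mul]
    congr 1
    rw [Finset.univ_eq_attach, Finset.sum_attach (Nat.divisorsAntidiagonal n) (fun x : ℕ × ℕ => χ ((x.1 : ℕ) : ZMod q)),
      Nat.sum_divisorsAntidiagonal (fun x _ => χ ((x : ℕ) : ZMod q)), DirichletCharacter.zetaMul, ArithmeticFunction.coe_zeta_mul_apply]
    refine Finset.sum_congr rfl fun i hi => ?_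
    simp [toArithmeticFunction, (Nat.pos_of_mem_divisors hi).ne']
  simp only [hval] at hsig2
  refine ⟨hsig2.summable, ?_⟩
  have hte := sigmaAntidiagonalEquivProd.tsum_eq (fun c : (ℕ+ × ℕ+) ↦ χ ((c.1 : ℕ) : ZMod q) * ((r : ℂ) ^ (c.1 * c.2 : ℕ)))
  rw [hsig2.tsum_eq.trans hte]
  have hpr := hs'.hasSum.prod_fiberwise (fun d => (hs'.prod_factor d).hasSum)
  have hin : ∀ d : ℕ+, ∑' c : ℕ+, χ ((d : ℕ) : ZMod q) * ((r : ℂ) ^ (d * c : ℕ)) = χ ((d : ℕ) : ZMod q) * ((r ^ (d : ℕ) / (1 - r ^ (d : ℕ)) : ℝ) : ℂ) := by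
    intro d
    rw [tsum_mul_left]
    congr 1
    have hrd : ‖(r : ℂ) ^ (d : ℕ)‖ < 1 := by
      rw [norm_pow]; exact pow_lt_one₀ (norm_nonneg _) hr d.ne_zero
    have h2 := tsum_pnat_eq_tsum_succ (f := fun m => ((r : ℂ) ^ (d : ℕ)) ^ m)
    have h3 : ∑' c : ℕ+, ((r : ℂ) ^ (d * c : ℕ)) = ∑' c : ℕ+, ((r : ℂ) ^ (d : ℕ)) ^ (c : ℕ) :=
      tsum_congr fun c => by rw [pow_mul]
    rw [h3, h2]
    simp only [pow_succ _ _]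
    rw [tsum_mul_right, tsum_geometric_of_norm_lt_one hrd]
    push_cast
    rw [div_eq_inv_mul]
  simp only [hin] at hpr
  have := (Equiv.hasSum_iff Equiv.pnatEquivNat.symm).2 hpr
  exact this

theorem hker_mono : MonotoneOn (fun t : ℝ => 1 / (Real.exp t - 1) - 1 / t) (Set.Ioi 0) := by
  have hne : ∀ t : ℝ, 0 < t → Real.exp t - 1 ≠ 0 := fun t ht => by
    have := Real.add_one_lt_exp ht.ne'
    linarith
  have hd : ∀ t : ℝ, 0 < t → HasDerivAt (fun t : ℝ => 1 / (Real.exp t - 1) - 1 / t)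
      (-Real.exp t / (Real.exp t - 1) ^ 2 - (-1 / t ^ 2)) t := by
    intro t ht
    have h1 := ((Real.hasDerivAt_exp t).sub_const 1).inv (hne t ht)
    have h2 := (hasDerivAt_id t).inv ht.ne'
    simp only [one_div]
    exact (h1.sub h2).congr_deriv (by simp)
  refine monotoneOn_of_deriv_nonneg (convex_Ioi 0) (fun t ht => (hd t ht).continuousAt.continuousWithinAt)
    ?_ ?_
  · rw [interior_Ioi]
    exact fun t ht => (hd t ht).differentiableAt.differentiableWithinAt
  · rw [interior_Ioi]
    intro t ht
    have ht : 0 < t := ht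
    rw [(hd t ht).deriv]
    have h1 : 0 < Real.exp t - 1 := by linarith [Real.add_one_lt_exp ht.ne']
    have h2 : t / 2 ≤ Real.sinh (t / 2) := Real.self_le_sinh_iff.2 (by linarith)
    rw [Real.sinh_eq] at h2
    have h3 : t * Real.exp (t / 2) ≤ Real.exp t - 1 := by
      have e1 : Real.exp t = Real.exp (t / 2) * Real.exp (t / 2) := by rw [← Real.exp_add]; ring_nf
      have e2 : Real.exp (-(t / 2)) * Real.exp (t / 2) = 1 := by rw [← Real.exp_add]; simp
      have := mul_le_mul_of_nonneg_right h2 (Real.exp_pos (t / 2)).le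
      rw [e1]; nlinarith
    have h4 : t ^ 2 * Real.exp t ≤ (Real.exp t - 1) ^ 2 := by
      have e1 : Real.exp t = Real.exp (t / 2) ^ 2 := by rw [← Real.exp_nat_mul]; congr 1; push_cast; ring
      have := pow_le_pow_left₀ (by positivity) h3 2
      rw [mul_pow, ← e1] at this
      exact this
    have h5 : Real.exp t / (Real.exp t - 1) ^ 2 ≤ 1 / t ^ 2 := by
      rw [div_le_div_iff₀ (by positivity) (by positivity)]; linarith
    rw [neg_div, neg_div]; linarith

theorem hker_bound {t : ℝ} (ht : 0 < t) : |1 / (Real.exp t - 1) - 1 / t| ≤ 1 := by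
  have h1 : t < Real.exp t - 1 := by linarith [Real.add_one_lt_exp ht.ne']
  rw [abs_le]
  constructor
  · have h2 : 1 / t - 1 ≤ 1 / (Real.exp t - 1) := by
      rw [div_sub_one ht.ne', div_le_div_iff₀ ht (by linarith)]
      have h3 := Real.add_one_le_exp (-t)
      have h4 : Real.exp (-t) * Real.exp t = 1 := by rw [← Real.exp_add]; simp
      have := mul_le_mul_of_nonneg_right h3 (Real.exp_pos t).le
      nlinarith
    linarith
  · have := one_div_le_one_div_of_le ht h1.le
    linarith

theorem LFunction_one_ge {q : ℕ} [NeZero q] (χ : DirichletCharacter ℂ q) (hχ : χ ≠ 1) (h2 : χ ^ 2 = 1)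
    {S : ℝ} (hS1 : 1 ≤ S) (hS : ∀ N, ‖chiSum χ N‖ ≤ S) : 1 / (114 * S) ≤ ‖χ.LFunction 1‖ := by
  set K : ℕ := ⌈18 * S⌉₊ with hK
  have hK1 : 18 * S ≤ K := Nat.le_ceil _
  have hK2 : (K : ℝ) < 18 * S + 1 := Nat.ceil_lt_add_one (by linarith)
  have hK0 : (0 : ℝ) < K := by linarith
  set X : ℝ := (K : ℝ) ^ 2 with hX
  have hX0 : 0 < X := by positivity
  set r : ℝ := Real.exp (-(1 / X)) with hr
  have hr0 : 0 < r := Real.exp_pos _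
  have hr1 : r < 1 := by rw [hr, Real.exp_lt_one_iff]; simp; positivity
  obtain ⟨hsum, hW⟩ := lambert_eq χ hr0 hr1
  set W := ∑' n : ℕ+, DirichletCharacter.zetaMul χ n * (r : ℂ) ^ (n : ℕ) with hWdef
  have hrpow : ∀ n : ℕ, r ^ n = Real.exp (-(n / X)) := by
    intro n; rw [hr, ← Real.exp_nat_mul]; congr 1; ring
  -- lower bound
  have hlow : (K : ℝ) / 3 ≤ W.re := by
    have hre : W.re = ∑' n : ℕ+, (DirichletCharacter.zetaMul χ n).re * r ^ (n : ℕ) := by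
      rw [hWdef, re_tsum hsum]
      refine tsum_congr fun n => ?_
      rw [← ofReal_pow, re_mul_ofReal]
    have hsre : Summable (fun n : ℕ+ => (DirichletCharacter.zetaMul χ n).re * r ^ (n : ℕ)) := by
      have := reCLM.summable hsum
      refine this.congr fun n => ?_
      simp only [reCLM_apply]
      rw [← ofReal_pow, re_mul_ofReal]
    have hnn : ∀ n : ℕ+, 0 ≤ (DirichletCharacter.zetaMul χ n).re * r ^ (n : ℕ) := fun n =>
      mul_nonneg (Complex.le_def.1 (DirichletCharacter.zetaMul_nonneg h2 n)).1 (by positivity)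
    rw [hre]
    let g : ℕ → ℕ+ := fun m => ⟨(m + 1) ^ 2, by positivity⟩
    have hg : Function.Injective g := by
      intro a b hab
      have : (a + 1) ^ 2 = (b + 1) ^ 2 := congrArg PNat.val hab
      have := Nat.pow_left_injective (n := 2) (by norm_num) this
      omega
    refine le_trans ?_ (hsre.sum_le_tsum ((Finset.range K).map ⟨g, hg⟩) fun n _ => hnn n)
    rw [Finset.sum_map]
    calc (K : ℝ) / 3 = ∑ m ∈ Finset.range K, (1 / 3 : ℝ) := by simp; ring
      _ ≤ _ := by
        refine Finset.sum_le_sum fun m hm => ?_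
        have hm : m + 1 ≤ K := Finset.mem_range.1 hm
        change (1 / 3 : ℝ) ≤ (DirichletCharacter.zetaMul χ ((m + 1) ^ 2)).re * r ^ ((m + 1) ^ 2)
        have h3 : (1 / 3 : ℝ) ≤ r ^ ((m + 1) ^ 2) := by
          rw [hrpow]
          have : (((m + 1) ^ 2 : ℕ) : ℝ) / X ≤ 1 := by
            rw [div_le_one hX0, hX]
            exact_mod_cast Nat.pow_le_pow_left hm 2
          calc (1 / 3 : ℝ) ≤ Real.exp (-1) := by
                rw [Real.exp_neg, one_div]
                exact inv_anti₀ (Real.exp_pos 1) (by linarith [Real.exp_one_lt_d9])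
            _ ≤ _ := Real.exp_le_exp.2 (by linarith)
        have h4 := zetaMul_sq_ge χ h2 (m := m + 1) (by omega)
        calc (1 / 3 : ℝ) ≤ 1 * r ^ ((m + 1) ^ 2) := by linarith
          _ ≤ _ := mul_le_mul_of_nonneg_right h4 (by positivity)
  -- comparison
  have hcmp : ‖W - X * χ.LFunction 1‖ ≤ 3 * S := by
    have t1 := hW.tendsto_sum_nat
    have t2 := (tendsto_LFunction_one χ hχ).const_mul (X : ℂ)
    refine le_of_tendsto (t1.sub t2).norm (Eventually.of_forall fun N => ?_)
    have hmono : Monotone (fun k : ℕ => 1 / (Real.exp ((k + 1 : ℕ) / X) - 1) - 1 / ((k + 1 : ℕ) / X)) := by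
      intro a b hab
      refine hker_mono (a := ((a + 1 : ℕ) / X : ℝ)) (b := ((b + 1 : ℕ) / X : ℝ)) (Set.mem_Ioi.2 (by positivity)) (Set.mem_Ioi.2 (by positivity)) ?_
      gcongr
    have := abel_bound _ (fun k => χ ((k + 1 : ℕ) : ZMod q)) (Or.inl hmono)
      (fun k => hker_bound (t := ((k + 1 : ℕ) : ℝ) / X) (by positivity)) (S := S) (fun n => by
        have : ∑ k ∈ Finset.range n, χ ((k + 1 : ℕ) : ZMod q) = chiSum χ n := by
          rw [chiSum, show Finset.Icc 1 n = Finset.Ico 1 (n + 1) from rfl, Finset.sum_Ico_eq_sum_range]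
          simp [add_comm]
        rw [this]; exact hS n) N
    rw [mul_one] at this
    refine le_trans (le_of_eq ?_) this
    rw [Finset.mul_sum, ← Finset.sum_sub_distrib]
    congr 1
    refine Finset.sum_congr rfl fun d _ => ?_
    have e1 : r ^ (d + 1) / (1 - r ^ (d + 1)) = 1 / (Real.exp ((d + 1 : ℕ) / X) - 1) := by
      rw [hrpow, Real.exp_neg]
      have h3 : 0 < ((d + 1 : ℕ) : ℝ) / X := by positivity
      have h1 : Real.exp ((d + 1 : ℕ) / X) - 1 ≠ 0 := by linarith [Real.add_one_lt_exp h3.ne']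
      have h2 := (Real.exp_pos (((d + 1 : ℕ) : ℝ) / X)).ne'
      field_simp
    rw [e1]
    have e2 : (1 : ℝ) / ((d + 1 : ℕ) / X) = X / (d + 1 : ℕ) := by rw [one_div_div]
    rw [e2]
    push_cast
    ring
  have h5 : (K : ℝ) / 3 ≤ X * ‖χ.LFunction 1‖ + 3 * S := by
    have h6 : W.re ≤ ‖W‖ := re_le_norm W
    have h7 : ‖W‖ ≤ ‖W - X * χ.LFunction 1‖ + ‖X * χ.LFunction 1‖ := by
      simpa using norm_add_le (W - X * χ.LFunction 1) (X * χ.LFunction 1)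
    rw [norm_mul, norm_real, Real.norm_of_nonneg hX0.le] at h7
    linarith
  have h8 : (K : ℝ) / 6 ≤ (K : ℝ) ^ 2 * ‖χ.LFunction 1‖ := by linarith
  have h9 : 1 / (6 * K) ≤ ‖χ.LFunction 1‖ := by
    rw [div_le_iff₀ (by positivity)]
    have : (K : ℝ) * 1 ≤ K * (‖χ.LFunction 1‖ * (6 * K)) := by nlinarith
    exact le_of_mul_le_mul_left this hK0
  refine le_trans (one_div_le_one_div_of_le (by positivity) ?_) h9
  linarith

theorem no_zero_near_one : ∃ c : ℝ, 0 < c ∧ ∀ (q : ℕ) [NeZero q] (χ : DirichletCharacter ℂ q),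
    χ.IsPrimitive → χ ≠ 1 → χ ^ 2 = 1 → ∀ s : ℂ, ‖s - 1‖ ≤ c * (q : ℝ) ^ (-(13 / 20) : ℝ) →
      χ.LFunction s ≠ 0 := by
  refine ⟨1 / 4000000, by norm_num, fun q _ χ hprim hχ h2 s hs h0 => ?_⟩
  have hq1 : (1 : ℝ) ≤ q := by exact_mod_cast NeZero.one_le
  have hq0 : (0 : ℝ) < q := by linarith
  have hqp : ∀ a : ℝ, 0 < a → (1 : ℝ) ≤ (q : ℝ) ^ a := fun a ha => Real.one_le_rpow hq1 ha.le
  have hS : ∀ N, ‖chiSum χ N‖ ≤ 21 * (q : ℝ) ^ (11 / 20 : ℝ) := by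
    intro N
    refine (polya_vinogradov χ hprim hχ N).trans ?_
    have hl := Real.log_le_rpow_div hq0.le (show (0 : ℝ) < 1 / 20 by norm_num)
    have h1 := hqp (1 / 20) (by norm_num)
    have : √(q : ℝ) * (1 + Real.log q) ≤ √(q : ℝ) * (21 * (q : ℝ) ^ (1 / 20 : ℝ)) :=
      mul_le_mul_of_nonneg_left (by linarith) (Real.sqrt_nonneg _)
    refine this.trans (le_of_eq ?_)
    rw [Real.sqrt_eq_rpow, mul_left_comm, ← Real.rpow_add hq0]
    norm_num
  have hL1 := LFunction_one_ge χ hχ h2 (by linarith [hqp (11 / 20) (by norm_num)]) hS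
  have hder : ∀ z ∈ Metric.closedBall (1 : ℂ) (1 / 25), ‖deriv χ.LFunction z‖ ≤ 1350 * (q : ℝ) ^ (1 / 10 : ℝ) := by
    intro z hz
    have hz : ‖z - 1‖ ≤ 1 / 25 := by simpa [dist_eq_norm] using hz
    have := norm_deriv_le_of_forall_mem_sphere_norm_le (f := χ.LFunction) (c := z) (R := 1 / 25)
      (C := 54 * (q : ℝ) ^ (1 / 10 : ℝ)) (by norm_num)
      (DirichletCharacter.differentiable_LFunction hχ).diffContOnCl (fun w hw => by
        have hw : ‖w - z‖ = 1 / 25 := by simpa [dist_eq_norm] using hw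
        have h3 : ‖w - 1‖ ≤ 2 / 25 := by
          have := norm_add_le (w - z) (z - 1)
          rw [sub_add_sub_cancel] at this
          linarith
        have h4 : 23 / 25 ≤ w.re := by
          have := (abs_le.1 ((abs_re_le_norm (w - 1)).trans h3)).1
          simp at this; linarith
        have h5 : ‖w‖ ≤ 27 / 25 := by
          have := norm_add_le (w - 1) 1
          rw [sub_add_cancel, norm_one] at this
          linarith
        refine (norm_LFunction_le χ hχ (a := 1 / 10) (by norm_num) (by norm_num) (s := w) (by linarith)).trans ?_
        have h6 : (q : ℝ) ^ (1 / 10 : ℝ) / (w.re + 1 / 10 - 1) ≤ (q : ℝ) ^ (1 / 10 : ℝ) / (1 / 50) := by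
          refine div_le_div_of_nonneg_left (by positivity) (by norm_num) (by linarith)
        calc _ ≤ 27 / 25 * ((q : ℝ) ^ (1 / 10 : ℝ) / (1 / 50)) :=
              mul_le_mul h5 h6 (div_nonneg (by positivity) (by linarith)) (by norm_num)
          _ = _ := by ring)
    refine this.trans (le_of_eq (by ring))
  have hs' : ‖s - 1‖ ≤ 1 / 25 := by
    have : (q : ℝ) ^ (-(13 / 20) : ℝ) ≤ 1 := Real.rpow_le_one_of_one_le_of_nonpos hq1 (by norm_num)
    linarith
  have hdiff := Convex.norm_image_sub_le_of_norm_deriv_le (f := χ.LFunction)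
    (fun z _ => (DirichletCharacter.differentiable_LFunction hχ) z) hder (convex_closedBall (1 : ℂ) (1 / 25))
    (x := 1) (y := s) (by simp) (by simpa [dist_eq_norm] using hs')
  rw [h0, zero_sub, norm_neg] at hdiff
  have e1 : (q : ℝ) ^ (1 / 10 : ℝ) * (q : ℝ) ^ (-(13 / 20) : ℝ) = ((q : ℝ) ^ (11 / 20 : ℝ))⁻¹ := by
    rw [← Real.rpow_add hq0, ← Real.rpow_neg hq0.le]; norm_num
  have h7 : ‖χ.LFunction 1‖ ≤ 1350 / 4000000 * ((q : ℝ) ^ (11 / 20 : ℝ))⁻¹ := by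
    refine hdiff.trans ((mul_le_mul_of_nonneg_left hs (by positivity)).trans (le_of_eq ?_))
    rw [← e1]; ring
  have h8 : 0 < ((q : ℝ) ^ (11 / 20 : ℝ))⁻¹ := by positivity
  have h9 : 1 / (114 * (21 * (q : ℝ) ^ (11 / 20 : ℝ))) = 1 / 2394 * ((q : ℝ) ^ (11 / 20 : ℝ))⁻¹ := by
    rw [one_div, mul_inv, mul_inv]; ring
  rw [h9] at hL1
  linarith

open Complex Filter Topology

theorem one_add_pow_of_sq_zero {R : Type*} [CommRing R] (x : R) (hx : x * x = 0) (n : ℕ) :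
    (1 + x) ^ n = 1 + n * x := by
  induction n with
  | zero => simp
  | succ n ih =>
    rw [pow_succ, ih]; push_cast
    linear_combination (n : R) * hx

theorem not_primitive_aux {q m : ℕ} [NeZero q] (χ : DirichletCharacter ℂ q) (hprim : χ.IsPrimitive)
    (hm : m ∣ q) (hlt : m < q) (h : ∀ k : ℤ, χ (1 + (m : ZMod q) * k) = 0 ∨ χ (1 + (m : ZMod q) * k) = 1) : False := by
  have hf : χ.FactorsThrough m := by
    rw [DirichletCharacter.factorsThrough_iff_ker_unitsMap hm]
    intro u hu
    rw [MonoidHom.mem_ker] at hu ⊢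
    have h1 := congrArg Units.val hu
    rw [ZMod.unitsMap_val, Units.val_one] at h1
    have h2 : (((u : ZMod q).val : ℤ) : ZMod m) = ((1 : ℤ) : ZMod m) := by
      rw [ZMod.cast_eq_val] at h1
      push_cast; exact h1
    rw [ZMod.intCast_eq_intCast_iff_dvd_sub] at h2
    obtain ⟨k, hk⟩ := h2
    have h3 : (u : ZMod q) = 1 + (m : ZMod q) * ((-k : ℤ) : ZMod q) := by
      have h4 : ((u : ZMod q).val : ℤ) = 1 + m * (-k) := by linarith
      have h5 := congrArg (fun z : ℤ => (z : ZMod q)) h4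
      push_cast at h5
      rw [ZMod.natCast_zmod_val] at h5
      push_cast; exact h5
    apply Units.ext
    rw [MulChar.coe_toUnitHom, Units.val_one, h3]
    rcases h (-k) with h6 | h6
    · rw [← h3] at h6
      exact absurd h6 (by rw [← MulChar.coe_toUnitHom]; exact Units.ne_zero _)
    · exact h6
  have : χ.conductor ≤ m := Nat.sInf_le hf
  rw [hprim] at this
  omega

theorem real_prim_sq {q : ℕ} [NeZero q] (χ : DirichletCharacter ℂ q) (hprim : χ.IsPrimitive) (h2 : χ ^ 2 = 1)
    {p : ℕ} (hp : p.Prime) (hp2 : p ≠ 2) : ¬ p ^ 2 ∣ q := by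
  rintro ⟨j, hj⟩
  have hq0 : q ≠ 0 := NeZero.ne q
  have hj0 : 0 < j := Nat.pos_of_ne_zero (by rintro rfl; simp at hj; exact hq0 hj)
  refine not_primitive_aux (m := p * j) χ hprim ⟨p, by rw [hj]; ring⟩ ?_ fun k => ?_
  · rw [hj]; nlinarith [hp.two_le, Nat.mul_pos hp.pos hj0]
  · have hq : ((p * (p * j) : ℕ) : ZMod q) = 0 := by
      rw [show p * (p * j) = q by rw [hj]; ring]; exact ZMod.natCast_self q
    push_cast at hq
    have hpow : (1 + ((p * j : ℕ) : ZMod q) * k) ^ p = 1 := by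
      rw [one_add_pow_of_sq_zero]
      · push_cast; linear_combination (k : ZMod q) * hq
      · push_cast; linear_combination (k : ZMod q) ^ 2 * j * hq
    have h3 := congrArg χ hpow
    rw [map_pow, map_one] at h3
    rcases MulChar.isQuadratic_iff_sq_eq_one.mpr h2 (1 + ((p * j : ℕ) : ZMod q) * k) with h | h | h
    · exact Or.inl h
    · exact Or.inr h
    · rw [h, (hp.odd_of_ne_two hp2).neg_one_pow] at h3
      norm_num at h3

theorem real_prim_sixteen {q : ℕ} [NeZero q] (χ : DirichletCharacter ℂ q) (hprim : χ.IsPrimitive) (h2 : χ ^ 2 = 1) :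
    ¬ 16 ∣ q := by
  rintro ⟨j, hj⟩
  have hq0 : q ≠ 0 := NeZero.ne q
  refine not_primitive_aux (m := 8 * j) χ hprim ⟨2, by rw [hj]; ring⟩ (by omega) fun k => ?_
  have hq : ((16 * j : ℕ) : ZMod q) = 0 := by
    rw [← hj]; exact ZMod.natCast_self q
  push_cast at hq
  have hpow : 1 + ((8 * j : ℕ) : ZMod q) * k = (1 + 4 * j * k) ^ 2 := by
    push_cast; linear_combination -(k : ZMod q) ^ 2 * j * hq
  rw [hpow, map_pow]
  rcases MulChar.isQuadratic_iff_sq_eq_one.mpr h2 (1 + 4 * (j : ZMod q) * k) with h | h | h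
  · left; rw [h]; norm_num
  · right; rw [h]; norm_num
  · right; rw [h]; norm_num

theorem real_prim_le {q : ℕ} [NeZero q] (χ : DirichletCharacter ℂ q) (hprim : χ.IsPrimitive) (h2 : χ ^ 2 = 1)
    {p0 : ℕ} (hp0 : ∀ p, p.Prime → p ∣ q → p ≤ p0) : q ≤ 8 * 4 ^ p0 := by
  have hq0 : q ≠ 0 := NeZero.ne q
  have hd : q ∣ 8 * primorial p0 := by
    rw [← Nat.factorization_prime_le_iff_dvd hq0 (mul_ne_zero (by norm_num) (primorial_ne_zero _))]
    intro p hp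
    rw [Nat.factorization_mul (by norm_num) (primorial_ne_zero _), Finsupp.add_apply]
    by_cases hpq : p ∣ q
    · have h1 : 1 ≤ (primorial p0).factorization p := by
        rw [← hp.dvd_iff_one_le_factorization (primorial_ne_zero _), primorial]
        exact Finset.dvd_prod_of_mem (fun i => i) (by
          simp [hp]; exact hp0 p hp hpq)
      by_cases h : p = 2
      · subst h
        have h3 : (8 : ℕ).factorization 2 = 3 := by
          rw [show (8 : ℕ) = 2 ^ 3 by norm_num, Nat.Prime.factorization_pow hp]; simp
        have h4 : q.factorization 2 < 4 := by
          by_contra h5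
          push Not at h5
          exact real_prim_sixteen χ hprim h2 (by
            rw [show 16 = 2 ^ 4 by norm_num]
            exact (hp.pow_dvd_iff_le_factorization hq0).2 h5)
        omega
      · have h4 : q.factorization p < 2 := by
          by_contra h5
          push Not at h5
          exact real_prim_sq χ hprim h2 hp h ((hp.pow_dvd_iff_le_factorization hq0).2 h5)
        omega
    · rw [Nat.factorization_eq_zero_of_not_dvd hpq]; omega
  refine (Nat.le_of_dvd (by have := primorial_pos p0; omega) hd).trans ?_
  exact Nat.mul_le_mul_left 8 (primorial_le_four_pow _)

/-- good region -/
def GoodMod (κ l : ℝ) (p0 : ℕ) : Prop :=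
  ∀ (q : ℕ) [NeZero q] (χ : DirichletCharacter ℂ q), (q : ℝ) ≤ Real.exp l → Nat.Coprime q p0 →
    χ.IsPrimitive → χ ≠ 1 → ∀ s : ℂ, 1 - κ / l ≤ s.re → |s.im| ≤ 2 * Real.exp l → χ.LFunction s ≠ 0

theorem exists_p0 : ∃ κ : ℝ, 0 < κ ∧ κ ≤ 1 / 100 ∧ ∃ l₁ : ℝ, 1 ≤ l₁ ∧ ∀ l : ℝ, l₁ ≤ l →
    ∃ p0 : ℕ, p0.Prime ∧ Real.log l ≤ p0 ∧ (p0 : ℝ) ≤ Real.exp l ∧ GoodMod κ l p0 := by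
  obtain ⟨κ, hκ0, hκ1, l₀, hl₀, hrep⟩ := repulsion
  obtain ⟨c, hc0, hc⟩ := no_zero_near_one
  have hlarge : ∀ᶠ l : ℝ in atTop, 8 * l ^ (14 / 10 : ℝ) < (c * l / (8 * κ)) ^ (20 / 13 : ℝ) := by
    have h1 : Tendsto (fun l : ℝ => l ^ (9 / 65 : ℝ)) atTop atTop := tendsto_rpow_atTop (by norm_num)
    filter_upwards [h1.eventually_gt_atTop (8 / (c / (8 * κ)) ^ (20 / 13 : ℝ)), eventually_gt_atTop 0] with l hl hl0
    rw [div_lt_iff₀ (by positivity)] at hl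
    rw [show c * l / (8 * κ) = (c / (8 * κ)) * l by ring, Real.mul_rpow (by positivity) hl0.le,
      show (20 / 13 : ℝ) = 9 / 65 + 14 / 10 by norm_num, Real.rpow_add hl0, ← mul_assoc]
    rw [show (9 / 65 + 14 / 10 : ℝ) = 20 / 13 by norm_num]
    refine mul_lt_mul_of_pos_right ?_ (by positivity)
    linarith
  obtain ⟨l₂, hl₂⟩ := eventually_atTop.1 hlarge
  refine ⟨κ, hκ0, hκ1, max (max l₀ l₂) 2, by have := le_max_right (max l₀ l₂) (2 : ℝ); linarith, fun l hl => ?_⟩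
  have hll₀ : l₀ ≤ l := (le_max_left _ _).trans ((le_max_left _ _).trans hl)
  have hll₂ : l₂ ≤ l := (le_max_right _ _).trans ((le_max_left _ _).trans hl)
  have hl2 : 2 ≤ l := (le_max_right _ _).trans hl
  have hl0 : 0 < l := by linarith
  obtain ⟨hA, hB⟩ := hrep l hll₀
  have hκl : κ / l ≤ 1 / 100 := (div_le_self hκ0.le (by linarith)).trans hκ1
  have hre : ∀ s : ℂ, (s.re : ℂ) + s.im * I = s := fun s => re_add_im s
  by_cases hbad : ∃ q : ℕ, ∃ _ : NeZero q, ∃ χ : DirichletCharacter ℂ q, (q : ℝ) ≤ Real.exp l ∧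
      χ.IsPrimitive ∧ χ ≠ 1 ∧ ∃ s : ℂ, 1 - κ / l ≤ s.re ∧ |s.im| ≤ 2 * Real.exp l ∧ χ.LFunction s = 0
  · obtain ⟨q, _, χ, hq, hprim, hχ, s, hs1, hs2, hs0⟩ := hbad
    have hq1 : q ≠ 1 := fun h => hχ (DirichletCharacter.level_one' χ h)
    have hq0 : q ≠ 0 := NeZero.ne q
    have hreal : χ ^ 2 = 1 := by
      by_contra h2
      have hne : χ ≠ χ⁻¹ := fun h => h2 (by rw [pow_two]; nth_rewrite 2 [h]; exact mul_inv_cancel χ)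
      have hconj := LFunction_conj χ hχ (s := s) (by linarith)
      rw [hs0, map_zero] at hconj
      refine hA q q χ χ⁻¹ s.re s.im (starRingEnd ℂ s).re (starRingEnd ℂ s).im hq hq hχ (inv_ne_one.2 hχ)
        (prodChar_ne_one' _ _ hne) ?_ ?_ hs2 ?_ hs1 ?_
      · rw [hre]; exact hs0
      · rw [hre]; exact hconj
      · simpa using hs2
      · simpa using hs1
    have him : |s.im| < 7 * κ / l := by
      by_contra h
      exact hB q χ s.re s.im hq hχ hreal (by rw [hre]; exact hs0) hs2 (not_lt.1 h) hs1
    have hlt1 : s.re < 1 := by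
      by_contra h
      exact DirichletCharacter.LFunction_ne_zero_of_one_le_re χ (Or.inl hχ) (not_lt.1 h) hs0
    have hns : ‖s - 1‖ ≤ 8 * κ / l := by
      have h1 := Complex.norm_le_abs_re_add_abs_im (s - 1)
      have h2 : |(s - 1).re| ≤ κ / l := by
        rw [abs_le]; simp; constructor <;> linarith [div_pos hκ0 hl0]
      have h3 : |(s - 1).im| ≤ 7 * κ / l := by simpa using him.le
      calc _ ≤ κ / l + 7 * κ / l := by linarith
        _ = _ := by ring
    have hqlow : (c * l / (8 * κ)) ^ (20 / 13 : ℝ) ≤ q := by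
      have hqR : (0 : ℝ) < q := by exact_mod_cast Nat.pos_of_ne_zero hq0
      by_contra h
      push Not at h
      refine hc q χ hprim hχ hreal s (hns.trans ?_) hs0
      have h5 : (q : ℝ) ^ (13 / 20 : ℝ) ≤ c * l / (8 * κ) := by
        have := Real.rpow_le_rpow hqR.le h.le (show (0 : ℝ) ≤ 13 / 20 by norm_num)
        rwa [← Real.rpow_mul (by positivity), show (20 / 13 : ℝ) * (13 / 20) = 1 by norm_num, Real.rpow_one] at this
      rw [Real.rpow_neg hqR.le]
      rw [div_le_iff₀ hl0, mul_assoc, mul_comm _ l, ← mul_assoc, ← div_eq_mul_inv,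
        le_div_iff₀ (by positivity)]
      rw [le_div_iff₀ (by positivity)] at h5
      linarith
    have hne : q.primeFactors.Nonempty := Nat.nonempty_primeFactors.2 (by omega)
    set p0 := q.primeFactors.max' hne with hp0
    have hmem : p0 ∈ q.primeFactors := Finset.max'_mem _ _
    have hpr : p0.Prime := Nat.prime_of_mem_primeFactors hmem
    have hdvd : p0 ∣ q := Nat.dvd_of_mem_primeFactors hmem
    have hle := real_prim_le χ hprim hreal (p0 := p0) (fun p hp hpq =>
      Finset.le_max' _ _ (Nat.mem_primeFactors.2 ⟨hp, hpq, hq0⟩))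
    refine ⟨p0, hpr, ?_, ?_, ?_⟩
    · by_contra h
      push Not at h
      have h1 : ((8 * 4 ^ p0 : ℕ) : ℝ) ≤ 8 * l ^ (14 / 10 : ℝ) := by
        push_cast
        refine mul_le_mul_of_nonneg_left ?_ (by norm_num)
        rw [Real.rpow_def_of_pos hl0, ← Real.rpow_natCast, Real.rpow_def_of_pos (by norm_num), Real.exp_le_exp]
        have h4 : Real.log 4 ≤ 14 / 10 := by
          rw [show (4 : ℝ) = 2 ^ 2 by norm_num, Real.log_pow]; push_cast
          linarith [Real.log_two_lt_d9]
        have hlog : 0 ≤ Real.log l := Real.log_nonneg (by linarith)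
        calc Real.log 4 * p0 ≤ 14 / 10 * Real.log l := mul_le_mul h4 h.le (by positivity) (by norm_num)
          _ = _ := by ring
      have h2 : (q : ℝ) ≤ ((8 * 4 ^ p0 : ℕ) : ℝ) := by exact_mod_cast hle
      linarith [hl₂ l hll₂]
    · refine le_trans ?_ hq
      exact_mod_cast Nat.le_of_dvd (Nat.pos_of_ne_zero hq0) hdvd
    · intro q' _ χ' hq' hcop hprim' hχ' s' h1 h2 h0
      have hqq : q ≠ q' := by
        rintro rfl
        have := Nat.dvd_gcd hdvd (dvd_refl p0)
        rw [hcop] at this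
        exact hpr.one_lt.ne' (Nat.dvd_one.1 this)
      exact hA q q' χ χ' s.re s.im s'.re s'.im hq hq' hχ hχ' (prodChar_ne_one χ χ' hprim hprim' hqq)
        (by rw [hre]; exact hs0) (by rw [hre]; exact h0) hs2 h2 hs1 h1
  · push Not at hbad
    obtain ⟨p, hp, hp1, hp2⟩ := Nat.exists_prime_lt_and_le_two_mul ⌈Real.log l⌉₊ (by
      have := Real.log_pos (show 1 < l by linarith)
      exact (Nat.ceil_pos.2 this).ne')
    refine ⟨p, hp, (Nat.le_ceil _).trans (by exact_mod_cast hp1.le), ?_, ?_⟩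
    · have h1 : (p : ℝ) ≤ 2 * ⌈Real.log l⌉₊ := by exact_mod_cast hp2
      have h2 := Nat.ceil_lt_add_one (Real.log_nonneg (show 1 ≤ l by linarith))
      have h3 := Real.log_le_sub_one_of_pos hl0
      have h4 := Real.quadratic_le_exp_of_nonneg hl0.le
      have h5 := Real.log_le_sub_one_of_pos (show 0 < l / 2 by linarith)
      rw [Real.log_div hl0.ne' (by norm_num)] at h5
      have := Real.log_two_lt_d9
      nlinarith
    · intro q' _ χ' hq' _ hprim' hχ' s' h1 h2
      exact hbad q' inferInstance χ' hq' hprim' hχ' s' h1 h2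

open Complex Filter Topology MeasureTheory

/-- minus the logarithmic derivative -/
noncomputable def LD {q : ℕ} [NeZero q] (χ : DirichletCharacter ℂ q) (s : ℂ) : ℂ :=
  -(deriv χ.LFunction s / χ.LFunction s)

theorem norm_sigma_ge {σ : ℝ} (hσ : 1 ≤ σ) (t : ℝ) : √(1 + t ^ 2) ≤ ‖(σ : ℂ) + t * I‖ := by
  rw [norm_add_mul_I]
  apply Real.sqrt_le_sqrt
  nlinarith

theorem kernel_bound {σ : ℝ} (hσ : 1 ≤ σ) (t : ℝ) :
    ‖1 / (((σ : ℂ) + t * I) * ((σ : ℂ) + t * I + 1))‖ ≤ (1 + t ^ 2)⁻¹ := by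
  have h1 := norm_sigma_ge hσ t
  have h2 := norm_sigma_ge (σ := σ + 1) (by linarith) t
  rw [norm_div, norm_one, norm_mul, one_div]
  refine inv_anti₀ (by positivity) ?_
  rw [show (σ : ℂ) + t * I + 1 = ((σ + 1 : ℝ) : ℂ) + t * I by push_cast; ring]
  calc 1 + t ^ 2 = √(1 + t ^ 2) * √(1 + t ^ 2) := (Real.mul_self_sqrt (by positivity)).symm
    _ ≤ _ := mul_le_mul h1 h2 (by positivity) (by positivity)

theorem kernel_cont {σ : ℝ} (hσ : 1 ≤ σ) :
    Continuous (fun t : ℝ => 1 / (((σ : ℂ) + t * I) * ((σ : ℂ) + t * I + 1))) := by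
  refine Continuous.div continuous_const (by fun_prop) ?_
  intro t
  have h1 : (σ : ℂ) + t * I ≠ 0 := fun h => by
    have := congrArg re h; simp at this; linarith
  have h2 : (σ : ℂ) + t * I + 1 ≠ 0 := fun h => by
    have := congrArg re h; simp at this; linarith
  exact mul_ne_zero h1 h2

theorem kernel_integrable {σ : ℝ} (hσ : 1 ≤ σ) :
    Integrable (fun t : ℝ => 1 / (((σ : ℂ) + t * I) * ((σ : ℂ) + t * I + 1))) :=
  integrable_inv_one_add_sq.mono' (kernel_cont hσ).aestronglyMeasurable (ae_of_all _ fun t => kernel_bound hσ t)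

theorem perron_kernel {c u : ℝ} (hc : 1 ≤ c) (hu : 0 < u) :
    (1 / (2 * Real.pi) : ℂ) * ∫ t : ℝ, (u : ℂ) ^ (-((c : ℂ) + t * I)) * (1 / (((c : ℂ) + t * I) * ((c : ℂ) + t * I + 1)))
      = ((max (1 - u) 0 : ℝ) : ℂ) := by
  set f : ℝ → ℂ := fun t => (Set.Ioc (0 : ℝ) 1).indicator (fun _ => (1 : ℂ)) t - (Set.Ioc (0 : ℝ) 1).indicator (fun t => (t : ℂ) ^ (1 : ℂ)) t with hf
  have hm : ∀ s : ℂ, 0 < s.re → HasMellin f s (1 / (s * (s + 1))) := by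
    intro s hs
    have h1 := hasMellin_one_Ioc hs
    have h2 := hasMellin_cpow_Ioc 1 (s := s) (by simp; linarith)
    have h3 := hasMellin_sub h1.1 h2.1
    rw [h1.2, h2.2] at h3
    have e1 : s ≠ 0 := fun h => by simp [h] at hs
    have e2 : s + 1 ≠ 0 := fun h => by
      have := congrArg re h; simp at this; linarith
    have e3 : 1 / (s * (s + 1)) = 1 / s - 1 / (s + 1) := by field_simp; ring
    rw [e3]; exact h3
  have hfe : ∀ v : ℝ, 0 < v → f v = ((max (1 - v) 0 : ℝ) : ℂ) := by
    intro v hv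
    simp only [hf, Set.indicator, Set.mem_Ioc, hv, true_and, cpow_one]
    split_ifs with h
    · rw [max_eq_left (by linarith)]; push_cast; ring
    · rw [max_eq_right (by linarith)]; simp
  have hcont : ContinuousAt f u := by
    have h1 : ContinuousAt (fun v : ℝ => ((max (1 - v) 0 : ℝ) : ℂ)) u := by fun_prop
    refine h1.congr ?_
    filter_upwards [lt_mem_nhds hu] with v hv
    exact (hfe v hv).symm
  have hpos : ∀ t : ℝ, 0 < ((c : ℂ) + t * I).re := fun t => by simp; linarith
  have hval : ∀ t : ℝ, mellin f ((c : ℂ) + t * I) = 1 / (((c : ℂ) + t * I) * ((c : ℂ) + t * I + 1)) :=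
    fun t => (hm _ (hpos t)).2
  have := mellinInv_mellin_eq c f hu (hm c (by simp; linarith)).1 (by
    rw [VerticalIntegrable]
    simp only [hval]
    exact kernel_integrable hc) hcont
  rw [← hfe u hu, ← this, mellinInv]
  simp only [hval, smul_eq_mul]
  rw [real_smul]
  push_cast; rfl

theorem LD_eq_LSeries {q : ℕ} [NeZero q] (χ : DirichletCharacter ℂ q) {s : ℂ} (hs : 1 < s.re) :
    LD χ s = ∑' n, LSeries.term ((fun n : ℕ => χ n) * fun n => ((ArithmeticFunction.vonMangoldt n : ℝ) : ℂ)) s n := by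
  have := DirichletCharacter.LSeries_twist_vonMangoldt_eq χ hs
  rw [LSeries] at this
  rw [this, LD, DirichletCharacter.deriv_LFunction_eq_deriv_LSeries χ hs, DirichletCharacter.LFunction_eq_LSeries χ hs,
      neg_div]

theorem norm_LD_term_le {q : ℕ} (χ : DirichletCharacter ℂ q) (s : ℂ) (n : ℕ) :
    ‖LSeries.term ((fun n : ℕ => χ n) * fun n => ((ArithmeticFunction.vonMangoldt n : ℝ) : ℂ)) s n‖
      ≤ ArithmeticFunction.vonMangoldt n * (n : ℝ) ^ (-s.re) := by
  rcases eq_or_ne n 0 with rfl | hn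
  · simp
  · rw [LSeries.term_of_ne_zero hn, norm_div, norm_natCast_cpow_of_pos (Nat.pos_of_ne_zero hn),
      Real.rpow_neg (by positivity), ← div_eq_mul_inv, Pi.mul_apply, norm_mul, norm_real,
      Real.norm_of_nonneg ArithmeticFunction.vonMangoldt_nonneg]
    gcongr
    exact mul_le_of_le_one_left ArithmeticFunction.vonMangoldt_nonneg (norm_char_le_one' _ _)

theorem hasSum_vM {σ : ℝ} (hσ : 1 < σ) :
    HasSum (fun n : ℕ => ArithmeticFunction.vonMangoldt n * (n : ℝ) ^ (-σ)) (vK (1 : DirichletCharacter ℂ 1) σ 0) := by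
  have h := hasSum_vK (1 : DirichletCharacter ℂ 1) hσ 0
  convert h using 2 with n
  rcases eq_or_ne n 0 with rfl | hn
  · simp
  · have : ((n : ℕ) : ZMod 1) = 1 := Subsingleton.elim _ _
    simp [this]

theorem norm_LD_le {q : ℕ} [NeZero q] (χ : DirichletCharacter ℂ q) {s : ℂ} (hs : 1 < s.re) :
    ‖LD χ s‖ ≤ vK (1 : DirichletCharacter ℂ 1) s.re 0 := by
  rw [LD_eq_LSeries χ hs]
  exact tsum_of_norm_bounded (hasSum_vM hs) (norm_LD_term_le χ s)

/-- integrand -/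
noncomputable def pF {q : ℕ} [NeZero q] (χ : DirichletCharacter ℂ q) (y : ℝ) (s : ℂ) : ℂ :=
  LD χ s * (y : ℂ) ^ s * (1 / (s * (s + 1)))

theorem perron_LD {q : ℕ} [NeZero q] (χ : DirichletCharacter ℂ q) {c y : ℝ} (hc : 1 < c) (hy : 0 < y) :
    HasSum (fun n : ℕ => χ n * (ArithmeticFunction.vonMangoldt n : ℝ) * ((max (1 - n / y) 0 : ℝ) : ℂ))
      ((1 / (2 * Real.pi) : ℂ) * ∫ t : ℝ, pF χ y (c + t * I)) := by
  set a : ℕ → ℂ := (fun n : ℕ => χ n) * fun n => ((ArithmeticFunction.vonMangoldt n : ℝ) : ℂ) with ha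
  set F : ℕ → ℝ → ℂ := fun n t => LSeries.term a (c + t * I) n * (y : ℂ) ^ ((c : ℂ) + t * I) *
    (1 / (((c : ℂ) + t * I) * ((c : ℂ) + t * I + 1))) with hF
  have hyC : (y : ℂ) ≠ 0 := by exact_mod_cast hy.ne'
  have hcontpow : Continuous (fun t : ℝ => (y : ℂ) ^ ((c : ℂ) + t * I)) := by
    refine Continuous.const_cpow (by fun_prop) (Or.inl hyC)
  have hcontterm : ∀ n, Continuous (fun t : ℝ => LSeries.term a (c + t * I) n) := by
    intro n
    rcases eq_or_ne n 0 with rfl | hn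
    · simp only [LSeries.term_zero]; exact continuous_const
    · simp only [LSeries.term_of_ne_zero hn]
      have hn' : (n : ℂ) ≠ 0 := by exact_mod_cast hn
      refine Continuous.div continuous_const (Continuous.const_cpow (by fun_prop) (Or.inl hn')) ?_
      intro t; simp [cpow_eq_zero_iff, hn']
  have hnormpow : ∀ t : ℝ, ‖(y : ℂ) ^ ((c : ℂ) + t * I)‖ = y ^ c := fun t => by
    rw [norm_cpow_eq_rpow_re_of_pos hy]; simp
  have hbd : ∀ n t, ‖F n t‖ ≤ ArithmeticFunction.vonMangoldt n * (n : ℝ) ^ (-c) * y ^ c * (1 + t ^ 2)⁻¹ := by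
    intro n t
    simp only [hF]
    rw [norm_mul, norm_mul, hnormpow]
    have h1 := norm_LD_term_le χ (c + t * I) n
    have h2 : ((c : ℂ) + t * I).re = c := by simp
    rw [h2] at h1
    have h3 := kernel_bound hc.le t
    gcongr
  have hIntg : ∀ n, Integrable (F n) := by
    intro n
    refine (integrable_inv_one_add_sq.const_mul _).mono' ?_ (ae_of_all _ fun t => hbd n t)
    exact (((hcontterm n).mul hcontpow).mul (kernel_cont hc.le)).aestronglyMeasurable
  have hsum : Summable fun n => ∫ t, ‖F n t‖ := by
    refine Summable.of_nonneg_of_le (fun n => integral_nonneg fun t => norm_nonneg _)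
      (f := fun n : ℕ => ArithmeticFunction.vonMangoldt n * (n : ℝ) ^ (-c) * y ^ c * Real.pi) (fun n => ?_)
      (((hasSum_vM hc).summable.mul_right _).mul_right _)
    rw [← integral_univ_inv_one_add_sq, ← integral_const_mul]
    exact integral_mono (hIntg n).norm (integrable_inv_one_add_sq.const_mul _) (hbd n)
  have key := (hasSum_integral_of_summable_integral_norm hIntg hsum).mul_left (1 / (2 * Real.pi) : ℂ)
  have e1 : ∀ t : ℝ, ∑' n, F n t = pF χ y (c + t * I) := by
    intro t
    simp only [hF]
    rw [tsum_mul_right, tsum_mul_right, ← LD_eq_LSeries χ (by simpa using hc), pF]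
  simp only [e1] at key
  have hfun : (fun n : ℕ => χ n * (ArithmeticFunction.vonMangoldt n : ℝ) * ((max (1 - n / y) 0 : ℝ) : ℂ)) =
      (fun i => (1 / (2 * Real.pi) : ℂ) * ∫ t : ℝ, F i t) := by
    funext n
    rcases eq_or_ne n 0 with rfl | hn
    · simp [hF]
    · have hn0 : (0 : ℝ) < n := by exact_mod_cast Nat.pos_of_ne_zero hn
      rw [← perron_kernel hc.le (show 0 < n / y by positivity), mul_left_comm, ← integral_const_mul]
      congr 1
      refine integral_congr_ae (ae_of_all _ fun t => ?_)
      simp only [hF]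
      rw [LSeries.term_of_ne_zero hn]
      have h1 := mul_cpow_ofReal_nonneg (show 0 ≤ n / y by positivity) hy.le (-((c : ℂ) + t * I))
      rw [← ofReal_mul, div_mul_cancel₀ _ hy.ne', cpow_neg (y : ℂ), ofReal_natCast, cpow_neg] at h1
      have h2 : (y : ℂ) ^ ((c : ℂ) + t * I) ≠ 0 := by simp [cpow_eq_zero_iff, hyC]
      have h3 : ((n / y : ℝ) : ℂ) ^ (-((c : ℂ) + t * I)) = ((n : ℂ) ^ ((c : ℂ) + t * I))⁻¹ * (y : ℂ) ^ ((c : ℂ) + t * I) := by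
        rw [h1, mul_assoc, inv_mul_cancel₀ h2, mul_one]
      rw [h3, ha, Pi.mul_apply]
      ring
  rw [hfun]; exact key

theorem pF_bound_of {q : ℕ} [NeZero q] (χ : DirichletCharacter ℂ q) {y B σ t K : ℝ} (hy : 0 < y) (hB : ‖LD χ (σ + t * I)‖ ≤ B)
    (hK : ‖1 / (((σ : ℂ) + t * I) * ((σ : ℂ) + t * I + 1))‖ ≤ K) :
    ‖pF χ y (σ + t * I)‖ ≤ B * y ^ σ * K := by
  have hnormpow : ‖(y : ℂ) ^ ((σ : ℂ) + t * I)‖ = y ^ σ := by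
    rw [norm_cpow_eq_rpow_re_of_pos hy]; simp
  rw [pF, norm_mul, norm_mul, hnormpow]
  have : 0 ≤ B := (norm_nonneg _).trans hB
  gcongr

theorem kernel_bound2 {σ : ℝ} (hσ : 1 / 2 ≤ σ) (t : ℝ) :
    ‖1 / (((σ : ℂ) + t * I) * ((σ : ℂ) + t * I + 1))‖ ≤ 4 * (1 + t ^ 2)⁻¹ := by
  have h1 : √((1 + t ^ 2) / 4) ≤ ‖(σ : ℂ) + t * I‖ := by
    rw [norm_add_mul_I]
    apply Real.sqrt_le_sqrt
    nlinarith
  have h2 : √((1 + t ^ 2) / 4) ≤ ‖((σ + 1 : ℝ) : ℂ) + t * I‖ := by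
    rw [norm_add_mul_I]
    apply Real.sqrt_le_sqrt
    nlinarith
  rw [norm_div, norm_one, norm_mul, one_div, show (4 : ℝ) * (1 + t ^ 2)⁻¹ = ((1 + t ^ 2) / 4)⁻¹ by rw [inv_div]; ring]
  refine inv_anti₀ (by positivity) ?_
  rw [show (σ : ℂ) + t * I + 1 = ((σ + 1 : ℝ) : ℂ) + t * I by push_cast; ring]
  calc _ = √((1 + t ^ 2) / 4) * √((1 + t ^ 2) / 4) := (Real.mul_self_sqrt (by positivity)).symm
    _ ≤ _ := mul_le_mul h1 h2 (by positivity) (by positivity)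

theorem kernel_bound3 {σ t T : ℝ} (hT : 0 < T) (ht : T ≤ |t|) :
    ‖1 / (((σ : ℂ) + t * I) * ((σ : ℂ) + t * I + 1))‖ ≤ 1 / T ^ 2 := by
  have h1 : T ≤ ‖(σ : ℂ) + t * I‖ := ht.trans (by simpa using abs_im_le_norm ((σ : ℂ) + t * I))
  have h2 : T ≤ ‖(σ : ℂ) + t * I + 1‖ := ht.trans (by simpa using abs_im_le_norm ((σ : ℂ) + t * I + 1))
  rw [norm_div, norm_one, norm_mul]
  refine one_div_le_one_div_of_le (by positivity) ?_
  rw [pow_two]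
  exact mul_le_mul h1 h2 hT.le (by positivity)

theorem integral_inv_tail {T : ℝ} (hT : 0 < T) : ∫ t in Set.Ioi T, (1 + t ^ 2)⁻¹ ≤ 1 / T := by
  have h1 : ∫ t in Set.Ioi T, t ^ (-2 : ℝ) = 1 / T := by
    rw [integral_Ioi_rpow_of_lt (by norm_num) hT]
    norm_num
    rw [Real.rpow_neg_one]
  rw [← h1]
  refine setIntegral_mono_on integrable_inv_one_add_sq.integrableOn
    (integrableOn_Ioi_rpow_of_lt (by norm_num) hT) measurableSet_Ioi fun t ht => ?_
  have ht : T < t := ht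
  have ht0 : 0 < t := hT.trans ht
  rw [Real.rpow_neg ht0.le, show (2 : ℝ) = ((2 : ℕ) : ℝ) by norm_num, Real.rpow_natCast]
  exact inv_anti₀ (by positivity) (by norm_num)

theorem perron_bound {q : ℕ} [NeZero q] (χ : DirichletCharacter ℂ q) (hχ : χ ≠ 1) {y B c η T : ℝ} (hc : 1 < c) (hc2 : c ≤ 2)
    (hη0 : 0 < η) (hη : η ≤ 1 / 2) (hT : 1 ≤ T) (hy : 1 ≤ y)
    (hz : ∀ s : ℂ, 1 - η ≤ s.re → |s.im| ≤ T → χ.LFunction s ≠ 0)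
    (hB : ∀ s : ℂ, 1 - η ≤ s.re → s.re ≤ c → |s.im| ≤ T → ‖LD χ s‖ ≤ B)
    (hB' : ∀ s : ℂ, s.re = c → ‖LD χ s‖ ≤ B) :
    ‖∫ t : ℝ, pF χ y (c + t * I)‖ ≤ B * (13 * y ^ (1 - η) + 6 * y ^ c / T) := by
  have hy0 : 0 < y := by linarith
  have hT0 : 0 < T := by linarith
  have hyC : (y : ℂ) ≠ 0 := by exact_mod_cast hy0.ne'
  have hB0 : 0 ≤ B := (norm_nonneg _).trans (hB' c (by simp))
  -- differentiability
  have hdiff : DifferentiableOn ℂ (pF χ y) {s | 1 - η ≤ s.re ∧ |s.im| ≤ T} := by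
    intro s hs
    have hd := DirichletCharacter.differentiable_LFunction hχ
    have h1 : DifferentiableAt ℂ (deriv χ.LFunction) s := hd.analyticAt s |>.deriv.differentiableAt
    have h2 : DifferentiableAt ℂ (LD χ) s := (h1.div (hd s) (hz s hs.1 hs.2)).neg
    have h3 : DifferentiableAt ℂ (fun s : ℂ => (y : ℂ) ^ s) s := by
      refine DifferentiableAt.const_cpow differentiableAt_id (Or.inl hyC)
    have e1 : s ≠ 0 := fun h => by
      have := hs.1; rw [h] at this; simp at this; linarith
    have e2 : s + 1 ≠ 0 := fun h => by
      have h4 := congrArg re h; have := hs.1; simp at h4; linarith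
    refine DifferentiableAt.differentiableWithinAt ?_
    exact (h2.mul h3).mul ((differentiableAt_const _).div (differentiableAt_id.mul (differentiableAt_id.add_const 1)) (mul_ne_zero e1 e2))
  have hrect := integral_boundary_rect_eq_zero_of_differentiableOn (pF χ y) (((1 - η : ℝ) : ℂ) + ((-T : ℝ) : ℂ) * I) ((c : ℂ) + (T : ℂ) * I) (by
    refine hdiff.mono ?_
    intro s hs
    rw [mem_reProdIm] at hs
    simp only [add_re, ofReal_re, mul_re, I_re, mul_zero, ofReal_im, I_im, mul_one, sub_self, add_zero, add_im, mul_im, zero_add] at hs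
    rw [Set.uIcc_of_le (by linarith), Set.uIcc_of_le (by linarith)] at hs
    exact ⟨hs.1.1, abs_le.2 hs.2⟩)
  simp only [add_re, ofReal_re, mul_re, I_re, mul_zero, ofReal_im, I_im, mul_one, sub_self, add_zero, add_im, mul_im, zero_add, smul_eq_mul] at hrect
  -- pieces
  have hhor : ∀ t : ℝ, |t| = T → ‖∫ x in (1 - η)..c, pF χ y (x + t * I)‖ ≤ 2 * (B * y ^ c * (1 / T ^ 2)) := by
    intro t ht
    have := intervalIntegral.norm_integral_le_of_norm_le_const (a := 1 - η) (b := c) (f := fun x : ℝ => pF χ y (x + t * I)) (C := B * y ^ c * (1 / T ^ 2)) (by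
      intro x hx
      rw [Set.uIoc_of_le (by linarith)] at hx
      refine (pF_bound_of χ hy0 (hB _ (by simpa using hx.1.le) (by simpa using hx.2) (by simpa using ht.le)) (kernel_bound3 hT0 ht.ge)).trans ?_
      have := Real.rpow_le_rpow_of_exponent_le hy hx.2
      gcongr)
    refine this.trans ?_
    rw [mul_comm]
    refine mul_le_mul_of_nonneg_right ?_ (by positivity)
    rw [abs_of_nonneg (by linarith)]; linarith
  have hleft : ‖∫ t in (-T)..T, pF χ y (((1 - η : ℝ) : ℂ) + t * I)‖ ≤ B * y ^ (1 - η) * 4 * Real.pi := by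
    have h1 : ‖∫ t in (-T)..T, pF χ y (((1 - η : ℝ) : ℂ) + t * I)‖ ≤ ∫ t in (-T)..T, B * y ^ (1 - η) * 4 * (1 + t ^ 2)⁻¹ := by
      refine intervalIntegral.norm_integral_le_of_norm_le (by linarith) (ae_of_all _ fun t ht => ?_)
        (integrable_inv_one_add_sq.const_mul _).intervalIntegrable
      refine (pF_bound_of χ hy0 (hB _ (by simp) (by simp; linarith) (by simpa using abs_le.2 ⟨ht.1.le, ht.2⟩)) (kernel_bound2 (by linarith) t)).trans (le_of_eq (by ring))
    refine h1.trans ?_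
    rw [intervalIntegral.integral_const_mul]
    refine mul_le_mul_of_nonneg_left ?_ (by positivity)
    rw [intervalIntegral.integral_of_le (by linarith), ← integral_univ_inv_one_add_sq]
    exact setIntegral_le_integral integrable_inv_one_add_sq (ae_of_all _ fun t => by positivity)
  have hbdc : ∀ t : ℝ, ‖pF χ y (c + t * I)‖ ≤ B * y ^ c * (1 + t ^ 2)⁻¹ := fun t =>
    pF_bound_of χ hy0 (hB' _ (by simp)) (kernel_bound hc.le t)
  have hmeas : AEStronglyMeasurable (fun t : ℝ => pF χ y (c + t * I)) := by
    have hd := DirichletCharacter.differentiable_LFunction hχ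
    refine Measurable.aestronglyMeasurable ?_
    have m1 : Measurable (fun t : ℝ => (c : ℂ) + t * I) := by fun_prop
    have m2 : Measurable (deriv χ.LFunction) := measurable_deriv _
    have m3 : Measurable χ.LFunction := hd.continuous.measurable
    have m4 : Measurable (LD χ) := (m2.div m3).neg
    have m5 : Measurable (fun s : ℂ => (y : ℂ) ^ s) := by fun_prop
    exact ((m4.mul m5).mul (by fun_prop : Measurable fun s : ℂ => 1 / (s * (s + 1)))).comp m1
  have hIntg : Integrable (fun t : ℝ => pF χ y (c + t * I)) :=
    (integrable_inv_one_add_sq.const_mul _).mono' hmeas (ae_of_all _ hbdc)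
  have htailp : ‖∫ t in Set.Ioi T, pF χ y (c + t * I)‖ ≤ B * y ^ c * (1 / T) := by
    refine (norm_integral_le_of_norm_le (integrable_inv_one_add_sq.const_mul (B * y ^ c)).integrableOn (ae_of_all _ hbdc)).trans ?_
    rw [integral_const_mul]
    exact mul_le_mul_of_nonneg_left (integral_inv_tail hT0) (by positivity)
  have htailn : ‖∫ t in Set.Iic (-T), pF χ y (c + t * I)‖ ≤ B * y ^ c * (1 / T) := by
    refine (norm_integral_le_of_norm_le (integrable_inv_one_add_sq.const_mul (B * y ^ c)).integrableOn (ae_of_all _ hbdc)).trans ?_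
    rw [integral_const_mul]
    refine mul_le_mul_of_nonneg_left ?_ (by positivity)
    have := integral_comp_neg_Iic (-T) (fun t : ℝ => (1 + t ^ 2)⁻¹)
    simp only [neg_neg, even_two, Even.neg_pow] at this
    rw [this]
    exact integral_inv_tail hT0
  have hsplit : ∫ t : ℝ, pF χ y (c + t * I) = (∫ t in Set.Iic (-T), pF χ y (c + t * I)) +
      ((∫ t in (-T)..T, pF χ y (c + t * I)) + ∫ t in Set.Ioi T, pF χ y (c + t * I)) := by
    rw [intervalIntegral.integral_interval_add_Ioi hIntg.integrableOn hIntg.integrableOn,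
      intervalIntegral.integral_Iic_add_Ioi hIntg.integrableOn hIntg.integrableOn]
  have hmid : ‖∫ t in (-T)..T, pF χ y (c + t * I)‖ ≤ 4 * (B * y ^ c * (1 / T ^ 2)) + B * y ^ (1 - η) * 4 * Real.pi := by
    have e : I * ∫ t in (-T)..T, pF χ y (c + t * I) = I * (∫ t in (-T)..T, pF χ y (((1 - η : ℝ) : ℂ) + t * I)) +
       ((∫ x in (1 - η)..c, pF χ y (x + T * I)) - ∫ x in (1 - η)..c, pF χ y (x + ((-T : ℝ) : ℂ) * I)) := by
      linear_combination hrect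
    have e2 := congrArg norm e
    rw [norm_mul, norm_I, one_mul] at e2
    rw [e2]
    refine (norm_add_le _ _).trans ?_
    rw [norm_mul, norm_I, one_mul]
    have h3 := norm_sub_le (∫ x in (1 - η)..c, pF χ y (x + T * I)) (∫ x in (1 - η)..c, pF χ y (x + ((-T : ℝ) : ℂ) * I))
    have h4 := hhor T (abs_of_pos hT0)
    have h5 := hhor (-T) (by rw [abs_neg, abs_of_pos hT0])
    linarith
  rw [hsplit]
  have hT2 : 1 / T ^ 2 ≤ 1 / T := one_div_le_one_div_of_le hT0 (by nlinarith)
  have h6 : B * y ^ c * (1 / T ^ 2) ≤ B * y ^ c * (1 / T) := mul_le_mul_of_nonneg_left hT2 (by positivity)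
  have h7 : B * y ^ (1 - η) * 4 * Real.pi ≤ B * y ^ (1 - η) * 13 := by
    rw [mul_assoc]
    exact mul_le_mul_of_nonneg_left (by linarith [Real.pi_lt_d2]) (by positivity)
  refine (norm_add_le _ _).trans ((add_le_add htailn ((norm_add_le _ _).trans (add_le_add hmid htailp))).trans ?_)
  calc _ ≤ 6 * (B * y ^ c * (1 / T)) + B * y ^ (1 - η) * 13 := by linarith
    _ = _ := by ring

open Complex Filter Topology

theorem LD_bound_good {κ l : ℝ} (hκ0 : 0 < κ) (hκ1 : κ ≤ 1 / 100) (hl1 : 1 ≤ l) (hl2 : 48 * l / κ ≤ Real.exp l)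
    {q : ℕ} [NeZero q] (χ : DirichletCharacter ℂ q) (hχ : χ ≠ 1) (hq : (q : ℝ) ≤ Real.exp l)
    (hz : ∀ s : ℂ, 1 - κ / l ≤ s.re → |s.im| ≤ 2 * Real.exp l → χ.LFunction s ≠ 0)
    {s : ℂ} (h1 : 1 - κ / (2 * l) ≤ s.re) (h2 : s.re ≤ 1 + 3 * (κ / (2 * l))) (h3 : |s.im| ≤ Real.exp l) :
    ‖LD χ s‖ ≤ 224 * l ^ 2 / κ := by
  have hl0 : 0 < l := by linarith
  obtain ⟨η, hη⟩ : ∃ η, η = κ / (2 * l) := ⟨_, rfl⟩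
  have hη0 : 0 < η := by rw [hη]; positivity
  have hη2 : κ / l = 2 * η := by rw [hη]; field_simp
  have hη1 : η ≤ 1 / 200 := by
    rw [hη, div_le_iff₀ (by positivity)]; linarith
  rw [← hη] at h1 h2
  rw [hη2] at hz
  have hel : 1 + l ≤ Real.exp l := by linarith [Real.add_one_le_exp l]
  set t := s.im with ht
  set s0 : ℂ := ((1 + η : ℝ) : ℂ) + t * I with hs0
  have hs0re : s0.re = 1 + η := by simp [hs0]
  have hs0im : s0.im = t := by simp [hs0]
  have hL0 : η / 3 ≤ ‖χ.LFunction s0‖ := by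
    have := norm_LFunction_ge χ (s := s0) (by rw [hs0re]; linarith) (by rw [hs0re]; linarith)
    rw [hs0re] at this
    convert this using 1; ring
  have hexp : 2 * q * (|t| + 3) ≤ Real.exp (3 * l) * (η / 3) := by
    have e1 : Real.exp (3 * l) = Real.exp l * Real.exp l * Real.exp l := by
      rw [← Real.exp_add, ← Real.exp_add]; congr 1; ring
    have e2 : |t| + 3 ≤ 4 * Real.exp l := by linarith
    have e3 : 48 ≤ Real.exp l * (2 * η) := by
      rw [← hη2]
      have : 48 * l / κ * (κ / l) = 48 := by field_simp
      calc (48 : ℝ) = 48 * l / κ * (κ / l) := this.symm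
        _ ≤ _ := by gcongr
    calc 2 * q * (|t| + 3) ≤ 2 * Real.exp l * (4 * Real.exp l) := by gcongr
      _ = 8 * (Real.exp l * Real.exp l) := by ring
      _ ≤ (Real.exp l * (η / 3)) * (Real.exp l * Real.exp l) := by
          gcongr; linarith
      _ = _ := by rw [e1]; ring
  have key := logDeriv_le_of_zero_free (f := fun z => χ.LFunction (s0 + z)) (R := 3 * η) (M := 3 * l) (by positivity) (by positivity)
    (((DirichletCharacter.differentiable_LFunction hχ).comp (by fun_prop : Differentiable ℂ fun z : ℂ => s0 + z)).differentiableOn)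
    (by
      intro z hzz
      rw [mem_ball_zero_iff] at hzz
      have hr := abs_le.1 (abs_re_le_norm z)
      have hi := abs_im_le_norm z
      apply hz
      · rw [add_re, hs0re]; linarith
      · rw [add_im, hs0im]
        have := abs_add_le t z.im
        linarith)
    (by
      intro z hzz
      rw [mem_ball_zero_iff] at hzz
      have h := norm_le_on_disc χ hχ (σ := 1 + η) (t := t) (by linarith) (by linarith) (z := z) (by linarith)
      simp only [add_zero]
      refine h.trans (hexp.trans ?_)
      gcongr)
    (z := s - s0) (by
      have : s - s0 = ((s.re - (1 + η) : ℝ) : ℂ) := by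
        apply Complex.ext <;> simp [hs0, ht]
      rw [this, norm_real, Real.norm_eq_abs, abs_le]
      constructor <;> linarith)
  have e := deriv_comp_const_add (f := χ.LFunction) (s0) (s - s0)
  simp only [e, add_sub_cancel] at key
  rw [LD, norm_neg]
  refine key.trans (le_of_eq ?_)
  rw [hη]; field_simp; ring

set_option maxHeartbeats 2000000 in
theorem psi_small {κ : ℝ} (hκ0 : 0 < κ) (hκ1 : κ ≤ 1 / 100) : ∃ l₂ : ℝ, 1 ≤ l₂ ∧ ∀ l : ℝ, l₂ ≤ l →
    ∀ p0 : ℕ, GoodMod κ l p0 → ∀ (q : ℕ) [NeZero q] (χ : DirichletCharacter ℂ q), (q : ℝ) ≤ Real.exp l →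
      Nat.Coprime q p0 → χ.IsPrimitive → χ ≠ 1 → ∀ N : ℕ, (N : ℝ) ≤ Real.exp (l ^ 2) →
      ‖∑ n ∈ Finset.range (N + 1), χ n * (ArithmeticFunction.vonMangoldt n : ℝ)‖ ≤ Real.exp (l ^ 2 - κ / 8 * l) := by
  obtain ⟨C, hC0, hC⟩ := exists_vK_one_le
  have t1 : ∀ᶠ l : ℝ in atTop, 48 / κ * l ≤ Real.exp l := by
    have := (Real.isLittleO_pow_exp_atTop (n := 1)).bound (show 0 < κ / 48 by positivity)
    filter_upwards [this, eventually_ge_atTop 0] with l h h0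
    simp only [pow_one, Real.norm_eq_abs, abs_of_nonneg h0, Real.abs_exp] at h
    calc 48 / κ * l ≤ 48 / κ * (κ / 48 * Real.exp l) := by gcongr
      _ = _ := by field_simp
  have t2 : ∀ᶠ l : ℝ in atTop, (24000 / κ + 2) * l ^ 2 ≤ Real.exp (κ / 8 * l) := by
    have := (isLittleO_pow_exp_pos_mul_atTop 2 (show 0 < κ / 8 by positivity)).bound (show 0 < (24000 / κ + 2)⁻¹ by positivity)
    filter_upwards [this, eventually_ge_atTop 0] with l h h0
    simp only [Real.norm_eq_abs, abs_of_nonneg (sq_nonneg l), Real.abs_exp] at h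
    rwa [inv_mul_eq_div, le_div_iff₀ (by positivity), mul_comm] at h
  obtain ⟨l₂, hl₂⟩ := eventually_atTop.1 (t1.and (t2.and ((eventually_ge_atTop C).and (eventually_ge_atTop (2 / κ)))))
  refine ⟨max 1 l₂, le_max_left _ _, ?_⟩
  intro l hl p0 hgood q _ χ hq hcop hprim hχ N hN
  obtain ⟨a1, a2, a3, a4⟩ := hl₂ l ((le_max_right _ _).trans hl)
  have hl1 : 1 ≤ l := (le_max_left _ _).trans hl
  clear hl₂ t1 t2
  have hl0 : 0 < l := by linarith
  have hll : l ≤ l ^ 2 := by nlinarith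
  have hz := hgood q χ hq hcop hprim hχ
  set η := κ / (2 * l) with hη
  have hη0 : 0 < η := by positivity
  have hη1 : η ≤ 1 / 2 := by
    rw [hη, div_le_iff₀ (by positivity)]; linarith
  have hcη : 1 / l ^ 2 ≤ 3 * η := by
    rw [hη, div_le_iff₀ (by positivity)]
    rw [div_le_iff₀ hκ0] at a4
    have : 3 * (κ / (2 * l)) * l ^ 2 = 3 / 2 * (l * κ) := by field_simp
    rw [this]; linarith
  have hl2' : 1 / l ^ 2 ≤ 1 := by rw [div_le_one (by positivity)]; linarith
  have hl2p : 0 < 1 / l ^ 2 := by positivity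
  set c := 1 + 1 / l ^ 2 with hc
  have hcc : 1 < c := by linarith
  have hc2 : c ≤ 2 := by linarith
  have hTe : 1 ≤ Real.exp l := Real.one_le_exp hl0.le
  set X := Real.exp (l ^ 2) with hX
  have hX1 : 1 ≤ X := Real.one_le_exp (by positivity)
  -- smoothed bound
  have hsm : ∀ y : ℝ, 1 ≤ y → y ≤ 2 * X → ∀ K : ℕ, y ≤ K →
      ‖∑ n ∈ Finset.range K, χ n * (ArithmeticFunction.vonMangoldt n : ℝ) * ((max (y - n) 0 : ℝ) : ℂ)‖ ≤
        12000 * l ^ 2 / κ * X ^ 2 * Real.exp (-(κ / 2 * l)) := by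
    intro y hy hy2 K hK
    have hy0 : 0 < y := by linarith
    have hp := perron_LD χ hcc hy0
    have hB := perron_bound χ hχ (B := 300 * l ^ 2 / κ) (T := Real.exp l) hcc hc2 hη0 hη1 hTe hy
      (fun s h1 h2 => hz s (le_trans (by
        have : κ / l = 2 * η := by rw [hη]; field_simp
        rw [this]; linarith) h1) (by linarith))
      (fun s h1 h2 h3 => (LD_bound_good hκ0 hκ1 hl1 (by rw [mul_div_right_comm]; exact a1) χ hχ hq hz h1 (by linarith) h3).trans (by gcongr; norm_num))
      (fun s h1 => by
        refine (norm_LD_le χ (by rw [h1]; exact hcc)).trans ?_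
        rw [h1]
        refine (hC c hcc hc2).trans ?_
        have : 1 / (c - 1) = l ^ 2 := by rw [hc]; simp
        rw [this, le_div_iff₀ hκ0]
        have : (l ^ 2 + C) * κ ≤ (l ^ 2 + l ^ 2) * 1 := by gcongr <;> linarith
        linarith)
    have hfin := hasSum_sum_of_ne_finset_zero (L := SummationFilter.unconditional ℕ) (f := fun n : ℕ => χ n * (ArithmeticFunction.vonMangoldt n : ℝ) * ((max (1 - n / y) 0 : ℝ) : ℂ))
      (s := Finset.range K) (by
        intro n hn
        rw [Finset.mem_range, not_lt] at hn
        have hn' : (K : ℝ) ≤ n := by exact_mod_cast hn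
        have : 1 - (n : ℝ) / y ≤ 0 := by
          rw [sub_nonpos, le_div_iff₀ hy0]; linarith
        rw [max_eq_right this]; simp)
    have heq := hfin.unique hp
    have e1 : ∑ n ∈ Finset.range K, χ n * (ArithmeticFunction.vonMangoldt n : ℝ) * ((max (y - n) 0 : ℝ) : ℂ) =
        y * ∑ n ∈ Finset.range K, χ n * (ArithmeticFunction.vonMangoldt n : ℝ) * ((max (1 - n / y) 0 : ℝ) : ℂ) := by
      rw [Finset.mul_sum]
      refine Finset.sum_congr rfl fun n _ => ?_
      have : max (y - n) 0 = y * max (1 - n / y) 0 := by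
        rw [mul_max_of_nonneg _ _ hy0.le, mul_zero, mul_sub, mul_one, mul_div_cancel₀ _ hy0.ne']
      rw [this]; push_cast; ring
    rw [e1, heq, norm_mul, norm_mul, norm_real, Real.norm_of_nonneg hy0.le]
    have e2 : ‖(1 / (2 * Real.pi) : ℂ)‖ ≤ 1 / 6 := by
      have : (1 / (2 * Real.pi) : ℂ) = ((1 / (2 * Real.pi) : ℝ) : ℂ) := by push_cast; rfl
      rw [this, norm_real, Real.norm_of_nonneg (by positivity)]
      apply one_div_le_one_div_of_le (by norm_num)
      linarith [Real.pi_gt_three]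
    have e3 : y ^ (1 - η) ≤ 2 * (X * Real.exp (-(κ / 2 * l))) := by
      calc y ^ (1 - η) ≤ (2 * X) ^ (1 - η) := Real.rpow_le_rpow hy0.le hy2 (by linarith)
        _ = 2 ^ (1 - η) * X ^ (1 - η) := Real.mul_rpow (by norm_num) (by positivity)
        _ ≤ 2 ^ (1 : ℝ) * (X * Real.exp (-(κ / 2 * l))) := by
            have : X ^ (1 - η) = X * Real.exp (-(κ / 2 * l)) := by
              rw [hX, ← Real.exp_mul, ← Real.exp_add]
              congr 1
              rw [hη]; field_simp; ring
            rw [this]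
            gcongr
            · norm_num
            · linarith
        _ = _ := by simp
    have e4 : y ^ c / Real.exp l ≤ 12 * (X * Real.exp (-(κ / 2 * l))) := by
      have h5 : y ^ c ≤ 4 * (X * 3) := by
        calc y ^ c ≤ (2 * X) ^ c := Real.rpow_le_rpow hy0.le hy2 (by linarith)
          _ = 2 ^ c * X ^ c := Real.mul_rpow (by norm_num) (by positivity)
          _ ≤ 2 ^ (2 : ℝ) * (X * 3) := by
            have : X ^ c = X * Real.exp 1 := by
              rw [hX, ← Real.exp_mul, ← Real.exp_add]
              congr 1
              rw [hc]; field_simp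
            rw [this]
            gcongr
            · norm_num
            · linarith [Real.exp_one_lt_d9]
          _ = _ := by norm_num
      rw [div_eq_mul_inv, ← Real.exp_neg]
      calc y ^ c * Real.exp (-l) ≤ 4 * (X * 3) * Real.exp (-(κ / 2 * l)) := by
            gcongr
            nlinarith
        _ = _ := by ring
    calc y * (‖(1 / (2 * Real.pi) : ℂ)‖ * ‖∫ t : ℝ, pF χ y (c + t * I)‖)
        ≤ (2 * X) * (1 / 6 * (300 * l ^ 2 / κ * (13 * (2 * (X * Real.exp (-(κ / 2 * l)))) + 6 * (12 * (X * Real.exp (-(κ / 2 * l))))))) := by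
          have h6 : 6 * y ^ c / Real.exp l = 6 * (y ^ c / Real.exp l) := by ring
          rw [h6] at hB
          have h7 : 300 * l ^ 2 / κ * (13 * y ^ (1 - η) + 6 * (y ^ c / Real.exp l)) ≤
            (300 * l ^ 2 / κ * (13 * (2 * (X * Real.exp (-(κ / 2 * l)))) + 6 * (12 * (X * Real.exp (-(κ / 2 * l)))))) := by
            gcongr
          refine mul_le_mul hy2 (mul_le_mul e2 (hB.trans h7) (norm_nonneg _) (by norm_num)) (by positivity) (by positivity)
      _ = 9800 * (l ^ 2 / κ * X ^ 2 * Real.exp (-(κ / 2 * l))) := by ring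
      _ ≤ 12000 * (l ^ 2 / κ * X ^ 2 * Real.exp (-(κ / 2 * l))) := by gcongr; norm_num
      _ = _ := by ring
  rcases Nat.eq_zero_or_pos N with rfl | hNpos
  · simp; positivity
  have hN1 : (1 : ℝ) ≤ N := by exact_mod_cast hNpos
  set w := Real.exp (-(κ / 4 * l)) with hw
  have hw0 : 0 < w := Real.exp_pos _
  have hw1 : w ≤ 1 := Real.exp_le_one_iff.2 (by rw [neg_nonpos]; positivity)
  set h := X * w with hh
  have hh0 : 0 < h := by positivity
  have hhX : h ≤ X := by rw [hh]; nlinarith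
  set K := ⌈(N : ℝ) + h⌉₊ with hK
  have hKge : (N : ℝ) + h ≤ K := Nat.le_ceil _
  have hNK : N + 1 ≤ K := by
    have : (N : ℝ) < K := by linarith
    exact_mod_cast this
  have hKlt : (K : ℝ) < N + h + 1 := Nat.ceil_lt_add_one (by positivity)
  have hs1 := hsm N hN1 (by linarith) K (by linarith)
  have hs2 := hsm (N + h) (by linarith) (by linarith) K hKge
  have hdec : (h : ℂ) * ∑ n ∈ Finset.range (N + 1), χ n * (ArithmeticFunction.vonMangoldt n : ℝ) =
      ∑ n ∈ Finset.range K, χ n * (ArithmeticFunction.vonMangoldt n : ℝ) * ((max (N + h - n) 0 : ℝ) : ℂ)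
      - ∑ n ∈ Finset.range K, χ n * (ArithmeticFunction.vonMangoldt n : ℝ) * ((max (N - n) 0 : ℝ) : ℂ)
      - ∑ n ∈ Finset.Ico (N + 1) K, χ n * (ArithmeticFunction.vonMangoldt n : ℝ) * ((max (N + h - n) 0 : ℝ) : ℂ) := by
    rw [← Finset.sum_sub_distrib, ← Finset.sum_range_add_sum_Ico _ hNK, add_sub_assoc, ← Finset.sum_sub_distrib,
      Finset.mul_sum]
    rw [Finset.sum_eq_zero (s := Finset.Ico (N + 1) K), add_zero]
    · refine Finset.sum_congr rfl fun n hn => ?_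
      rw [Finset.mem_range] at hn
      have : (n : ℝ) ≤ N := by exact_mod_cast Nat.lt_succ_iff.1 hn
      rw [max_eq_left (by linarith), max_eq_left (by linarith)]
      push_cast; ring
    · intro n hn
      rw [Finset.mem_Ico] at hn
      have : (N : ℝ) ≤ n := by exact_mod_cast (by omega : N ≤ n)
      rw [max_eq_right (by linarith : (N : ℝ) - n ≤ 0)]
      simp
  have htail : ‖∑ n ∈ Finset.Ico (N + 1) K, χ n * (ArithmeticFunction.vonMangoldt n : ℝ) * ((max (N + h - n) 0 : ℝ) : ℂ)‖ ≤
      h * (2 * l ^ 2 * h) := by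
    have hb : ∀ n ∈ Finset.Ico (N + 1) K, ‖χ n * (ArithmeticFunction.vonMangoldt n : ℝ) * ((max (N + h - n) 0 : ℝ) : ℂ)‖ ≤ 2 * l ^ 2 * h := by
      intro n hn
      rw [Finset.mem_Ico] at hn
      have g1 : (N : ℝ) + 1 ≤ n := by exact_mod_cast hn.1
      have g2 : (n : ℝ) < N + h := by
        have := Nat.lt_ceil.1 hn.2
        exact this
      rw [norm_mul, norm_mul, norm_real, norm_real, Real.norm_of_nonneg ArithmeticFunction.vonMangoldt_nonneg, Real.norm_of_nonneg (le_max_right _ _)]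
      have g3 : ArithmeticFunction.vonMangoldt n ≤ 2 * l ^ 2 := by
        refine ArithmeticFunction.vonMangoldt_le_log.trans ?_
        calc Real.log n ≤ Real.log (2 * X) := Real.log_le_log (by linarith) (by linarith)
          _ = Real.log 2 + l ^ 2 := by rw [Real.log_mul (by norm_num) (by positivity), hX, Real.log_exp]
          _ ≤ _ := by nlinarith [Real.log_two_lt_d9]
      have g4 : max ((N : ℝ) + h - n) 0 ≤ h := max_le (by linarith) hh0.le
      calc ‖χ n‖ * ArithmeticFunction.vonMangoldt n * max ((N : ℝ) + h - n) 0 ≤ 1 * (2 * l ^ 2) * h := by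
            refine mul_le_mul (mul_le_mul (norm_char_le_one' χ n) g3 ArithmeticFunction.vonMangoldt_nonneg (by norm_num)) g4 (le_max_right _ _) (by positivity)
        _ = _ := by ring
    refine (norm_sum_le_of_le _ hb).trans ?_
    rw [Finset.sum_const, Nat.card_Ico, nsmul_eq_mul, Nat.cast_sub hNK]
    push_cast
    gcongr
    linarith
  have hE : Real.exp (-(κ / 2 * l)) = w * w := by
    rw [hw, ← Real.exp_add]; congr 1; ring
  rw [hE] at hs1 hs2
  have hfinal : h * ‖∑ n ∈ Finset.range (N + 1), χ n * (ArithmeticFunction.vonMangoldt n : ℝ)‖ ≤ h * ((24000 / κ + 2) * l ^ 2 * (X * w)) := by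
    have : ‖(h : ℂ) * ∑ n ∈ Finset.range (N + 1), χ n * (ArithmeticFunction.vonMangoldt n : ℝ)‖ = 
      h * ‖∑ n ∈ Finset.range (N + 1), χ n * (ArithmeticFunction.vonMangoldt n : ℝ)‖ := by
      rw [norm_mul, norm_real, Real.norm_of_nonneg hh0.le]
    rw [← this, hdec]
    refine (norm_sub_le _ _).trans ?_
    have h8 := norm_sub_le (∑ n ∈ Finset.range K, χ n * (ArithmeticFunction.vonMangoldt n : ℝ) * ((max (N + h - n) 0 : ℝ) : ℂ))
      (∑ n ∈ Finset.range K, χ n * (ArithmeticFunction.vonMangoldt n : ℝ) * ((max (N - n) 0 : ℝ) : ℂ))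
    have h9 : 12000 * l ^ 2 / κ * X ^ 2 * (w * w) = h * (12000 * l ^ 2 / κ * (X * w)) := by rw [hh]; ring
    rw [h9] at hs1 hs2
    have h10 : h * ((24000 / κ + 2) * l ^ 2 * (X * w)) = h * (12000 * l ^ 2 / κ * (X * w)) + h * (12000 * l ^ 2 / κ * (X * w)) + h * (2 * l ^ 2 * h) := by
      rw [hh]; ring
    rw [h10]
    linarith
  have := le_of_mul_le_mul_left hfinal hh0
  refine this.trans ?_
  calc (24000 / κ + 2) * l ^ 2 * (X * w) ≤ Real.exp (κ / 8 * l) * (X * w) := by gcongr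
    _ = _ := by
      rw [hX, hw, ← Real.exp_add, ← Real.exp_add]; congr 1; ring

open Complex Filter Topology

theorem duality_principle {ι : Type*} (s : Finset ι) (N : ℕ) (e : ι → ℕ → ℂ) {Δ : ℝ} (hΔ : 0 ≤ Δ)
    (h : ∀ b : ι → ℂ, ∑ n ∈ Finset.range N, ‖∑ i ∈ s, b i * e i n‖ ^ 2 ≤ Δ * ∑ i ∈ s, ‖b i‖ ^ 2) (a : ℕ → ℂ) :
    ∑ i ∈ s, ‖∑ n ∈ Finset.range N, a n * e i n‖ ^ 2 ≤ Δ * ∑ n ∈ Finset.range N, ‖a n‖ ^ 2 := by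
  set T : ι → ℂ := fun i => ∑ n ∈ Finset.range N, a n * e i n with hT
  set L := ∑ i ∈ s, ‖T i‖ ^ 2 with hL
  have hL0 : 0 ≤ L := Finset.sum_nonneg fun i _ => by positivity
  have h1 : (L : ℂ) = ∑ n ∈ Finset.range N, a n * ∑ i ∈ s, (starRingEnd ℂ) (T i) * e i n := by
    simp_rw [Finset.mul_sum]
    rw [Finset.sum_comm, hL]
    push_cast
    refine Finset.sum_congr rfl fun i _ => ?_
    rw [← Complex.conj_mul', hT, Finset.mul_sum]
    exact Finset.sum_congr rfl fun n _ => by ring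
  have h2 : L ≤ ∑ n ∈ Finset.range N, ‖a n‖ * ‖∑ i ∈ s, (starRingEnd ℂ) (T i) * e i n‖ := by
    calc L = ‖(L : ℂ)‖ := by rw [norm_real, Real.norm_of_nonneg hL0]
      _ ≤ _ := by
        rw [h1]
        refine (norm_sum_le _ _).trans (le_of_eq ?_)
        exact Finset.sum_congr rfl fun n _ => norm_mul _ _
  have h3 := Finset.sum_mul_sq_le_sq_mul_sq (Finset.range N) (fun n => ‖a n‖) (fun n => ‖∑ i ∈ s, (starRingEnd ℂ) (T i) * e i n‖)
  have h4 := h (fun i => (starRingEnd ℂ) (T i))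
  simp only [RCLike.norm_conj] at h4
  have hA : 0 ≤ ∑ n ∈ Finset.range N, ‖a n‖ ^ 2 := Finset.sum_nonneg fun i _ => by positivity
  have h5 : L * L ≤ (Δ * ∑ n ∈ Finset.range N, ‖a n‖ ^ 2) * L := by
    calc L * L = L ^ 2 := by ring
      _ ≤ (∑ n ∈ Finset.range N, ‖a n‖ * ‖∑ i ∈ s, (starRingEnd ℂ) (T i) * e i n‖) ^ 2 := by gcongr
      _ ≤ _ := h3
      _ ≤ (∑ n ∈ Finset.range N, ‖a n‖ ^ 2) * (Δ * L) := by gcongr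
      _ = _ := by ring
  rcases hL0.eq_or_lt with h0 | h0
  · rw [← h0]
    positivity
  · exact le_of_mul_le_mul_right h5 h0

/-- spacing sum -/
theorem spacing_sum {ι : Type*} (s : Finset ι) (β : ι → ℝ) {δ : ℝ} (hδ : 0 < δ) (K : ℕ) (hK : 1 / (2 * δ) + 1 ≤ K)
    (h1 : ∀ i ∈ s, δ ≤ |β i|) (h2 : ∀ i ∈ s, |β i| ≤ 1 / 2)
    (h3 : ∀ i ∈ s, ∀ j ∈ s, i ≠ j → δ ≤ |β i - β j|) :
    ∑ i ∈ s, 1 / (2 * |β i|) ≤ 2 / δ * (1 + Real.log K) := by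
  classical
  set g : ι → ℤ := fun i => ⌊β i / δ⌋ with hg
  have hfl : ∀ i, (g i : ℝ) * δ ≤ β i ∧ β i < (g i + 1) * δ := by
    intro i
    constructor
    · rw [← le_div_iff₀ hδ]; exact Int.floor_le _
    · rw [← div_lt_iff₀ hδ]; exact Int.lt_floor_add_one _
  have hinj : Set.InjOn g s := by
    intro i hi j hj hij
    by_contra hne
    have := h3 i hi j hj hne
    have a1 := hfl i
    have a2 := hfl j
    rw [← hij] at a2
    have : |β i - β j| < δ := by rw [abs_lt]; constructor <;> linarith
    linarith
  have hg0 : ∀ i ∈ s, (g i : ℤ) ≠ 0 ∧ |(g i : ℝ)| * δ ≤ 2 * |β i| ∧ |g i| ≤ K := by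
    intro i hi
    have a1 := hfl i
    have a2 := h1 i hi
    have a3 := h2 i hi
    have hne : g i ≠ 0 := by
      intro h0
      rw [h0] at a1
      simp only [Int.cast_zero, zero_mul, zero_add, one_mul] at a1
      rw [abs_of_nonneg a1.1] at a2
      linarith
    have hb : |(g i : ℝ)| * δ ≤ |β i| + δ := by
      rw [← abs_of_pos hδ, ← abs_mul, abs_of_pos hδ]
      rcases abs_cases (β i) with ⟨h, h'⟩ | ⟨h, h'⟩ <;> rcases abs_cases ((g i : ℝ) * δ) with ⟨k, k'⟩ | ⟨k, k'⟩ <;> rw [h, k] <;> linarith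
    refine ⟨hne, by linarith, ?_⟩
    have : |(g i : ℝ)| ≤ K := by
      refine le_trans ?_ hK
      have : |(g i : ℝ)| * δ ≤ (1 / (2 * δ) + 1) * δ := by
        refine hb.trans ?_
        have : (1 / (2 * δ) + 1) * δ = 1 / 2 + δ := by field_simp
        rw [this]; linarith
      exact le_of_mul_le_mul_right this hδ
    exact_mod_cast this
  have hterm : ∀ i ∈ s, 1 / (2 * |β i|) ≤ 1 / δ * (1 / |(g i : ℝ)|) := by
    intro i hi
    obtain ⟨b1, b2, b3⟩ := hg0 i hi
    have : 0 < |(g i : ℝ)| := by simpa using b1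
    rw [one_div_mul_one_div, mul_comm δ]
    exact one_div_le_one_div_of_le (by positivity) b2
  refine (Finset.sum_le_sum hterm).trans ?_
  rw [← Finset.mul_sum, ← Finset.sum_image (f := fun m : ℤ => 1 / |(m : ℝ)|) (g := g) (s := s) hinj]
  have hsub : s.image g ⊆ (Finset.range K).image (fun k : ℕ => ((k : ℤ) + 1)) ∪ (Finset.range K).image (fun k : ℕ => -((k : ℤ) + 1)) := by
    intro m hm
    obtain ⟨i, hi, rfl⟩ := Finset.mem_image.1 hm
    obtain ⟨b1, b2, b3⟩ := hg0 i hi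
    rw [Finset.mem_union, Finset.mem_image, Finset.mem_image]
    rw [abs_le] at b3
    rcases lt_or_gt_of_ne b1 with h | h
    · right
      exact ⟨(-g i - 1).toNat, by rw [Finset.mem_range]; omega, by omega⟩
    · left
      exact ⟨(g i - 1).toNat, by rw [Finset.mem_range]; omega, by omega⟩
  have h5 : ∑ m ∈ s.image g, 1 / |(m : ℝ)| ≤ 2 * (1 + Real.log K) := by
    refine (Finset.sum_le_sum_of_subset_of_nonneg hsub fun m _ _ => by positivity).trans ?_
    refine (Finset.sum_union_inter (s₁ := (Finset.range K).image (fun k : ℕ => ((k : ℤ) + 1))) (s₂ := (Finset.range K).image (fun k : ℕ => -((k : ℤ) + 1))) (f := fun m : ℤ => 1 / |(m : ℝ)|) ▸ le_add_of_nonneg_right (Finset.sum_nonneg fun m _ => by positivity)).trans ?_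
    rw [Finset.sum_image (by intro a _ b _ h; simpa using h), Finset.sum_image (by intro a _ b _ h; simpa using h)]
    have hh := harmonic_le K
    have e : ∀ k : ℕ, |((k : ℝ) + 1)| = k + 1 := fun k => abs_of_pos (by positivity)
    push_cast
    simp only [abs_neg, e]
    linarith
  calc 1 / δ * ∑ m ∈ s.image g, 1 / |(m : ℝ)| ≤ 1 / δ * (2 * (1 + Real.log K)) := by gcongr
    _ = _ := by ring

theorem large_sieve_spaced {ι : Type*} (s : Finset ι) (α : ι → ℝ) {δ : ℝ} (hδ : 0 < δ) (K : ℕ) (hK : 1 / (2 * δ) + 1 ≤ K)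
    (h : ∀ i ∈ s, ∀ j ∈ s, i ≠ j → ∀ m : ℤ, δ ≤ |α i - α j - m|) (N : ℕ) (a : ℕ → ℂ) :
    ∑ i ∈ s, ‖∑ n ∈ Finset.range N, a n * ee (n * α i)‖ ^ 2 ≤
      (N + 2 / δ * (1 + Real.log K)) * ∑ n ∈ Finset.range N, ‖a n‖ ^ 2 := by
  classical
  have hK1 : (1 : ℝ) ≤ K := le_trans (by have : 0 < 1 / (2 * δ) := by positivity
                                         linarith) hK
  have hlog : 0 ≤ Real.log K := Real.log_nonneg hK1
  refine duality_principle s N (fun i n => ee (n * α i)) (by positivity) (fun b => ?_) a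
  set Ker : ι → ι → ℝ := fun i j => ‖∑ n ∈ Finset.range N, ee (n * (α i - α j))‖ with hKer
  have hsymm : ∀ i j, Ker i j = Ker j i := by
    intro i j
    simp only [hKer]
    rw [← RCLike.norm_conj, map_sum]
    congr 1
    refine Finset.sum_congr rfl fun n _ => ?_
    rw [← ee_neg]; congr 1; ring
  have hrow : ∀ i ∈ s, ∑ j ∈ s, Ker i j ≤ N + 2 / δ * (1 + Real.log K) := by
    intro i hi
    rw [← Finset.add_sum_erase s _ hi]
    have hd : Ker i i ≤ N := by
      simp only [hKer]
      refine (norm_sum_le _ _).trans ?_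
      simp [norm_ee]
    have hr : ∑ j ∈ s.erase i, Ker i j ≤ ∑ j ∈ s.erase i, 1 / (2 * |(α i - α j) - round (α i - α j)|) := by
      refine Finset.sum_le_sum fun j hj => ?_
      rw [Finset.mem_erase] at hj
      exact norm_sum_ee_le (lt_of_lt_of_le hδ (h i hi j hj.2 hj.1.symm _)) N
    have hsp := spacing_sum (s.erase i) (fun j => (α i - α j) - round (α i - α j)) hδ K hK
      (fun j hj => h i hi j (Finset.mem_erase.1 hj).2 (Finset.mem_erase.1 hj).1.symm _)
      (fun j _ => abs_sub_round _)
      (fun j hj k hk hjk => by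
        have := h k (Finset.mem_erase.1 hk).2 j (Finset.mem_erase.1 hj).2 hjk.symm (round (α i - α j) - round (α i - α k))
        refine this.trans (le_of_eq ?_)
        push_cast; congr 1; ring)
    linarith
  have h1 : ((∑ n ∈ Finset.range N, ‖∑ i ∈ s, b i * ee (n * α i)‖ ^ 2 : ℝ) : ℂ) =
      ∑ i ∈ s, ∑ j ∈ s, b i * (starRingEnd ℂ) (b j) * ∑ n ∈ Finset.range N, ee (n * (α i - α j)) := by
    push_cast
    simp_rw [← Complex.mul_conj', map_sum, Finset.sum_mul_sum, Finset.mul_sum]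
    rw [Finset.sum_comm]
    refine Finset.sum_congr rfl fun i _ => ?_
    rw [Finset.sum_comm]
    refine Finset.sum_congr rfl fun j _ => Finset.sum_congr rfl fun n _ => ?_
    rw [map_mul, ← ee_neg, show (n : ℝ) * (α i - α j) = n * α i + -(n * α j) by ring, ee_add]
    ring
  have h2 : ∑ n ∈ Finset.range N, ‖∑ i ∈ s, b i * ee (n * α i)‖ ^ 2 ≤
      ∑ i ∈ s, ∑ j ∈ s, (‖b i‖ ^ 2 * Ker i j / 2 + ‖b j‖ ^ 2 * Ker j i / 2) := by
    have : ∑ n ∈ Finset.range N, ‖∑ i ∈ s, b i * ee (n * α i)‖ ^ 2 = 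
      ‖((∑ n ∈ Finset.range N, ‖∑ i ∈ s, b i * ee (n * α i)‖ ^ 2 : ℝ) : ℂ)‖ := by
      rw [norm_real, Real.norm_of_nonneg (Finset.sum_nonneg fun n _ => by positivity)]
    rw [this, h1]
    refine norm_sum_le_of_le _ fun i _ => norm_sum_le_of_le _ fun j _ => ?_
    rw [norm_mul, norm_mul, RCLike.norm_conj, ← hsymm i j]
    have h0 : 0 ≤ Ker i j := norm_nonneg _
    change ‖b i‖ * ‖b j‖ * Ker i j ≤ _
    nlinarith [mul_nonneg (sq_nonneg (‖b i‖ - ‖b j‖)) h0]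
  refine h2.trans ?_
  simp_rw [Finset.sum_add_distrib]
  rw [Finset.sum_comm (f := fun i j => ‖b j‖ ^ 2 * Ker j i / 2)]
  rw [← Finset.sum_add_distrib, Finset.mul_sum]
  refine Finset.sum_le_sum fun i hi => ?_
  rw [← Finset.sum_add_distrib]
  calc ∑ j ∈ s, (‖b i‖ ^ 2 * Ker i j / 2 + ‖b i‖ ^ 2 * Ker i j / 2) = ‖b i‖ ^ 2 * ∑ j ∈ s, Ker i j := by
        rw [Finset.mul_sum]; exact Finset.sum_congr rfl fun j _ => by ring
    _ ≤ ‖b i‖ ^ 2 * (N + 2 / δ * (1 + Real.log K)) := by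
        have := hrow i hi; gcongr
    _ = _ := mul_comm _ _

/-- Large sieve over Farey fractions, `q = k+1`. -/
theorem large_sieve_farey (R N : ℕ) (a : ℕ → ℂ) :
    ∑ k ∈ Finset.range R, ∑ c ∈ (Finset.range (k + 1)).filter (fun c => Nat.Coprime c (k + 1)),
      ‖∑ n ∈ Finset.range N, a n * ee (n * ((c : ℝ) / ((k + 1 : ℕ) : ℝ)))‖ ^ 2 ≤
      (N + 2 * R ^ 2 * (1 + Real.log (R ^ 2 + 1))) * ∑ n ∈ Finset.range N, ‖a n‖ ^ 2 := by
  rcases Nat.eq_zero_or_pos R with rfl | hR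
  · simp; positivity
  have hR' : (1 : ℝ) ≤ R := by exact_mod_cast hR
  rw [Finset.sum_sigma']
  have key := large_sieve_spaced ((Finset.range R).sigma fun k => (Finset.range (k + 1)).filter (fun c => Nat.Coprime c (k + 1)))
    (fun i => (i.2 : ℝ) / ((i.1 + 1 : ℕ) : ℝ)) (δ := 1 / (R : ℝ) ^ 2) (by positivity) (R ^ 2 + 1) (by
      push_cast
      have : 1 / (2 * (1 / (R : ℝ) ^ 2)) = R ^ 2 / 2 := by field_simp
      rw [this]; nlinarith) ?_ N a
  · refine key.trans (le_of_eq ?_)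
    push_cast
    congr 2
    have : 2 / (1 / (R : ℝ) ^ 2) = 2 * R ^ 2 := by field_simp
    rw [this]
  · rintro ⟨k, c⟩ h1 ⟨k', c'⟩ h2 hne m
    simp only [Finset.mem_sigma, Finset.mem_range, Finset.mem_filter] at h1 h2
    obtain ⟨hk, hc, hcop⟩ := h1
    obtain ⟨hk', hc', hcop'⟩ := h2
    simp only
    set z : ℤ := (c : ℤ) * (k' + 1) - c' * (k + 1) - m * ((k + 1) * (k' + 1)) with hz
    have hz0 : z ≠ 0 := by
      intro h0
      have d1 : ((k + 1 : ℕ) : ℤ) ∣ (c : ℤ) * (k' + 1 : ℕ) := by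
        refine ⟨c' + m * (k' + 1), ?_⟩
        push_cast; linarith
      have d2 : ((k' + 1 : ℕ) : ℤ) ∣ (c' : ℤ) * (k + 1 : ℕ) := by
        refine ⟨c - m * (k + 1), ?_⟩
        push_cast; linarith
      have d1' : (k + 1) ∣ c * (k' + 1) := by exact_mod_cast d1
      have d2' : (k' + 1) ∣ c' * (k + 1) := by exact_mod_cast d2
      have e1 := (Nat.Coprime.dvd_mul_left hcop.symm).1 d1'
      have e2 := (Nat.Coprime.dvd_mul_left hcop'.symm).1 d2'
      have e3 : k = k' := by have := Nat.dvd_antisymm e1 e2; omega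
      subst e3
      apply hne
      have h5 : ((c : ℤ) - c' - m * (k + 1)) * (k + 1) = 0 := by linarith
      have h6 : (c : ℤ) - c' - m * (k + 1) = 0 := by
        rcases mul_eq_zero.1 h5 with h | h
        · exact h
        · omega
      have h7 : m = 0 := by
        by_contra hm
        rcases lt_or_gt_of_ne hm with h | h
        · have : m * ((k : ℤ) + 1) ≤ (-1) * (k + 1) := by gcongr; omega
          omega
        · have : 1 * ((k : ℤ) + 1) ≤ m * (k + 1) := by gcongr; omega
          omega
      rw [h7] at h6
      have : c = c' := by omega
      rw [this]
    have hz1 : (1 : ℝ) ≤ |(z : ℝ)| := by exact_mod_cast Int.one_le_abs hz0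
    have e : (c : ℝ) / ((k + 1 : ℕ) : ℝ) - c' / ((k' + 1 : ℕ) : ℝ) - m = z / (((k : ℝ) + 1) * (k' + 1)) := by
      rw [hz]; push_cast; field_simp
    rw [e, abs_div, abs_of_pos (show 0 < ((k : ℝ) + 1) * (k' + 1) by positivity)]
    have b1 : (k : ℝ) + 1 ≤ R := by exact_mod_cast hk
    have b2 : (k' : ℝ) + 1 ≤ R := by exact_mod_cast hk'
    refine div_le_div₀ (by positivity) hz1 (by positivity) ?_
    calc ((k : ℝ) + 1) * (k' + 1) ≤ R * R := by gcongr
      _ = _ := by ring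

theorem char_orth {q : ℕ} [NeZero q] {b : ZMod q} (hb : IsUnit b) (a : ZMod q) :
    ∑ χ : DirichletCharacter ℂ q, χ a * (starRingEnd ℂ) (χ b) = if b = a then (q.totient : ℂ) else 0 := by
  rw [← DirichletCharacter.sum_char_inv_mul_char_eq ℂ hb a]
  refine Finset.sum_congr rfl fun χ _ => ?_
  have h1 : χ b⁻¹ * χ b = 1 := by rw [← map_mul, ZMod.inv_mul_of_unit _ hb, map_one]
  have h2 : (starRingEnd ℂ) (χ b) * χ b = 1 := by
    rw [← char_inv_eq_conj, ← MulChar.mul_apply, inv_mul_cancel, MulChar.one_apply hb]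
  have h3 : χ b ≠ 0 := right_ne_zero_of_mul_eq_one h1
  rw [mul_right_cancel₀ h3 (h1.trans h2.symm)]
  ring

theorem parseval_char {q : ℕ} [NeZero q] (c : ℕ → ℂ) :
    ∑ χ : DirichletCharacter ℂ q, ‖∑ a ∈ Finset.range q, χ (a : ZMod q) * c a‖ ^ 2 =
      q.totient * ∑ a ∈ (Finset.range q).filter (fun a => Nat.Coprime a q), ‖c a‖ ^ 2 := by
  have hred : ∀ χ : DirichletCharacter ℂ q, ∑ a ∈ Finset.range q, χ (a : ZMod q) * c a = 
      ∑ a ∈ (Finset.range q).filter (fun a => Nat.Coprime a q), χ (a : ZMod q) * c a := by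
    intro χ
    rw [Finset.sum_filter]
    refine Finset.sum_congr rfl fun a _ => ?_
    split_ifs with h
    · rfl
    · rw [MulChar.map_nonunit _ (by rwa [ZMod.isUnit_iff_coprime]), zero_mul]
  simp_rw [hred]
  set s := (Finset.range q).filter (fun a => Nat.Coprime a q) with hs
  have : ((∑ χ : DirichletCharacter ℂ q, ‖∑ a ∈ s, χ (a : ZMod q) * c a‖ ^ 2 : ℝ) : ℂ) =
      ((q.totient * ∑ a ∈ s, ‖c a‖ ^ 2 : ℝ) : ℂ) := by
    push_cast
    simp_rw [← Complex.mul_conj', map_sum, Finset.sum_mul_sum]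
    rw [Finset.sum_comm, Finset.mul_sum]
    refine Finset.sum_congr rfl fun a ha => ?_
    rw [Finset.sum_comm]
    have ha' := Finset.mem_filter.1 ha
    have hu : IsUnit (a : ZMod q) := (ZMod.isUnit_iff_coprime a q).2 ha'.2
    have ho : ∀ b ∈ s, ∑ χ : DirichletCharacter ℂ q, χ (a : ZMod q) * c a * (starRingEnd ℂ) (χ (b : ZMod q) * c b) =
        (if (b : ZMod q) = a then (q.totient : ℂ) else 0) * (c a * (starRingEnd ℂ) (c b)) := by
      intro b hb
      have hb' := Finset.mem_filter.1 hb
      have hu' : IsUnit (b : ZMod q) := (ZMod.isUnit_iff_coprime b q).2 hb'.2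
      rw [← char_orth hu' (a : ZMod q), Finset.sum_mul]
      refine Finset.sum_congr rfl fun χ _ => ?_
      rw [map_mul]; ring
    rw [Finset.sum_congr rfl ho, Finset.sum_eq_single_of_mem a ha]
    · simp
    · intro b hb hne
      have hb' := Finset.mem_filter.1 hb
      rw [if_neg, zero_mul]
      intro h
      rw [ZMod.natCast_eq_natCast_iff', Nat.mod_eq_of_lt (Finset.mem_range.1 ha'.1), Nat.mod_eq_of_lt (Finset.mem_range.1 hb'.1)] at h
      exact hne h
  exact_mod_cast this

/-- index set of primitive characters with `D ≤ q ≤ R`, `q = k+1` -/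
noncomputable def primSet (D R : ℕ) : Finset (Σ k : ℕ, DirichletCharacter ℂ (k + 1)) := by
  classical
  exact (Finset.Ico D R).sigma fun k => Finset.univ.filter fun χ => χ.IsPrimitive

/-- evaluation -/
noncomputable def pEval (i : Σ k : ℕ, DirichletCharacter ℂ (k + 1)) (n : ℕ) : ℂ := i.2 (n : ZMod (i.1 + 1))

theorem norm_pEval_le (i : Σ k : ℕ, DirichletCharacter ℂ (k + 1)) (n : ℕ) : ‖pEval i n‖ ≤ 1 :=
  norm_char_le_one' _ _

theorem pEval_mul (i : Σ k : ℕ, DirichletCharacter ℂ (k + 1)) (m n : ℕ) : pEval i (m * n) = pEval i m * pEval i n := by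
  simp [pEval]

theorem large_sieve_char_q {q : ℕ} [NeZero q] (s : Finset (DirichletCharacter ℂ q)) (hs : ∀ χ ∈ s, χ.IsPrimitive) (N : ℕ) (a : ℕ → ℂ) :
    ∑ χ ∈ s, ‖∑ n ∈ Finset.range N, a n * χ (n : ZMod q)‖ ^ 2 ≤
      ∑ c ∈ (Finset.range q).filter (fun c => Nat.Coprime c q),
      ‖∑ n ∈ Finset.range N, (starRingEnd ℂ) (a n) * ee (n * ((c : ℝ) / (q : ℝ)))‖ ^ 2 := by
  have hq : (0 : ℝ) < q := by exact_mod_cast NeZero.pos q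
  set S : ℕ → ℂ := fun c => ∑ n ∈ Finset.range N, (starRingEnd ℂ) (a n) * ee (n * ((c : ℝ) / (q : ℝ))) with hS
  have h1 : ∀ χ ∈ s, q * ‖∑ n ∈ Finset.range N, a n * χ (n : ZMod q)‖ ^ 2 = ‖∑ c ∈ Finset.range q, χ (c : ZMod q) * S c‖ ^ 2 := by
    intro χ hχ
    have e : ∑ c ∈ Finset.range q, χ (c : ZMod q) * S c =
        gaussSum χ ZMod.stdAddChar * (starRingEnd ℂ) (∑ n ∈ Finset.range N, a n * χ (n : ZMod q)) := by
      rw [map_sum, Finset.mul_sum]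
      simp only [hS, Finset.mul_sum]
      rw [Finset.sum_comm]
      refine Finset.sum_congr rfl fun n _ => ?_
      rw [map_mul, ← char_inv_eq_conj, mul_left_comm, mul_comm (gaussSum _ _), chiSum_mul_gauss χ (hs χ hχ), Finset.mul_sum]
      exact Finset.sum_congr rfl fun c _ => by ring
    rw [e, norm_mul, RCLike.norm_conj, mul_pow, norm_gaussSum_sq χ (hs χ hχ)]
  have h2 : q * ∑ χ ∈ s, ‖∑ n ∈ Finset.range N, a n * χ (n : ZMod q)‖ ^ 2 ≤
      q * ∑ c ∈ (Finset.range q).filter (fun c => Nat.Coprime c q), ‖S c‖ ^ 2 := by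
    rw [Finset.mul_sum, Finset.sum_congr rfl h1]
    refine (Finset.sum_le_sum_of_subset_of_nonneg (Finset.subset_univ s) fun _ _ _ => by positivity).trans ?_
    rw [parseval_char]
    gcongr
    exact Nat.totient_le q
  exact le_of_mul_le_mul_left h2 hq

/-- Multiplicative large sieve. -/
theorem large_sieve_mult (D R N : ℕ) (a : ℕ → ℂ) :
    ∑ i ∈ primSet D R, ‖∑ n ∈ Finset.range N, a n * pEval i n‖ ^ 2 ≤
      (N + 2 * R ^ 2 * (1 + Real.log (R ^ 2 + 1))) * ∑ n ∈ Finset.range N, ‖a n‖ ^ 2 := by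
  classical
  have := large_sieve_farey R N (fun n => (starRingEnd ℂ) (a n))
  simp only [RCLike.norm_conj] at this
  refine le_trans ?_ this
  rw [primSet, Finset.sum_sigma]
  refine le_trans (Finset.sum_le_sum fun k hk => large_sieve_char_q (q := k + 1) _ (fun χ hχ => (Finset.mem_filter.1 hχ).2) N a) ?_
  refine Finset.sum_le_sum_of_subset_of_nonneg ?_ fun _ _ _ => Finset.sum_nonneg fun _ _ => by positivity
  intro k hk
  rw [Finset.mem_Ico] at hk
  exact Finset.mem_range.2 hk.2

open Complex Filter Topology

theorem sum_dyadic_prefix (f : ℕ → ℂ) (B J : ℕ) (hB : B < 2 ^ J) :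
    ∑ m ∈ Finset.range B, f m =
      ∑ j ∈ Finset.range J, ∑ m ∈ Finset.Ico (2 ^ (j + 1) * (B / 2 ^ (j + 1))) (2 ^ j * (B / 2 ^ j)), f m := by
  have hmono : ∀ j, 2 ^ (j + 1) * (B / 2 ^ (j + 1)) ≤ 2 ^ j * (B / 2 ^ j) := by
    intro j
    rw [pow_succ, ← Nat.div_div_eq_div_mul, mul_assoc]
    exact Nat.mul_le_mul_left _ (Nat.mul_div_le _ _)
  have h : ∀ j, ∑ m ∈ Finset.Ico (2 ^ (j + 1) * (B / 2 ^ (j + 1))) (2 ^ j * (B / 2 ^ j)), f m =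
      (fun j => -∑ m ∈ Finset.range (2 ^ j * (B / 2 ^ j)), f m) (j + 1) - (fun j => -∑ m ∈ Finset.range (2 ^ j * (B / 2 ^ j)), f m) j := by
    intro j
    rw [Finset.sum_Ico_eq_sub _ (hmono j)]
    ring
  rw [Finset.sum_congr rfl fun j _ => h j, Finset.sum_range_sub (fun j => -∑ m ∈ Finset.range (2 ^ j * (B / 2 ^ j)), f m)]
  simp [Nat.div_eq_of_lt hB]

theorem bilinear_cut {ι : Type*} (s : Finset ι) (e : ι → ℕ → ℂ) {E : ℝ} (hE : 0 ≤ E)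
    (hLS : ∀ (N : ℕ) (a : ℕ → ℂ), ∑ i ∈ s, ‖∑ n ∈ Finset.range N, a n * e i n‖ ^ 2 ≤
      (N + E) * ∑ n ∈ Finset.range N, ‖a n‖ ^ 2)
    (a b : ℕ → ℂ) (J K : ℕ) (B : ℕ → ℕ) (hB : ∀ k < K, B k < 2 ^ J) :
    ∑ i ∈ s, ‖∑ k ∈ Finset.range K, b k * e i k * ∑ m ∈ Finset.range (B k), a m * e i m‖ ≤
      J * √(((2 ^ J : ℕ) + E) * (∑ m ∈ Finset.range (2 ^ J), ‖a m‖ ^ 2) * ((K + E) * ∑ k ∈ Finset.range K, ‖b k‖ ^ 2)) := by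
  classical
  set Z := √(((2 ^ J : ℕ) + E) * (∑ m ∈ Finset.range (2 ^ J), ‖a m‖ ^ 2) * ((K + E) * ∑ k ∈ Finset.range K, ‖b k‖ ^ 2)) with hZ
  -- blocks
  set A : ℕ → ι → ℕ → ℂ := fun j i u => ∑ m ∈ Finset.range (2 ^ J), (if 2 ^ (j + 1) * (u / 2) ≤ m ∧ m < 2 ^ j * u then a m else 0) * e i m with hA
  set Bb : ℕ → ι → ℕ → ℂ := fun j i u => ∑ k ∈ Finset.range K, (if B k / 2 ^ j = u then b k else 0) * e i k with hBb
  have hdec : ∀ i, ∑ k ∈ Finset.range K, b k * e i k * ∑ m ∈ Finset.range (B k), a m * e i m =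
      ∑ j ∈ Finset.range J, ∑ u ∈ Finset.range (2 ^ J), A j i u * Bb j i u := by
    intro i
    have h1 : ∀ k ∈ Finset.range K, b k * e i k * ∑ m ∈ Finset.range (B k), a m * e i m =
        ∑ j ∈ Finset.range J, b k * e i k * A j i (B k / 2 ^ j) := by
      intro k hk
      rw [sum_dyadic_prefix _ (B k) J (hB k (Finset.mem_range.1 hk)), Finset.mul_sum]
      refine Finset.sum_congr rfl fun j _ => ?_
      congr 1
      simp only [hA, ite_mul, zero_mul]
      rw [← Finset.sum_filter]
      refine Finset.sum_congr ?_ fun _ _ => rfl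
      ext m
      rw [Finset.mem_Ico, Finset.mem_filter, Finset.mem_range, pow_succ, ← Nat.div_div_eq_div_mul]
      constructor
      · intro h
        refine ⟨?_, h⟩
        have := Nat.mul_div_le (B k) (2 ^ j)
        have := hB k (Finset.mem_range.1 hk)
        omega
      · intro h; exact h.2
    rw [Finset.sum_congr rfl h1, Finset.sum_comm]
    refine Finset.sum_congr rfl fun j _ => ?_
    simp only [hBb, Finset.mul_sum]
    rw [Finset.sum_comm]
    refine Finset.sum_congr rfl fun k hk => ?_
    rw [Finset.sum_eq_single_of_mem (B k / 2 ^ j)]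
    · simp; ring
    · rw [Finset.mem_range]
      exact lt_of_le_of_lt (Nat.div_le_self _ _) (hB k (Finset.mem_range.1 hk))
    · intro u _ hu
      rw [if_neg (fun h => hu h.symm)]; simp
  have hfix : ∀ j, ∑ i ∈ s, ∑ u ∈ Finset.range (2 ^ J), ‖A j i u‖ * ‖Bb j i u‖ ≤ Z := by
    intro j
    rw [hZ]
    apply Real.le_sqrt_of_sq_le
    rw [← Finset.sum_product']
    refine (Finset.sum_mul_sq_le_sq_mul_sq _ _ _).trans ?_
    rw [Finset.sum_product, Finset.sum_product]
    have b1 : ∑ i ∈ s, ∑ u ∈ Finset.range (2 ^ J), ‖A j i u‖ ^ 2 ≤ ((2 ^ J : ℕ) + E) * (∑ m ∈ Finset.range (2 ^ J), ‖a m‖ ^ 2) := by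
      rw [Finset.sum_comm]
      refine (Finset.sum_le_sum fun u _ => hLS _ _).trans ?_
      rw [← Finset.mul_sum, Finset.sum_comm]
      refine mul_le_mul_of_nonneg_left ?_ (by positivity)
      refine Finset.sum_le_sum fun m _ => ?_
      calc ∑ u ∈ Finset.range (2 ^ J), ‖if 2 ^ (j + 1) * (u / 2) ≤ m ∧ m < 2 ^ j * u then a m else 0‖ ^ 2
          ≤ ∑ u ∈ Finset.range (2 ^ J), if u = m / 2 ^ j + 1 then ‖a m‖ ^ 2 else 0 := by
            refine Finset.sum_le_sum fun u _ => ?_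
            by_cases h : 2 ^ (j + 1) * (u / 2) ≤ m ∧ m < 2 ^ j * u
            · rw [if_pos h, if_pos]
              obtain ⟨h1, h2⟩ := h
              have hp : 0 < 2 ^ j := by positivity
              have g1 : m / 2 ^ j < u := by rw [Nat.div_lt_iff_lt_mul hp, mul_comm]; exact h2
              have g2 : 2 * (u / 2) ≤ m / 2 ^ j := by
                rw [Nat.le_div_iff_mul_le hp]
                rw [pow_succ] at h1
                calc 2 * (u / 2) * 2 ^ j = 2 ^ j * 2 * (u / 2) := by ring
                  _ ≤ m := h1
              omega
            · rw [if_neg h]; split_ifs <;> simp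
        _ ≤ ‖a m‖ ^ 2 := by
            rw [Finset.sum_ite_eq']
            split_ifs <;> simp
    have b2 : ∑ i ∈ s, ∑ u ∈ Finset.range (2 ^ J), ‖Bb j i u‖ ^ 2 ≤ (K + E) * (∑ k ∈ Finset.range K, ‖b k‖ ^ 2) := by
      rw [Finset.sum_comm]
      refine (Finset.sum_le_sum fun u _ => hLS _ _).trans ?_
      rw [← Finset.mul_sum, Finset.sum_comm]
      refine mul_le_mul_of_nonneg_left ?_ (by positivity)
      refine Finset.sum_le_sum fun k _ => ?_
      calc ∑ u ∈ Finset.range (2 ^ J), ‖if B k / 2 ^ j = u then b k else 0‖ ^ 2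
          = ∑ u ∈ Finset.range (2 ^ J), if B k / 2 ^ j = u then ‖b k‖ ^ 2 else 0 := by
            refine Finset.sum_congr rfl fun u _ => ?_
            split_ifs <;> simp
        _ ≤ ‖b k‖ ^ 2 := by
            rw [Finset.sum_ite_eq]
            split_ifs <;> simp
    exact mul_le_mul b1 b2 (Finset.sum_nonneg fun _ _ => Finset.sum_nonneg fun _ _ => by positivity) (by positivity)
  calc ∑ i ∈ s, ‖∑ k ∈ Finset.range K, b k * e i k * ∑ m ∈ Finset.range (B k), a m * e i m‖
      ≤ ∑ i ∈ s, ∑ j ∈ Finset.range J, ∑ u ∈ Finset.range (2 ^ J), ‖A j i u‖ * ‖Bb j i u‖ := by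
        refine Finset.sum_le_sum fun i _ => ?_
        rw [hdec i]
        refine norm_sum_le_of_le _ fun j _ => norm_sum_le_of_le _ fun u _ => ?_
        rw [norm_mul]
    _ = ∑ j ∈ Finset.range J, ∑ i ∈ s, ∑ u ∈ Finset.range (2 ^ J), ‖A j i u‖ * ‖Bb j i u‖ := Finset.sum_comm
    _ ≤ ∑ j ∈ Finset.range J, Z := Finset.sum_le_sum fun j _ => hfix j
    _ = J * Z := by simp

open Complex Filter Topology

theorem sum_multiples_inv (K g : ℕ) (hg : 0 < g) :
    ∑ a ∈ (Finset.Ioc 0 K).filter (fun a => g ∣ a), (1 : ℝ) / a ≤ 1 / g * ∑ a ∈ Finset.Ioc 0 K, (1 : ℝ) / a := by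
  rw [Finset.mul_sum]
  calc ∑ a ∈ (Finset.Ioc 0 K).filter (fun a => g ∣ a), (1 : ℝ) / a
      ≤ ∑ a ∈ (Finset.Ioc 0 K).image (fun b => g * b), (1 : ℝ) / a := by
        refine Finset.sum_le_sum_of_subset_of_nonneg ?_ fun _ _ _ => by positivity
        intro a ha
        simp only [Finset.mem_filter, Finset.mem_Ioc] at ha
        obtain ⟨⟨h1, h2⟩, ⟨b, rfl⟩⟩ := ha
        rw [Finset.mem_image]
        refine ⟨b, ?_, rfl⟩
        rw [Finset.mem_Ioc]
        constructor
        · exact Nat.pos_of_mul_pos_left h1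
        · exact le_trans (Nat.le_mul_of_pos_left b hg) h2
    _ = ∑ b ∈ Finset.Ioc 0 K, 1 / (g : ℝ) * (1 / b) := by
        rw [Finset.sum_image (fun a _ b _ h => Nat.eq_of_mul_eq_mul_left hg h)]
        refine Finset.sum_congr rfl fun b _ => ?_
        push_cast; rw [one_div_mul_one_div]

theorem harmonic_Ioc_le (K : ℕ) : ∑ a ∈ Finset.Ioc 0 K, (1 : ℝ) / a ≤ 1 + Real.log K := by
  refine le_trans (le_of_eq ?_) (harmonic_le K)
  induction K with
  | zero => simp
  | succ n ih => rw [Finset.sum_Ioc_succ_top (Nat.zero_le n), Finset.sum_range_succ, ih]; push_cast; rfl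

theorem sum_divisors_sq (K : ℕ) :
    ∑ k ∈ Finset.Ioc 0 K, ((k.divisors.card : ℝ)) ^ 2 ≤ K * (1 + Real.log K) ^ 3 := by
  set S := Finset.Ioc 0 K with hS
  set H := ∑ a ∈ S, (1 : ℝ) / a with hH
  have hH0 : 0 ≤ H := Finset.sum_nonneg fun _ _ => by positivity
  have h1 : ∀ k ∈ S, ((k.divisors.card : ℝ)) ^ 2 = ∑ a ∈ S, ∑ b ∈ S, if a ∣ k ∧ b ∣ k then (1 : ℝ) else 0 := by
    intro k hk
    rw [hS, Finset.mem_Ioc] at hk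
    have hd : k.divisors = S.filter (fun a => a ∣ k) := by
      ext a
      rw [Nat.mem_divisors, Finset.mem_filter, hS, Finset.mem_Ioc]
      constructor
      · rintro ⟨h, h'⟩
        exact ⟨⟨Nat.pos_of_dvd_of_pos h hk.1, (Nat.le_of_dvd hk.1 h).trans hk.2⟩, h⟩
      · rintro ⟨h, h'⟩
        exact ⟨h', by omega⟩
    have hc : (k.divisors.card : ℝ) = ∑ a ∈ S, if a ∣ k then (1 : ℝ) else 0 := by
      rw [hd, Finset.card_filter]; push_cast; rfl
    rw [sq, hc, Finset.sum_mul_sum]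
    refine Finset.sum_congr rfl fun a _ => Finset.sum_congr rfl fun b _ => ?_
    by_cases ha : a ∣ k <;> by_cases hb : b ∣ k <;> simp [ha, hb]
  rw [Finset.sum_congr rfl h1, Finset.sum_comm]
  have h2 : ∀ a ∈ S, ∀ b ∈ S, ∑ k ∈ S, (if a ∣ k ∧ b ∣ k then (1 : ℝ) else 0) ≤ K * ∑ g ∈ S, if g ∣ a ∧ g ∣ b then (g : ℝ) * (1 / a) * (1 / b) else 0 := by
    intro a ha b hb
    rw [hS, Finset.mem_Ioc] at ha hb
    have haR : (0 : ℝ) < a := by exact_mod_cast ha.1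
    have hbR : (0 : ℝ) < b := by exact_mod_cast hb.1
    have e1 : ∑ k ∈ S, (if a ∣ k ∧ b ∣ k then (1 : ℝ) else 0) = ((K / Nat.lcm a b : ℕ) : ℝ) := by
      rw [← Nat.Ioc_filter_dvd_card_eq_div, Finset.card_filter]
      push_cast
      refine Finset.sum_congr rfl fun k _ => ?_
      simp only [Nat.lcm_dvd_iff]
    have e2 : ((K / Nat.lcm a b : ℕ) : ℝ) ≤ K * ((Nat.gcd a b : ℝ) * (1 / a) * (1 / b)) := by
      refine Nat.cast_div_le.trans (le_of_eq ?_)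
      have : (Nat.gcd a b : ℝ) * (Nat.lcm a b : ℝ) = a * b := by exact_mod_cast Nat.gcd_mul_lcm a b
      have hl : (0 : ℝ) < Nat.lcm a b := by exact_mod_cast Nat.lcm_pos ha.1 hb.1
      field_simp
      linear_combination (-(K:ℝ)) * this
    rw [e1]
    refine e2.trans ?_
    refine mul_le_mul_of_nonneg_left ?_ (by positivity)
    have hg : Nat.gcd a b ∈ S := by
      rw [hS, Finset.mem_Ioc]
      exact ⟨Nat.gcd_pos_of_pos_left _ ha.1, (Nat.gcd_le_left _ ha.1).trans ha.2⟩
    refine le_trans (le_of_eq ?_) (Finset.single_le_sum (f := fun g : ℕ => if g ∣ a ∧ g ∣ b then (g : ℝ) * (1 / a) * (1 / b) else 0) (fun g _ => by split_ifs <;> positivity) hg)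
    rw [if_pos ⟨Nat.gcd_dvd_left _ _, Nat.gcd_dvd_right _ _⟩]
  calc ∑ a ∈ S, ∑ k ∈ S, ∑ b ∈ S, (if a ∣ k ∧ b ∣ k then (1 : ℝ) else 0)
      = ∑ a ∈ S, ∑ b ∈ S, ∑ k ∈ S, (if a ∣ k ∧ b ∣ k then (1 : ℝ) else 0) :=
        Finset.sum_congr rfl fun a _ => Finset.sum_comm
    _ ≤ ∑ a ∈ S, ∑ b ∈ S, K * ∑ g ∈ S, (if g ∣ a ∧ g ∣ b then (g : ℝ) * (1 / a) * (1 / b) else 0) :=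
        Finset.sum_le_sum fun a ha => Finset.sum_le_sum fun b hb => h2 a ha b hb
    _ = K * ∑ g ∈ S, (g : ℝ) * (∑ a ∈ S.filter (fun a => g ∣ a), (1 : ℝ) / a) ^ 2 := by
        simp_rw [← Finset.mul_sum]
        congr 1
        calc ∑ a ∈ S, ∑ b ∈ S, ∑ g ∈ S, (if g ∣ a ∧ g ∣ b then (g : ℝ) * (1 / a) * (1 / b) else 0)
            = ∑ a ∈ S, ∑ g ∈ S, ∑ b ∈ S, (if g ∣ a ∧ g ∣ b then (g : ℝ) * (1 / a) * (1 / b) else 0) :=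
              Finset.sum_congr rfl fun a _ => Finset.sum_comm
          _ = ∑ g ∈ S, ∑ a ∈ S, ∑ b ∈ S, (if g ∣ a ∧ g ∣ b then (g : ℝ) * (1 / a) * (1 / b) else 0) := Finset.sum_comm
          _ = _ := by
            refine Finset.sum_congr rfl fun g _ => ?_
            rw [sq, Finset.sum_filter, Finset.sum_mul_sum, Finset.mul_sum]
            refine Finset.sum_congr rfl fun a _ => ?_
            rw [Finset.mul_sum]
            refine Finset.sum_congr rfl fun b _ => ?_
            by_cases ha : g ∣ a <;> by_cases hb : g ∣ b <;> simp [ha, hb]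
            ring
    _ ≤ K * ∑ g ∈ S, (1 : ℝ) / g * H ^ 2 := by
        refine mul_le_mul_of_nonneg_left (Finset.sum_le_sum fun g hg => ?_) (by positivity)
        rw [hS, Finset.mem_Ioc] at hg
        have hgR : (0 : ℝ) < g := by exact_mod_cast hg.1
        have h3 := sum_multiples_inv K g hg.1
        calc (g : ℝ) * (∑ a ∈ S.filter (fun a => g ∣ a), (1 : ℝ) / a) ^ 2 ≤ g * (1 / g * H) ^ 2 :=
              mul_le_mul_of_nonneg_left (pow_le_pow_left₀ (Finset.sum_nonneg fun _ _ => by positivity) h3 2) hgR.le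
          _ = _ := by field_simp
    _ = K * H ^ 3 := by rw [← Finset.sum_mul]; ring
    _ ≤ _ := by
        have := harmonic_Ioc_le K
        gcongr

theorem prod_div_pred_le (S : Finset ℕ) (hS : ∀ p ∈ S, 2 ≤ p) :
    ∏ p ∈ S, ((p : ℝ) / (p - 1)) ≤ S.card + 1 := by
  induction S using Finset.induction_on_max with
  | empty => simp
  | insert M T hM ih =>
    have hnot : M ∉ T := fun h => lt_irrefl _ (hM M h)
    rw [Finset.prod_insert hnot, Finset.card_insert_of_notMem hnot]
    have ih' := ih fun p hp => hS p (Finset.mem_insert_of_mem hp)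
    have hM2 : 2 ≤ M := hS M (Finset.mem_insert_self _ _)
    have hcard : T.card + 2 ≤ M := by
      have : T ⊆ Finset.Ico 2 M := by
        intro p hp
        rw [Finset.mem_Ico]
        exact ⟨hS p (Finset.mem_insert_of_mem hp), hM p hp⟩
      have := Finset.card_le_card this
      rw [Nat.card_Ico] at this
      omega
    have hc : (T.card : ℝ) + 2 ≤ M := by exact_mod_cast hcard
    have hM1 : (0 : ℝ) < M - 1 := by
      have : (0 : ℝ) ≤ T.card := by positivity
      linarith
    calc (M : ℝ) / (M - 1) * ∏ p ∈ T, ((p : ℝ) / (p - 1)) ≤ M / (M - 1) * (T.card + 1) := by gcongr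
      _ ≤ _ := by
        rw [div_mul_eq_mul_div, div_le_iff₀ hM1]
        push_cast
        nlinarith

theorem le_totient_mul (n : ℕ) (hn : 0 < n) : (n : ℝ) ≤ Nat.totient n * (2 * (1 + Real.log n)) := by
  have h1 : ((Nat.totient n : ℚ) : ℝ) = n * ∏ p ∈ n.primeFactors, (1 - (p : ℝ)⁻¹) := by
    rw [Nat.totient_eq_mul_prod_factors]; push_cast; rfl
  rw [Rat.cast_natCast] at h1
  have h2 := prod_div_pred_le n.primeFactors (fun p hp => (Nat.prime_of_mem_primeFactors hp).two_le)
  have h3 : (∏ p ∈ n.primeFactors, (1 - (p : ℝ)⁻¹)) * ∏ p ∈ n.primeFactors, ((p : ℝ) / (p - 1)) = 1 := by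
    rw [← Finset.prod_mul_distrib]
    refine Finset.prod_eq_one fun p hp => ?_
    have : (2 : ℝ) ≤ p := by exact_mod_cast (Nat.prime_of_mem_primeFactors hp).two_le
    have : (p : ℝ) - 1 ≠ 0 := by linarith
    field_simp
  have h4 : (n.primeFactors.card : ℝ) * Real.log 2 ≤ Real.log n := by
    rw [← Real.log_pow]
    apply Real.log_le_log (by positivity)
    have : 2 ^ n.primeFactors.card ≤ n := by
      calc 2 ^ n.primeFactors.card = ∏ p ∈ n.primeFactors, 2 := by simp
        _ ≤ ∏ p ∈ n.primeFactors, p := Finset.prod_le_prod' fun p hp => (Nat.prime_of_mem_primeFactors hp).two_le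
        _ ≤ n := Nat.le_of_dvd hn (Nat.prod_primeFactors_dvd n)
    exact_mod_cast this
  have h5 : (n.primeFactors.card : ℝ) + 1 ≤ 2 * (1 + Real.log n) := by
    have : (n.primeFactors.card : ℝ) * (1 / 2) ≤ n.primeFactors.card * Real.log 2 := by
      gcongr; linarith [Real.log_two_gt_d9]
    linarith
  calc (n : ℝ) = n * ((∏ p ∈ n.primeFactors, (1 - (p : ℝ)⁻¹)) * ∏ p ∈ n.primeFactors, ((p : ℝ) / (p - 1))) := by rw [h3, mul_one]
    _ = Nat.totient n * ∏ p ∈ n.primeFactors, ((p : ℝ) / (p - 1)) := by rw [h1]; ring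
    _ ≤ _ := by gcongr; linarith

/-- twist of an arithmetic function -/
def twist (e : ℕ → ℂ) (f : ArithmeticFunction ℝ) : ArithmeticFunction ℂ :=
  ⟨fun n => (f n : ℂ) * e n, by simp⟩

theorem twist_apply (e : ℕ → ℂ) (f : ArithmeticFunction ℝ) (n : ℕ) : twist e f n = (f n : ℂ) * e n := rfl

theorem twist_mul (e : ℕ → ℂ) (he : ∀ m n, e (m * n) = e m * e n) (f g : ArithmeticFunction ℝ) :
    twist e (f * g) = twist e f * twist e g := by
  ext n
  rw [twist_apply, ArithmeticFunction.mul_apply, ArithmeticFunction.mul_apply]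
  push_cast
  rw [Finset.sum_mul]
  refine Finset.sum_congr rfl fun d hd => ?_
  rw [twist_apply, twist_apply, ← (Nat.mem_divisorsAntidiagonal.1 hd).1, he]
  ring

theorem sum_twist_conv (e : ℕ → ℂ) (he : ∀ m n, e (m * n) = e m * e n) (f g : ArithmeticFunction ℝ) (N : ℕ) :
    ∑ n ∈ Finset.Ioc 0 N, ((f * g) n : ℂ) * e n =
      ∑ k ∈ Finset.Ioc 0 N, (f k : ℂ) * e k * ∑ m ∈ Finset.Ioc 0 (N / k), (g m : ℂ) * e m := by
  have := ArithmeticFunction.sum_Ioc_mul_eq_sum_sum (twist e f) (twist e g) N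
  rw [← twist_mul e he] at this
  exact this

/-- truncation -/
def tle (U : ℕ) (f : ArithmeticFunction ℝ) : ArithmeticFunction ℝ :=
  ⟨fun n => if n ≤ U then f n else 0, by simp⟩

theorem tle_apply (U : ℕ) (f : ArithmeticFunction ℝ) (n : ℕ) : tle U f n = if n ≤ U then f n else 0 := rfl

theorem vaughan_identity (U : ℕ) :
    (ArithmeticFunction.vonMangoldt : ArithmeticFunction ℝ) = tle U ArithmeticFunction.vonMangoldt
      + tle U ((ArithmeticFunction.moebius : ArithmeticFunction ℤ) : ArithmeticFunction ℝ) * ArithmeticFunction.log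
      - tle U ((ArithmeticFunction.moebius : ArithmeticFunction ℤ) : ArithmeticFunction ℝ) * tle U ArithmeticFunction.vonMangoldt * ((ArithmeticFunction.zeta : ArithmeticFunction ℕ) : ArithmeticFunction ℝ)
      + (((ArithmeticFunction.moebius : ArithmeticFunction ℤ) : ArithmeticFunction ℝ) - tle U ((ArithmeticFunction.moebius : ArithmeticFunction ℤ) : ArithmeticFunction ℝ)) *
        ((ArithmeticFunction.zeta : ArithmeticFunction ℕ) : ArithmeticFunction ℝ) * (ArithmeticFunction.vonMangoldt - tle U ArithmeticFunction.vonMangoldt) := by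
  have h1 : ((ArithmeticFunction.moebius : ArithmeticFunction ℤ) : ArithmeticFunction ℝ) * ((ArithmeticFunction.zeta : ArithmeticFunction ℕ) : ArithmeticFunction ℝ) = 1 :=
    ArithmeticFunction.coe_moebius_mul_coe_zeta
  rw [← ArithmeticFunction.vonMangoldt_mul_zeta]
  set M := ((ArithmeticFunction.moebius : ArithmeticFunction ℤ) : ArithmeticFunction ℝ)
  set Z := ((ArithmeticFunction.zeta : ArithmeticFunction ℕ) : ArithmeticFunction ℝ)
  set L := (ArithmeticFunction.vonMangoldt : ArithmeticFunction ℝ)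
  linear_combination (tle U L - L) * h1

open Complex Filter Topology

theorem nat_log_cast_le {m X : ℕ} (h : m ≤ X) (_hX : 1 ≤ X) : Real.log m ≤ Real.log X := by
  rcases Nat.eq_zero_or_pos m with rfl | hm
  · simp only [Nat.cast_zero, Real.log_zero]; exact Real.log_natCast_nonneg X
  · exact Real.log_le_log (by exact_mod_cast hm) (by exact_mod_cast h)

theorem moebius_abs_le_one (n : ℕ) : |((ArithmeticFunction.moebius n : ℤ) : ℝ)| ≤ 1 := by
  exact_mod_cast ArithmeticFunction.abs_moebius_le_one (n := n)

theorem tle_moebius_abs (U n : ℕ) :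
    |tle U ((ArithmeticFunction.moebius : ArithmeticFunction ℤ) : ArithmeticFunction ℝ) n| ≤ if n ≤ U then 1 else 0 := by
  rw [tle_apply]
  split_ifs
  · rw [ArithmeticFunction.intCoe_apply]; exact moebius_abs_le_one n
  · simp

theorem sum_ite_le (N U : ℕ) (c : ℝ) (hc : 0 ≤ c) :
    ∑ k ∈ Finset.Ioc 0 N, (if k ≤ U then c else 0) ≤ U * c := by
  rw [← Finset.sum_filter, Finset.sum_const, nsmul_eq_mul]
  refine mul_le_mul_of_nonneg_right ?_ hc
  have : (Finset.Ioc 0 N).filter (fun k => k ≤ U) ⊆ Finset.Ioc 0 U := by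
    intro k hk
    simp only [Finset.mem_filter, Finset.mem_Ioc] at hk ⊢
    exact ⟨hk.1.1, hk.2⟩
  have := Finset.card_le_card this
  rw [Nat.card_Ioc, Nat.sub_zero] at this
  exact_mod_cast this

theorem sum_Ioc_eq_range {A : Type*} [AddCommMonoid A] (F : ℕ → A) (hF : F 0 = 0) (M : ℕ) :
    ∑ m ∈ Finset.Ioc 0 M, F m = ∑ m ∈ Finset.range (M + 1), F m := by
  induction M with
  | zero => simp [hF]
  | succ n ih => rw [Finset.sum_Ioc_succ_top (Nat.zero_le n), Finset.sum_range_succ, ih]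

theorem log_twist_bound (i : Σ k : ℕ, DirichletCharacter ℂ (k + 1)) (hi : i.2 ≠ 1) (M X : ℕ) (hM : M ≤ X)
    (hX : 1 ≤ X) :
    ‖∑ m ∈ Finset.Ioc 0 M, ((ArithmeticFunction.log m : ℝ) : ℂ) * pEval i m‖ ≤ 3 * (i.1 + 1) * Real.log X := by
  have h := abel_bound (fun k : ℕ => Real.log ((min k X : ℕ) : ℝ)) (pEval i) (S := (i.1 + 1)) (B := Real.log X)
    (Or.inl ?_) ?_ ?_ (M + 1)
  · rw [sum_Ioc_eq_range _ (by simp)]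
    refine le_trans (le_of_eq ?_) h
    congr 1
    refine Finset.sum_congr rfl fun m hm => ?_
    rw [Finset.mem_range] at hm
    rw [ArithmeticFunction.log_apply, min_eq_left (by omega : m ≤ X)]
  · intro a b hab
    have : min a X ≤ min b X := min_le_min_right _ hab
    rcases Nat.eq_zero_or_pos (min b X) with h0 | h0
    · have h1 : min a X = 0 := by omega
      simp only [h0, h1]; exact le_rfl
    · exact nat_log_cast_le this h0
  · intro k
    rw [abs_of_nonneg (Real.log_natCast_nonneg _)]
    exact nat_log_cast_le (min_le_right _ _) hX
  · intro n
    have := norm_sum_range_char_le i.2 hi n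
    push_cast at this
    exact this

theorem zeta_twist_bound (i : Σ k : ℕ, DirichletCharacter ℂ (k + 1)) (hi : i.2 ≠ 1) (M : ℕ) :
    ‖∑ m ∈ Finset.Ioc 0 M, ((((ArithmeticFunction.zeta : ArithmeticFunction ℕ) : ArithmeticFunction ℝ) m : ℝ) : ℂ) * pEval i m‖ ≤ (i.1 + 1) := by
  have := norm_chiSum_le i.2 hi M
  push_cast at this
  refine le_trans (le_of_eq ?_) this
  congr 1
  rw [chiSum]
  refine Finset.sum_congr rfl fun m hm => ?_
  rw [Finset.mem_Icc] at hm
  have : m ≠ 0 := by omega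
  simp [pEval, ArithmeticFunction.natCoe_apply, ArithmeticFunction.zeta_apply, this]

theorem conv_trunc_abs (U r : ℕ) :
    |(tle U ((ArithmeticFunction.moebius : ArithmeticFunction ℤ) : ArithmeticFunction ℝ) * tle U ArithmeticFunction.vonMangoldt) r| ≤
      if r ≤ U * U then Real.log r else 0 := by
  rw [ArithmeticFunction.mul_apply]
  split_ifs with h
  · rw [← ArithmeticFunction.vonMangoldt_sum]
    refine (Finset.abs_sum_le_sum_abs _ _).trans ?_
    rw [← Nat.sum_divisorsAntidiagonal' (fun _ y => ArithmeticFunction.vonMangoldt y)]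
    refine Finset.sum_le_sum fun d hd => ?_
    rw [abs_mul]
    have h1 := tle_moebius_abs U d.1
    have h2 : |tle U ArithmeticFunction.vonMangoldt d.2| ≤ ArithmeticFunction.vonMangoldt d.2 := by
      rw [tle_apply]; split_ifs
      · rw [abs_of_nonneg ArithmeticFunction.vonMangoldt_nonneg]
      · simp [ArithmeticFunction.vonMangoldt_nonneg]
    have h3 : |tle U ((ArithmeticFunction.moebius : ArithmeticFunction ℤ) : ArithmeticFunction ℝ) d.1| ≤ 1 := by
      refine h1.trans ?_; split_ifs <;> norm_num
    calc _ ≤ 1 * ArithmeticFunction.vonMangoldt d.2 := mul_le_mul h3 h2 (abs_nonneg _) zero_le_one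
      _ = _ := one_mul _
  · rw [Finset.sum_eq_zero, abs_zero]
    intro d hd
    rw [tle_apply, tle_apply]
    have := (Nat.mem_divisorsAntidiagonal.1 hd).1
    by_cases h1 : d.1 ≤ U
    · by_cases h2 : d.2 ≤ U
      · exact absurd (this ▸ Nat.mul_le_mul h1 h2) h
      · simp [h2]
    · simp [h1]

theorem type_one_bound (i : Σ k : ℕ, DirichletCharacter ℂ (k + 1)) (hi : i.2 ≠ 1) (N X U : ℕ) (hN : N ≤ X)
    (hX : 1 ≤ X) (hU : 1 ≤ U) :
    ‖∑ n ∈ Finset.Ioc 0 N, ((tle U ArithmeticFunction.vonMangoldt n : ℝ) : ℂ) * pEval i n‖ +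
    ‖∑ n ∈ Finset.Ioc 0 N, (((tle U ((ArithmeticFunction.moebius : ArithmeticFunction ℤ) : ArithmeticFunction ℝ) * ArithmeticFunction.log) n : ℝ) : ℂ) * pEval i n‖ +
    ‖∑ n ∈ Finset.Ioc 0 N, (((tle U ((ArithmeticFunction.moebius : ArithmeticFunction ℤ) : ArithmeticFunction ℝ) * tle U ArithmeticFunction.vonMangoldt *
        ((ArithmeticFunction.zeta : ArithmeticFunction ℕ) : ArithmeticFunction ℝ)) n : ℝ) : ℂ) * pEval i n‖ ≤
      5 * U ^ 2 * (i.1 + 1) * Real.log X := by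
  have hL : 0 ≤ Real.log X := Real.log_natCast_nonneg X
  have hUR : (1 : ℝ) ≤ U := by exact_mod_cast hU
  have s1 : ‖∑ n ∈ Finset.Ioc 0 N, ((tle U ArithmeticFunction.vonMangoldt n : ℝ) : ℂ) * pEval i n‖ ≤ U * Real.log X := by
    refine (norm_sum_le _ _).trans (le_trans (Finset.sum_le_sum fun n hn => ?_) (sum_ite_le N U _ hL))
    rw [Finset.mem_Ioc] at hn
    rw [norm_mul, Complex.norm_real, Real.norm_eq_abs, tle_apply]
    split_ifs
    · rw [abs_of_nonneg ArithmeticFunction.vonMangoldt_nonneg]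
      calc _ ≤ Real.log n * 1 := mul_le_mul ArithmeticFunction.vonMangoldt_le_log (norm_pEval_le _ _) (norm_nonneg _) (Real.log_natCast_nonneg _)
        _ = Real.log n := mul_one _
        _ ≤ _ := nat_log_cast_le (hn.2.trans hN) hX
    · simp
  have s2 : ‖∑ n ∈ Finset.Ioc 0 N, (((tle U ((ArithmeticFunction.moebius : ArithmeticFunction ℤ) : ArithmeticFunction ℝ) * ArithmeticFunction.log) n : ℝ) : ℂ) * pEval i n‖
      ≤ U * (3 * (i.1 + 1) * Real.log X) := by
    rw [sum_twist_conv _ (pEval_mul i)]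
    refine (norm_sum_le _ _).trans (le_trans (Finset.sum_le_sum fun k hk => ?_) (sum_ite_le N U _ (by positivity)))
    rw [Finset.mem_Ioc] at hk
    rw [norm_mul, norm_mul, Complex.norm_real, Real.norm_eq_abs]
    have h1 := tle_moebius_abs U k
    have h2 := log_twist_bound i hi (N / k) X ((Nat.div_le_self _ _).trans hN) hX
    have h3 := norm_pEval_le i k
    split_ifs at h1 ⊢
    · calc _ ≤ 1 * 1 * (3 * (i.1 + 1) * Real.log X) :=
          mul_le_mul (mul_le_mul h1 h3 (norm_nonneg _) zero_le_one) h2 (norm_nonneg _) (by norm_num)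
        _ = _ := by ring
    · rw [le_antisymm h1 (abs_nonneg _), zero_mul, zero_mul]
  have s3 : ‖∑ n ∈ Finset.Ioc 0 N, (((tle U ((ArithmeticFunction.moebius : ArithmeticFunction ℤ) : ArithmeticFunction ℝ) * tle U ArithmeticFunction.vonMangoldt *
        ((ArithmeticFunction.zeta : ArithmeticFunction ℕ) : ArithmeticFunction ℝ)) n : ℝ) : ℂ) * pEval i n‖ ≤ (U * U : ℕ) * ((i.1 + 1) * Real.log X) := by
    rw [sum_twist_conv _ (pEval_mul i)]
    refine (norm_sum_le _ _).trans (le_trans (Finset.sum_le_sum fun k hk => ?_) (sum_ite_le N (U * U) _ (by positivity)))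
    rw [Finset.mem_Ioc] at hk
    rw [norm_mul, norm_mul, Complex.norm_real, Real.norm_eq_abs]
    have h1 := conv_trunc_abs U k
    have h2 := zeta_twist_bound i hi (N / k)
    have h3 := norm_pEval_le i k
    have h4 := nat_log_cast_le (hk.2.trans hN) hX
    split_ifs at h1 ⊢
    · calc _ ≤ Real.log X * 1 * (i.1 + 1) :=
          mul_le_mul (mul_le_mul (h1.trans h4) h3 (norm_nonneg _) hL) h2 (norm_nonneg _) (by positivity)
        _ = _ := by ring
    · rw [le_antisymm h1 (abs_nonneg _), zero_mul, zero_mul]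
  refine (add_le_add (add_le_add s1 s2) s3).trans ?_
  push_cast
  have hq : (1 : ℝ) ≤ i.1 + 1 := by have : (0 : ℝ) ≤ i.1 := by positivity
                                    linarith
  have a1 : (U : ℝ) * Real.log X ≤ U ^ 2 * (i.1 + 1) * Real.log X := by
    refine mul_le_mul_of_nonneg_right ?_ hL
    nlinarith
  have a2 : (U : ℝ) * (3 * (i.1 + 1) * Real.log X) ≤ 3 * (U ^ 2 * (i.1 + 1) * Real.log X) := by
    have : (U : ℝ) ≤ U ^ 2 := by nlinarith
    have h := mul_le_mul_of_nonneg_right this (show 0 ≤ 3 * ((i.1 : ℝ) + 1) * Real.log X by positivity)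
    linarith
  linarith

theorem card_primSet_le (D R : ℕ) : ((primSet D R).card : ℝ) ≤ R ^ 2 := by
  classical
  rw [primSet, Finset.card_sigma]
  push_cast
  calc ∑ k ∈ Finset.Ico D R, _ ≤ ∑ k ∈ Finset.Ico D R, (R : ℝ) := by
        refine Finset.sum_le_sum fun k hk => ?_
        rw [Finset.mem_Ico] at hk
        have h1 := Finset.card_le_univ (Finset.univ.filter (fun χ : DirichletCharacter ℂ (k + 1) => χ.IsPrimitive))
        have h2 : Fintype.card (DirichletCharacter ℂ (k + 1)) = (k + 1).totient := by
          rw [← Nat.card_eq_fintype_card]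
          exact DirichletCharacter.card_eq_totient_of_hasEnoughRootsOfUnity ℂ (k + 1)
        have h3 := Nat.totient_le (k + 1)
        have : (Finset.univ.filter (fun χ : DirichletCharacter ℂ (k + 1) => χ.IsPrimitive)).card ≤ R := by omega
        exact_mod_cast this
    _ ≤ R ^ 2 := by
        rw [Finset.sum_const, nsmul_eq_mul, sq]
        refine mul_le_mul_of_nonneg_right ?_ (by positivity)
        rw [Nat.card_Ico]
        exact_mod_cast Nat.sub_le _ _

theorem mem_primSet {D R : ℕ} {i : Σ k : ℕ, DirichletCharacter ℂ (k + 1)} :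
    i ∈ primSet D R ↔ (D ≤ i.1 ∧ i.1 < R) ∧ i.2.IsPrimitive := by
  classical
  rw [primSet, Finset.mem_sigma, Finset.mem_Ico, Finset.mem_filter]
  simp

theorem prim_ne_one {i : Σ k : ℕ, DirichletCharacter ℂ (k + 1)} (h : i.2.IsPrimitive) (h1 : 1 ≤ i.1) : i.2 ≠ 1 := by
  intro h2
  have h3 : i.2.conductor = i.1 + 1 := h
  rw [h2, DirichletCharacter.conductor_one] at h3
  omega

open Complex Filter Topology

/-- Type II coefficient -/
noncomputable def bII (U : ℕ) : ArithmeticFunction ℝ :=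
  (((ArithmeticFunction.moebius : ArithmeticFunction ℤ) : ArithmeticFunction ℝ) - tle U ((ArithmeticFunction.moebius : ArithmeticFunction ℤ) : ArithmeticFunction ℝ)) *
        ((ArithmeticFunction.zeta : ArithmeticFunction ℕ) : ArithmeticFunction ℝ)

/-- Type II coefficient -/
noncomputable def aII (U : ℕ) : ArithmeticFunction ℝ := ArithmeticFunction.vonMangoldt - tle U ArithmeticFunction.vonMangoldt

theorem aII_apply (U m : ℕ) : aII U m = if m ≤ U then 0 else ArithmeticFunction.vonMangoldt m := by
  have : aII U m = ArithmeticFunction.vonMangoldt m - tle U ArithmeticFunction.vonMangoldt m := rfl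
  rw [this, tle_apply]
  split_ifs <;> simp

theorem abs_aII_le (U m : ℕ) : |aII U m| ≤ Real.log m := by
  rw [aII_apply]
  split_ifs
  · simp [Real.log_natCast_nonneg]
  · rw [abs_of_nonneg ArithmeticFunction.vonMangoldt_nonneg]; exact ArithmeticFunction.vonMangoldt_le_log

theorem bII_apply (U k : ℕ) : bII U k = ∑ d ∈ k.divisors, if d ≤ U then 0 else ((ArithmeticFunction.moebius d : ℤ) : ℝ) := by
  rw [bII, ArithmeticFunction.coe_mul_zeta_apply]
  refine Finset.sum_congr rfl fun d _ => ?_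
  have : (((ArithmeticFunction.moebius : ArithmeticFunction ℤ) : ArithmeticFunction ℝ) - tle U ((ArithmeticFunction.moebius : ArithmeticFunction ℤ) : ArithmeticFunction ℝ)) d
    = ((ArithmeticFunction.moebius : ArithmeticFunction ℤ) : ArithmeticFunction ℝ) d - tle U ((ArithmeticFunction.moebius : ArithmeticFunction ℤ) : ArithmeticFunction ℝ) d := rfl
  rw [this, tle_apply]
  split_ifs <;> simp

theorem abs_bII_le (U k : ℕ) : |bII U k| ≤ k.divisors.card := by
  rw [bII_apply]
  refine (Finset.abs_sum_le_sum_abs _ _).trans ?_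
  rw [Finset.card_eq_sum_ones]
  push_cast
  refine Finset.sum_le_sum fun d _ => ?_
  split_ifs
  · simp
  · exact moebius_abs_le_one d

theorem bII_eq_zero (U k : ℕ) (h : k ≤ U) : bII U k = 0 := by
  rw [bII_apply]
  refine Finset.sum_eq_zero fun d hd => ?_
  rw [if_pos ((Nat.divisor_le hd).trans h)]

theorem sum_aII_sq (U M : ℕ) {ℓ : ℝ} (hℓ : Real.log M ≤ ℓ) (hM : 1 ≤ M) :
    ∑ m ∈ Finset.range M, ‖((aII U m : ℝ) : ℂ)‖ ^ 2 ≤ M * ℓ ^ 2 := by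
  calc _ ≤ ∑ m ∈ Finset.range M, ℓ ^ 2 := by
        refine Finset.sum_le_sum fun m hm => ?_
        rw [Finset.mem_range] at hm
        rw [Complex.norm_real, Real.norm_eq_abs]
        exact pow_le_pow_left₀ (abs_nonneg _) ((abs_aII_le U m).trans ((nat_log_cast_le hm.le hM).trans hℓ)) 2
    _ = _ := by simp

theorem sum_bII_sq (U K : ℕ) {ℓ : ℝ} (hℓ : 1 + Real.log K ≤ ℓ) :
    ∑ k ∈ Finset.range K, ‖((bII U k : ℝ) : ℂ)‖ ^ 2 ≤ K * ℓ ^ 3 := by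
  have h0 : 0 ≤ Real.log K := Real.log_natCast_nonneg K
  calc _ ≤ ∑ k ∈ Finset.range (K + 1), ‖((bII U k : ℝ) : ℂ)‖ ^ 2 :=
        Finset.sum_le_sum_of_subset_of_nonneg (Finset.range_mono (Nat.le_succ K)) fun _ _ _ => by positivity
    _ = ∑ k ∈ Finset.Ioc 0 K, ‖((bII U k : ℝ) : ℂ)‖ ^ 2 := by
        rw [sum_Ioc_eq_range _ (by simp)]
    _ ≤ ∑ k ∈ Finset.Ioc 0 K, ((k.divisors.card : ℝ)) ^ 2 := by
        refine Finset.sum_le_sum fun k _ => ?_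
        rw [Complex.norm_real, Real.norm_eq_abs]
        exact pow_le_pow_left₀ (abs_nonneg _) (abs_bII_le U k) 2
    _ ≤ K * (1 + Real.log K) ^ 3 := sum_divisors_sq K
    _ ≤ _ := by gcongr

theorem block_arith {N M K E u ℓ : ℝ} (hN : 0 ≤ N) (hM : 0 ≤ M) (hK : 0 ≤ K) (hE : 0 ≤ E) (hu : 0 < u) (hℓ : 1 ≤ ℓ)
    (hMK : M * K ≤ 8 * N) (hM1 : M ≤ 8 * N / u) (hK1 : K ≤ 2 * N / u) :
    √((M + E) * (M * ℓ ^ 2) * ((K + E) * (K * ℓ ^ 3))) ≤ 9 * ℓ ^ 3 * (N + N * √(E / u) + √N * E) := by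
  set s := √(E / u) with hs
  have hs2 : s ^ 2 = E / u := Real.sq_sqrt (by positivity)
  set t := √N with ht
  have ht2 : t ^ 2 = N := Real.sq_sqrt hN
  have hs0 : 0 ≤ s := Real.sqrt_nonneg _
  have ht0 : 0 ≤ t := Real.sqrt_nonneg _
  apply Real.sqrt_le_iff.2
  refine ⟨by positivity, ?_⟩
  have h1 : (M + E) * (K + E) ≤ 8 * N + 10 * N * s ^ 2 + E ^ 2 := by
    have : E * (M + K) ≤ E * (10 * N / u) := by
      refine mul_le_mul_of_nonneg_left ?_ hE
      calc M + K ≤ 8 * N / u + 2 * N / u := add_le_add hM1 hK1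
        _ = _ := by ring
    rw [hs2]
    have e : E * (10 * N / u) = 10 * N * (E / u) := by ring
    nlinarith
  calc (M + E) * (M * ℓ ^ 2) * ((K + E) * (K * ℓ ^ 3)) = (M * K) * ((M + E) * (K + E)) * ℓ ^ 5 := by ring
    _ ≤ (8 * N) * (8 * N + 10 * N * s ^ 2 + E ^ 2) * ℓ ^ 6 := by
        refine mul_le_mul (mul_le_mul hMK h1 (by positivity) (by positivity)) (pow_le_pow_right₀ hℓ (by norm_num)) (by positivity) (by positivity)
    _ ≤ (81 * (N + N * s + t * E) ^ 2) * ℓ ^ 6 := by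
        refine mul_le_mul_of_nonneg_right ?_ (by positivity)
        have : 0 ≤ N * (N * s) := by positivity
        have : 0 ≤ N * (t * E) := by positivity
        have : 0 ≤ N * s * (t * E) := by positivity
        have e1 : (t * E) ^ 2 = N * E ^ 2 := by rw [mul_pow, ht2]
        have : 0 ≤ N ^ 2 := by positivity
        have : 0 ≤ N ^ 2 * s ^ 2 := by positivity
        have : 0 ≤ N * E ^ 2 := by positivity
        nlinarith
    _ = _ := by ring

theorem block_bound (D R N X U j : ℕ) (hN : N ≤ X) (hN1 : 1 ≤ N) (hU : 1 ≤ U) (hj : j ≤ Nat.log 2 N) {E ℓ : ℝ}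
    (hE : E = 2 * R ^ 2 * (1 + Real.log (R ^ 2 + 1))) (hℓ : ℓ = 4 + Real.log X) :
    ∑ i ∈ primSet D R, ‖∑ k ∈ (Finset.Ioc 0 N).filter (fun k => Nat.log 2 k = j),
      ((bII U k : ℝ) : ℂ) * pEval i k * ∑ m ∈ Finset.Ioc 0 (N / k), ((aII U m : ℝ) : ℂ) * pEval i m‖ ≤
      18 * ℓ ^ 4 * (N + N * √(E / U) + √N * E) := by
  have hL : 0 ≤ Real.log X := Real.log_natCast_nonneg X
  have hE0 : 0 ≤ E := by
    rw [hE]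
    have : 0 ≤ Real.log ((R : ℝ) ^ 2 + 1) := Real.log_nonneg (by nlinarith [sq_nonneg (R : ℝ)])
    positivity
  have hℓ1 : 1 ≤ ℓ := by rw [hℓ]; linarith
  have hrhs : 0 ≤ 18 * ℓ ^ 4 * (N + N * √(E / U) + √N * E) := by positivity
  have hjN : 2 ^ j ≤ N := (Nat.pow_le_pow_right (by norm_num) hj).trans (Nat.pow_log_le_self 2 (by omega))
  have hlo : ∀ k ∈ (Finset.Ioc 0 N).filter (fun k => Nat.log 2 k = j), 2 ^ j ≤ k ∧ k < 2 ^ (j + 1) := by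
    intro k hk
    simp only [Finset.mem_filter, Finset.mem_Ioc] at hk
    rw [← hk.2]
    exact ⟨Nat.pow_log_le_self 2 (by omega), Nat.lt_pow_succ_log_self (by norm_num) k⟩
  by_cases c1 : 2 ^ (j + 1) ≤ U
  · refine le_trans (le_of_eq ?_) hrhs
    refine Finset.sum_eq_zero fun i _ => ?_
    rw [norm_eq_zero]
    refine Finset.sum_eq_zero fun k hk => ?_
    rw [bII_eq_zero U k (by have := hlo k hk; omega)]; simp
  by_cases c2 : N / 2 ^ j ≤ U
  · refine le_trans (le_of_eq ?_) hrhs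
    refine Finset.sum_eq_zero fun i _ => ?_
    rw [norm_eq_zero]
    refine Finset.sum_eq_zero fun k hk => ?_
    rw [Finset.sum_eq_zero, mul_zero]
    intro m hm
    rw [Finset.mem_Ioc] at hm
    have : N / k ≤ N / 2 ^ j := Nat.div_le_div_left (hlo k hk).1 (by positivity)
    rw [aII_apply, if_pos (by omega)]; simp
  push Not at c1 c2
  set K := 2 ^ (j + 1) with hK
  set J := Nat.log 2 (N / 2 ^ j + 1) + 1 with hJ
  have hNj : 1 ≤ N / 2 ^ j := by omega
  have hM : 2 ^ J ≤ 4 * (N / 2 ^ j) := by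
    have : 2 ^ Nat.log 2 (N / 2 ^ j + 1) ≤ N / 2 ^ j + 1 := Nat.pow_log_le_self 2 (by omega)
    rw [hJ, pow_succ]; omega
  set B : ℕ → ℕ := fun k => if (0 < k ∧ k ≤ N) ∧ Nat.log 2 k = j then N / k + 1 else 0 with hB
  have hB' : ∀ k < K, B k < 2 ^ J := by
    intro k _
    simp only [hB]
    split_ifs with h
    · have h1 := (hlo k (by simp only [Finset.mem_filter, Finset.mem_Ioc]; exact h)).1
      have h2 : N / k ≤ N / 2 ^ j := Nat.div_le_div_left h1 (by positivity)
      exact lt_of_le_of_lt (by omega) (Nat.lt_pow_succ_log_self (by norm_num) (N / 2 ^ j + 1))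
    · positivity
  have key := bilinear_cut (primSet D R) pEval hE0 (fun N a => by rw [hE]; exact large_sieve_mult D R N a)
    (fun m => ((aII U m : ℝ) : ℂ)) (fun k => ((bII U k : ℝ) : ℂ)) J K B hB'
  have hMN : 2 ^ J ≤ 4 * N := hM.trans (Nat.mul_le_mul_left 4 (Nat.div_le_self _ _))
  have hX1 : 1 ≤ X := hN1.trans hN
  have hXR : (0 : ℝ) < X := by exact_mod_cast hX1
  have hlogM : Real.log (2 ^ J : ℕ) ≤ Real.log 4 + Real.log X := by
    rw [← Real.log_mul (by norm_num) hXR.ne']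
    refine Real.log_le_log (by positivity) ?_
    exact_mod_cast hMN.trans (Nat.mul_le_mul_left 4 hN)
  have hl4 : Real.log 4 ≤ 1.4 := by
    rw [show (4 : ℝ) = 2 ^ 2 by norm_num, Real.log_pow]; push_cast; linarith [Real.log_two_lt_d9]
  have hKN : K ≤ 2 * N := by rw [hK, pow_succ]; omega
  have hlogK : Real.log K ≤ 0.7 + Real.log X := by
    have : Real.log K ≤ Real.log 2 + Real.log X := by
      rw [← Real.log_mul (by norm_num) hXR.ne']
      refine Real.log_le_log (by rw [hK]; positivity) ?_
      exact_mod_cast hKN.trans (Nat.mul_le_mul_left 2 hN)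
    linarith [Real.log_two_lt_d9]
  have hJℓ : (J : ℝ) ≤ 2 * ℓ := by
    have h1 : (J : ℝ) * Real.log 2 ≤ Real.log 4 + Real.log X := by
      rw [← Real.log_pow]; exact_mod_cast hlogM
    have h2 : (J : ℝ) * (1 / 2) ≤ J * Real.log 2 := by
      refine mul_le_mul_of_nonneg_left ?_ (by positivity)
      linarith [Real.log_two_gt_d9]
    rw [hℓ]; linarith
  have hA := sum_aII_sq U (2 ^ J) (ℓ := ℓ) (by rw [hℓ]; linarith) (Nat.one_le_two_pow)
  have hBB := sum_bII_sq U K (ℓ := ℓ) (by rw [hℓ]; linarith)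
  have hjR : (0 : ℝ) < 2 ^ j := by positivity
  have hUR : (0 : ℝ) < U := by exact_mod_cast hU
  have hMR : ((2 ^ J : ℕ) : ℝ) ≤ 4 * (N / 2 ^ j) := by
    have h1 : ((2 ^ J : ℕ) : ℝ) ≤ 4 * ((N / 2 ^ j : ℕ) : ℝ) := by exact_mod_cast hM
    have h2 : ((N / 2 ^ j : ℕ) : ℝ) ≤ (N : ℝ) / ((2 ^ j : ℕ) : ℝ) := Nat.cast_div_le
    push_cast at h2 h1 ⊢
    linarith
  have hKR : (K : ℝ) = 2 * 2 ^ j := by rw [hK, pow_succ]; push_cast; ring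
  have hU2 : (U : ℝ) * 2 ^ j ≤ N := by
    have : U * 2 ^ j ≤ N := (Nat.le_div_iff_mul_le (by positivity)).1 c2.le
    exact_mod_cast this
  have hUK : (U : ℝ) ≤ 2 * 2 ^ j := by rw [← hKR]; exact_mod_cast c1.le
  have harith := block_arith (N := N) (M := ((2 ^ J : ℕ) : ℝ)) (K := K) (E := E) (u := U) (ℓ := ℓ) (by positivity) (by positivity) (by positivity)
    hE0 hUR hℓ1 (by
      calc ((2 ^ J : ℕ) : ℝ) * K ≤ 4 * (N / 2 ^ j) * (2 * 2 ^ j) := by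
            rw [hKR]; exact mul_le_mul_of_nonneg_right hMR (by positivity)
        _ = 8 * N := by field_simp; norm_num) (by
      refine hMR.trans ?_
      rw [le_div_iff₀ hUR]
      calc 4 * ((N : ℝ) / 2 ^ j) * U ≤ 4 * ((N : ℝ) / 2 ^ j) * (2 * 2 ^ j) := mul_le_mul_of_nonneg_left hUK (by positivity)
        _ = 8 * N := by field_simp; norm_num) (by
      rw [le_div_iff₀ hUR, hKR]; linarith)
  calc _ = ∑ i ∈ primSet D R, ‖∑ k ∈ Finset.range K, ((bII U k : ℝ) : ℂ) * pEval i k * ∑ m ∈ Finset.range (B k), ((aII U m : ℝ) : ℂ) * pEval i m‖ := by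
        refine Finset.sum_congr rfl fun i _ => ?_
        congr 1
        refine Finset.sum_congr_of_eq_on_inter ?_ ?_ ?_
        · intro k hk hk'
          exact absurd (Finset.mem_range.2 (hlo k hk).2) hk'
        · intro k _ hk'
          simp only [Finset.mem_filter, Finset.mem_Ioc] at hk'
          simp only [hB, if_neg hk', Finset.range_zero, Finset.sum_empty, mul_zero]
        · intro k hk _
          simp only [Finset.mem_filter, Finset.mem_Ioc] at hk
          simp only [hB, if_pos hk]
          rw [sum_Ioc_eq_range _ (by simp)]
    _ ≤ _ := key
    _ ≤ (2 * ℓ) * √((((2 ^ J : ℕ) : ℝ) + E) * (((2 ^ J : ℕ) : ℝ) * ℓ ^ 2) * ((K + E) * (K * ℓ ^ 3))) := by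
        refine mul_le_mul hJℓ (Real.sqrt_le_sqrt ?_) (Real.sqrt_nonneg _) (by positivity)
        refine mul_le_mul (mul_le_mul_of_nonneg_left hA (by positivity)) (mul_le_mul_of_nonneg_left hBB (by positivity)) ?_ (by positivity)
        exact mul_nonneg (by positivity) (Finset.sum_nonneg fun _ _ => by positivity)
    _ ≤ (2 * ℓ) * (9 * ℓ ^ 3 * (N + N * √(E / U) + √N * E)) := mul_le_mul_of_nonneg_left harith (by positivity)
    _ = _ := by ring

theorem typeII_bound (D R N X U : ℕ) (hN : N ≤ X) (hX : 1 ≤ X) (hU : 1 ≤ U) (hR : R ≤ X) {ℓ : ℝ}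
    (hℓ : ℓ = 4 + Real.log X) :
    ∑ i ∈ primSet D R, ‖∑ n ∈ Finset.Ioc 0 N, (((bII U * aII U) n : ℝ) : ℂ) * pEval i n‖ ≤
      144 * ℓ ^ 6 * (X + R * X / √U + √X * R ^ 2) := by
  have hL : 0 ≤ Real.log X := Real.log_natCast_nonneg X
  have hXR : (1 : ℝ) ≤ X := by exact_mod_cast hX
  have hUR : (0 : ℝ) < U := by exact_mod_cast hU
  have hℓ1 : 1 ≤ ℓ := by rw [hℓ]; linarith
  have hrhs : 0 ≤ 144 * ℓ ^ 6 * (X + R * X / √U + √X * R ^ 2) := by positivity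
  rcases Nat.eq_zero_or_pos N with rfl | hN1
  · simpa using hrhs
  set E : ℝ := 2 * R ^ 2 * (1 + Real.log (R ^ 2 + 1)) with hE
  have hElog : 0 ≤ Real.log ((R : ℝ) ^ 2 + 1) := Real.log_nonneg (by nlinarith [sq_nonneg (R : ℝ)])
  have hE0 : 0 ≤ E := by positivity
  have hE1 : E ≤ 4 * R ^ 2 * ℓ := by
    have h1 : Real.log ((R : ℝ) ^ 2 + 1) ≤ Real.log (2 * X ^ 2) := by
      refine Real.log_le_log (by positivity) ?_
      have : (R : ℝ) ≤ X := by exact_mod_cast hR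
      have : (R : ℝ) ^ 2 ≤ X ^ 2 := by gcongr
      nlinarith
    rw [Real.log_mul (by norm_num) (by positivity), Real.log_pow] at h1
    push_cast at h1
    calc E ≤ 2 * R ^ 2 * (2 * ℓ) := by
          rw [hE]
          refine mul_le_mul_of_nonneg_left ?_ (by positivity)
          rw [hℓ]; linarith [Real.log_two_lt_d9]
      _ = _ := by ring
  have hEU : √(E / U) ≤ 2 * R * ℓ / √U := by
    apply Real.sqrt_le_iff.2
    refine ⟨by positivity, ?_⟩
    rw [div_pow, Real.sq_sqrt hUR.le]
    refine div_le_div_of_nonneg_right ?_ hUR.le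
    calc E ≤ 4 * R ^ 2 * ℓ := hE1
      _ ≤ 4 * R ^ 2 * ℓ ^ 2 := by
          refine mul_le_mul_of_nonneg_left ?_ (by positivity)
          nlinarith
      _ = _ := by ring
  set Bd := 18 * ℓ ^ 4 * (N + N * √(E / U) + √N * E) with hBd
  have hBd1 : Bd ≤ 72 * ℓ ^ 5 * (X + R * X / √U + √X * R ^ 2) := by
    have hNX : (N : ℝ) ≤ X := by exact_mod_cast hN
    have a1 : (N : ℝ) ≤ 4 * ℓ * X := by nlinarith
    have a2 : (N : ℝ) * √(E / U) ≤ 4 * ℓ * (R * X / √U) := by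
      calc (N : ℝ) * √(E / U) ≤ X * (2 * R * ℓ / √U) := mul_le_mul hNX hEU (Real.sqrt_nonneg _) (by positivity)
        _ = 2 * (ℓ * (R * X / √U)) := by ring
        _ ≤ 4 * (ℓ * (R * X / √U)) := by
            have : 0 ≤ ℓ * (R * X / √U) := by positivity
            linarith
        _ = _ := by ring
    have a3 : √N * E ≤ 4 * ℓ * (√X * R ^ 2) := by
      calc √N * E ≤ √X * (4 * R ^ 2 * ℓ) := mul_le_mul (Real.sqrt_le_sqrt hNX) hE1 hE0 (Real.sqrt_nonneg _)
        _ = _ := by ring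
    calc Bd ≤ 18 * ℓ ^ 4 * (4 * ℓ * X + 4 * ℓ * (R * X / √U) + 4 * ℓ * (√X * R ^ 2)) :=
          mul_le_mul_of_nonneg_left (add_le_add (add_le_add a1 a2) a3) (by positivity)
      _ = _ := by ring
  have hcount : ((Nat.log 2 N + 1 : ℕ) : ℝ) ≤ 2 * ℓ := by
    have h1 : 2 ^ Nat.log 2 N ≤ X := (Nat.pow_log_le_self 2 (by omega)).trans hN
    have h2 : ((Nat.log 2 N : ℕ) : ℝ) * Real.log 2 ≤ Real.log X := by
      rw [← Real.log_pow]
      refine Real.log_le_log (by positivity) ?_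
      exact_mod_cast h1
    have h3 : ((Nat.log 2 N : ℕ) : ℝ) * (1 / 2) ≤ (Nat.log 2 N : ℕ) * Real.log 2 := by
      refine mul_le_mul_of_nonneg_left ?_ (by positivity)
      linarith [Real.log_two_gt_d9]
    push_cast
    rw [hℓ]; linarith
  calc _ ≤ ∑ i ∈ primSet D R, ∑ j ∈ Finset.range (Nat.log 2 N + 1), ‖∑ k ∈ (Finset.Ioc 0 N).filter (fun k => Nat.log 2 k = j),
      ((bII U k : ℝ) : ℂ) * pEval i k * ∑ m ∈ Finset.Ioc 0 (N / k), ((aII U m : ℝ) : ℂ) * pEval i m‖ := by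
        refine Finset.sum_le_sum fun i _ => ?_
        rw [sum_twist_conv _ (pEval_mul i),
          ← Finset.sum_fiberwise_of_maps_to (s := Finset.Ioc 0 N) (t := Finset.range (Nat.log 2 N + 1)) (g := fun k => Nat.log 2 k)]
        · exact norm_sum_le _ _
        · intro k hk
          rw [Finset.mem_Ioc] at hk
          rw [Finset.mem_range]
          exact Nat.lt_succ_of_le (Nat.log_mono_right hk.2)
    _ = ∑ j ∈ Finset.range (Nat.log 2 N + 1), ∑ i ∈ primSet D R, ‖∑ k ∈ (Finset.Ioc 0 N).filter (fun k => Nat.log 2 k = j),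
      ((bII U k : ℝ) : ℂ) * pEval i k * ∑ m ∈ Finset.Ioc 0 (N / k), ((aII U m : ℝ) : ℂ) * pEval i m‖ := Finset.sum_comm
    _ ≤ ∑ j ∈ Finset.range (Nat.log 2 N + 1), 72 * ℓ ^ 5 * (X + R * X / √U + √X * R ^ 2) := by
        refine Finset.sum_le_sum fun j hj => ?_
        exact (block_bound D R N X U j hN hN1 hU (by rw [Finset.mem_range] at hj; omega) hE hℓ).trans hBd1
    _ = ((Nat.log 2 N + 1 : ℕ) : ℝ) * (72 * ℓ ^ 5 * (X + R * X / √U + √X * R ^ 2)) := by simp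
    _ ≤ (2 * ℓ) * (72 * ℓ ^ 5 * (X + R * X / √U + √X * R ^ 2)) := mul_le_mul_of_nonneg_right hcount (by positivity)
    _ = _ := by ring

/-- mean value estimate over primitive characters -/
theorem mean_value_psi (D R N X U : ℕ) (hD : 1 ≤ D) (hN : N ≤ X) (hX : 1 ≤ X) (hU : 1 ≤ U) (hR : R ≤ X) {ℓ : ℝ}
    (hℓ : ℓ = 4 + Real.log X) :
    ∑ i ∈ primSet D R, ‖∑ n ∈ Finset.Ioc 0 N, ((ArithmeticFunction.vonMangoldt n : ℝ) : ℂ) * pEval i n‖ ≤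
      150 * ℓ ^ 6 * (X + R * X / √U + √X * R ^ 2 + R ^ 3 * U ^ 2) := by
  have hL : 0 ≤ Real.log X := Real.log_natCast_nonneg X
  have hℓ1 : 1 ≤ ℓ := by rw [hℓ]; linarith
  have hv := vaughan_identity U
  set M : ArithmeticFunction ℝ := ((ArithmeticFunction.moebius : ArithmeticFunction ℤ) : ArithmeticFunction ℝ) with hM
  set Z : ArithmeticFunction ℝ := ((ArithmeticFunction.zeta : ArithmeticFunction ℕ) : ArithmeticFunction ℝ) with hZ
  have hpt : ∀ n, (ArithmeticFunction.vonMangoldt n : ℝ) = tle U ArithmeticFunction.vonMangoldt n + (tle U M * ArithmeticFunction.log) n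
      - (tle U M * tle U ArithmeticFunction.vonMangoldt * Z) n + (bII U * aII U) n := by
    intro n
    have := congrArg (fun f : ArithmeticFunction ℝ => f n) hv
    exact this
  have hone : ∀ i ∈ primSet D R, ‖∑ n ∈ Finset.Ioc 0 N, ((ArithmeticFunction.vonMangoldt n : ℝ) : ℂ) * pEval i n‖ ≤
      5 * U ^ 2 * R * ℓ + ‖∑ n ∈ Finset.Ioc 0 N, (((bII U * aII U) n : ℝ) : ℂ) * pEval i n‖ := by
    intro i hi
    rw [mem_primSet] at hi
    have h1 := type_one_bound i (prim_ne_one hi.2 (hD.trans hi.1.1)) N X U hN hX hU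
    have h2 : ∑ n ∈ Finset.Ioc 0 N, ((ArithmeticFunction.vonMangoldt n : ℝ) : ℂ) * pEval i n =
        ∑ n ∈ Finset.Ioc 0 N, ((tle U ArithmeticFunction.vonMangoldt n : ℝ) : ℂ) * pEval i n
        + ∑ n ∈ Finset.Ioc 0 N, (((tle U M * ArithmeticFunction.log) n : ℝ) : ℂ) * pEval i n
        - ∑ n ∈ Finset.Ioc 0 N, (((tle U M * tle U ArithmeticFunction.vonMangoldt * Z) n : ℝ) : ℂ) * pEval i n
        + ∑ n ∈ Finset.Ioc 0 N, (((bII U * aII U) n : ℝ) : ℂ) * pEval i n := by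
      rw [← Finset.sum_add_distrib, ← Finset.sum_sub_distrib, ← Finset.sum_add_distrib]
      refine Finset.sum_congr rfl fun n _ => ?_
      rw [hpt n]; push_cast; ring
    have h3 : (5 : ℝ) * U ^ 2 * (i.1 + 1) * Real.log X ≤ 5 * U ^ 2 * R * ℓ := by
      have : (i.1 : ℝ) + 1 ≤ R := by exact_mod_cast hi.1.2
      refine mul_le_mul (mul_le_mul_of_nonneg_left this (by positivity)) (by rw [hℓ]; linarith) hL (by positivity)
    rw [h2]
    refine (norm_add_le _ _).trans (add_le_add_left (((norm_sub_le _ _).trans (add_le_add_left (norm_add_le _ _) _)).trans (h1.trans h3)) _)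
  refine (Finset.sum_le_sum hone).trans ?_
  rw [Finset.sum_add_distrib, Finset.sum_const, nsmul_eq_mul]
  have hII := typeII_bound D R N X U hN hX hU hR hℓ
  have hc := card_primSet_le D R
  have h1 : ((primSet D R).card : ℝ) * (5 * U ^ 2 * R * ℓ) ≤ 5 * (ℓ ^ 6 * (R ^ 3 * U ^ 2)) := by
    calc ((primSet D R).card : ℝ) * (5 * U ^ 2 * R * ℓ) ≤ R ^ 2 * (5 * U ^ 2 * R * ℓ) := mul_le_mul_of_nonneg_right hc (by positivity)
      _ = 5 * (ℓ * (R ^ 3 * U ^ 2)) := by ring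
      _ ≤ 5 * (ℓ ^ 6 * (R ^ 3 * U ^ 2)) := by
          have : ℓ ≤ ℓ ^ 6 := le_self_pow₀ hℓ1 (by norm_num)
          gcongr
  have h2 : 0 ≤ ℓ ^ 6 * (X + R * X / √U + √X * R ^ 2) := by positivity
  have h3 : 0 ≤ ℓ ^ 6 * ((R : ℝ) ^ 3 * U ^ 2) := by positivity
  linarith

open Complex Filter Topology

theorem exists_prim_index {q : ℕ} [NeZero q] (χ : DirichletCharacter ℂ q) (hχ : χ ≠ 1) :
    ∃ i : Σ k : ℕ, DirichletCharacter ℂ (k + 1), 1 ≤ i.1 ∧ i.2.IsPrimitive ∧ (i.1 + 1) ∣ q ∧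
      ∀ n : ℕ, n.Coprime q → pEval i n = χ (n : ZMod q) := by
  have gen : ∀ (d : ℕ) (ψ : DirichletCharacter ℂ d) (hd : d ∣ q), ψ.IsPrimitive → d ≠ 1 →
      DirichletCharacter.changeLevel hd ψ = χ →
      ∃ i : Σ k : ℕ, DirichletCharacter ℂ (k + 1), 1 ≤ i.1 ∧ i.2.IsPrimitive ∧ (i.1 + 1) ∣ q ∧
      ∀ n : ℕ, n.Coprime q → pEval i n = χ (n : ZMod q) := by
    intro d ψ hd hp h1 hc
    cases d with
    | zero => exact absurd (Nat.eq_zero_of_zero_dvd hd) (NeZero.ne q)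
    | succ k =>
      refine ⟨⟨k, ψ⟩, ?_, hp, hd, ?_⟩
      · show 1 ≤ k
        omega
      · intro n hn
        rw [← hc, changeLevel_natCast ψ hd hn]; rfl
  refine gen _ χ.primitiveCharacter χ.conductor_dvd_level χ.primitiveCharacter_isPrimitive ?_
    χ.changeLevel_primitiveCharacter
  intro h
  exact hχ (DirichletCharacter.eq_one_iff_conductor_eq_one.2 h)

theorem char_ext_coprime {q : ℕ} [NeZero q] {χ χ' : DirichletCharacter ℂ q}
    (h : ∀ n : ℕ, n.Coprime q → χ (n : ZMod q) = χ' (n : ZMod q)) : χ = χ' := by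
  refine MulChar.ext fun u => ?_
  have h1 := h (u : ZMod q).val ((ZMod.isUnit_iff_coprime _ _).1 (by rw [ZMod.natCast_zmod_val]; exact u.isUnit))
  rwa [ZMod.natCast_zmod_val] at h1

/-- the twisted Chebyshev sum attached to a primitive character -/
noncomputable def psiI (i : Σ k : ℕ, DirichletCharacter ℂ (k + 1)) (M : ℕ) : ℝ :=
  ‖∑ n ∈ Finset.Ioc 0 M, ((ArithmeticFunction.vonMangoldt n : ℝ) : ℂ) * pEval i n‖

/-- the contribution of non coprime prime powers -/
noncomputable def WW (q M : ℕ) : ℝ :=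
  ∑ n ∈ (Finset.Ioc 0 M).filter (fun n => ¬ n.Coprime q), ArithmeticFunction.vonMangoldt n

theorem WW_le (q M : ℕ) (hq : 0 < q) :
    WW q M ≤ ∑ n ∈ (Finset.Ioc 0 M).filter (fun n => ¬ n.Prime), ArithmeticFunction.vonMangoldt n + Real.log q := by
  have h1 : WW q M ≤ ∑ n ∈ (Finset.Ioc 0 M).filter (fun n => ¬ n.Prime) ∪ q.primeFactors, ArithmeticFunction.vonMangoldt n := by
    refine Finset.sum_le_sum_of_subset_of_nonneg ?_ fun _ _ _ => ArithmeticFunction.vonMangoldt_nonneg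
    intro n hn
    rw [Finset.mem_filter] at hn
    rw [Finset.mem_union, Finset.mem_filter]
    by_cases hp : n.Prime
    · right
      rw [Nat.mem_primeFactors]
      exact ⟨hp, by_contra fun h => hn.2 ((Nat.Prime.coprime_iff_not_dvd hp).2 h), hq.ne'⟩
    · exact Or.inl ⟨hn.1, hp⟩
  have h2 : ∑ n ∈ q.primeFactors, (ArithmeticFunction.vonMangoldt n : ℝ) ≤ Real.log q := by
    calc _ = ∑ n ∈ q.primeFactors, Real.log n :=
          Finset.sum_congr rfl fun n hn => ArithmeticFunction.vonMangoldt_apply_prime (Nat.prime_of_mem_primeFactors hn)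
      _ = Real.log (∏ n ∈ q.primeFactors, (n : ℝ)) := by
          rw [Real.log_prod]
          intro n hn
          exact_mod_cast (Nat.prime_of_mem_primeFactors hn).ne_zero
      _ ≤ _ := by
          refine Real.log_le_log (Finset.prod_pos fun n hn => by exact_mod_cast (Nat.prime_of_mem_primeFactors hn).pos) ?_
          have := Nat.le_of_dvd hq (Nat.prod_primeFactors_dvd q)
          rw [← Nat.cast_prod]
          exact Nat.cast_le.2 this
  have := Finset.sum_union_inter (s₁ := (Finset.Ioc 0 M).filter (fun n => ¬ n.Prime)) (s₂ := q.primeFactors) (f := fun n => (ArithmeticFunction.vonMangoldt n : ℝ))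
  have h0 : 0 ≤ ∑ n ∈ (Finset.Ioc 0 M).filter (fun n => ¬ n.Prime) ∩ q.primeFactors, (ArithmeticFunction.vonMangoldt n : ℝ) :=
    Finset.sum_nonneg fun _ _ => ArithmeticFunction.vonMangoldt_nonneg
  linarith

theorem sum_diff_le_WW (q M : ℕ) (u v : ℕ → ℂ) (h : ∀ n : ℕ, n.Coprime q → u n = v n)
    (h' : ∀ n : ℕ, ¬ n.Coprime q → ‖u n - v n‖ ≤ 1) :
    ‖∑ n ∈ Finset.Ioc 0 M, ((ArithmeticFunction.vonMangoldt n : ℝ) : ℂ) * u n -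
      ∑ n ∈ Finset.Ioc 0 M, ((ArithmeticFunction.vonMangoldt n : ℝ) : ℂ) * v n‖ ≤ WW q M := by
  rw [← Finset.sum_sub_distrib, WW, Finset.sum_filter]
  refine (norm_sum_le _ _).trans (Finset.sum_le_sum fun n _ => ?_)
  rw [← mul_sub, norm_mul, Complex.norm_real, Real.norm_eq_abs, abs_of_nonneg ArithmeticFunction.vonMangoldt_nonneg]
  by_cases hc : n.Coprime q
  · rw [h n hc, if_neg (not_not.2 hc)]; simp
  · rw [if_pos hc]
    exact mul_le_of_le_one_right ArithmeticFunction.vonMangoldt_nonneg (h' n hc)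

theorem delta_psi_bound (q : ℕ) [NeZero q] (a M : ℕ) (ha : a.Coprime q) :
    |∑ n ∈ Finset.Ioc 0 M, (ArithmeticFunction.vonMangoldt n : ℝ) * ((if n % q = a % q then 1 else 0) - 1 / (q.totient : ℝ))| ≤
      WW q M + 1 / (q.totient : ℝ) * ∑ i ∈ (primSet 1 q).filter (fun i => (i.1 + 1) ∣ q), psiI i M := by
  classical
  have hφ : (0 : ℝ) < q.totient := by exact_mod_cast Nat.totient_pos.2 (NeZero.pos q)
  have hφc : (q.totient : ℂ) ≠ 0 := by exact_mod_cast hφ.ne'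
  have hau : IsUnit (a : ZMod q) := (ZMod.isUnit_iff_coprime _ _).2 ha
  set P : DirichletCharacter ℂ q → ℂ := fun χ => ∑ n ∈ Finset.Ioc 0 M, ((ArithmeticFunction.vonMangoldt n : ℝ) : ℂ) * χ (n : ZMod q) with hP
  set P0 : ℂ := ∑ n ∈ Finset.Ioc 0 M, ((ArithmeticFunction.vonMangoldt n : ℝ) : ℂ) * 1 with hP0
  have hid : ((∑ n ∈ Finset.Ioc 0 M, (ArithmeticFunction.vonMangoldt n : ℝ) * ((if n % q = a % q then 1 else 0) - 1 / (q.totient : ℝ)) : ℝ) : ℂ) =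
      1 / (q.totient : ℂ) * ((P 1 - P0) + ∑ χ ∈ Finset.univ.erase (1 : DirichletCharacter ℂ q), (starRingEnd ℂ) (χ (a : ZMod q)) * P χ) := by
    have e1 : P 1 + ∑ χ ∈ Finset.univ.erase (1 : DirichletCharacter ℂ q), (starRingEnd ℂ) (χ (a : ZMod q)) * P χ =
        ∑ χ : DirichletCharacter ℂ q, (starRingEnd ℂ) (χ (a : ZMod q)) * P χ := by
      rw [← Finset.add_sum_erase Finset.univ _ (Finset.mem_univ (1 : DirichletCharacter ℂ q)), MulChar.one_apply hau, map_one, one_mul]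
    have e2 : ∑ χ : DirichletCharacter ℂ q, (starRingEnd ℂ) (χ (a : ZMod q)) * P χ =
        ∑ n ∈ Finset.Ioc 0 M, ((ArithmeticFunction.vonMangoldt n : ℝ) : ℂ) * (if n % q = a % q then (q.totient : ℂ) else 0) := by
      simp only [hP, Finset.mul_sum]
      rw [Finset.sum_comm]
      refine Finset.sum_congr rfl fun n _ => ?_
      have := char_orth hau (n : ZMod q)
      have h2 : (if n % q = a % q then (q.totient : ℂ) else 0) = if (a : ZMod q) = (n : ZMod q) then (q.totient : ℂ) else 0 := by
        refine if_congr ?_ rfl rfl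
        rw [ZMod.natCast_eq_natCast_iff']; exact eq_comm
      rw [h2, ← this, Finset.mul_sum]
      refine Finset.sum_congr rfl fun χ _ => by ring
    rw [sub_add_eq_add_sub, e1, e2, hP0, ← Finset.sum_sub_distrib, Finset.mul_sum]
    push_cast
    refine Finset.sum_congr rfl fun n _ => ?_
    split_ifs <;> push_cast <;> field_simp <;> ring
  have hW0 : 0 ≤ WW q M := Finset.sum_nonneg fun _ _ => ArithmeticFunction.vonMangoldt_nonneg
  have hW1 : ‖P 1 - P0‖ ≤ WW q M := by
    refine sum_diff_le_WW q M (fun n => (1 : DirichletCharacter ℂ q) (n : ZMod q)) (fun _ => 1) ?_ ?_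
    · intro n hn; exact MulChar.one_apply ((ZMod.isUnit_iff_coprime _ _).2 hn)
    · intro n hn
      rw [char_eq_zero _ hn]; simp
  have hex : ∀ χ : DirichletCharacter ℂ q, ∃ i : Σ k : ℕ, DirichletCharacter ℂ (k + 1), χ ≠ 1 → (1 ≤ i.1 ∧ i.2.IsPrimitive ∧ (i.1 + 1) ∣ q ∧
      ∀ n : ℕ, n.Coprime q → pEval i n = χ (n : ZMod q)) := by
    intro χ
    by_cases h : χ = 1
    · exact ⟨⟨0, 1⟩, fun h' => absurd h h'⟩
    · obtain ⟨i, hi⟩ := exists_prim_index χ h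
      exact ⟨i, fun _ => hi⟩
  choose I hI using hex
  have hcard : ((Finset.univ.erase (1 : DirichletCharacter ℂ q)).card : ℝ) + 1 = q.totient := by
    have h1 : Fintype.card (DirichletCharacter ℂ q) = q.totient := by
      rw [← Nat.card_eq_fintype_card]
      exact DirichletCharacter.card_eq_totient_of_hasEnoughRootsOfUnity ℂ q
    have h2 := Finset.card_erase_add_one (Finset.mem_univ (1 : DirichletCharacter ℂ q))
    rw [Finset.card_univ, h1] at h2
    exact_mod_cast h2
  have hbd : ∑ χ ∈ Finset.univ.erase (1 : DirichletCharacter ℂ q), ‖(starRingEnd ℂ) (χ (a : ZMod q)) * P χ‖ ≤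
      ∑ χ ∈ Finset.univ.erase (1 : DirichletCharacter ℂ q), (psiI (I χ) M + WW q M) := by
    refine Finset.sum_le_sum fun χ hχ => ?_
    have hχ1 : χ ≠ 1 := (Finset.mem_erase.1 hχ).1
    rw [norm_mul, RCLike.norm_conj]
    have h1 := norm_char_le_one' χ (a : ZMod q)
    have h2 : ‖P χ - ∑ n ∈ Finset.Ioc 0 M, ((ArithmeticFunction.vonMangoldt n : ℝ) : ℂ) * pEval (I χ) n‖ ≤ WW q M := by
      refine sum_diff_le_WW q M (fun n => χ (n : ZMod q)) (pEval (I χ)) ?_ ?_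
      · intro n hn; exact ((hI χ hχ1).2.2.2 n hn).symm
      · intro n hn
        simp only [char_eq_zero χ hn, zero_sub, norm_neg]
        exact norm_pEval_le _ _
    have h3 : ‖P χ‖ ≤ psiI (I χ) M + WW q M := by
      have := norm_add_le (P χ - ∑ n ∈ Finset.Ioc 0 M, ((ArithmeticFunction.vonMangoldt n : ℝ) : ℂ) * pEval (I χ) n)
        (∑ n ∈ Finset.Ioc 0 M, ((ArithmeticFunction.vonMangoldt n : ℝ) : ℂ) * pEval (I χ) n)
      rw [sub_add_cancel] at this
      rw [psiI]; linarith
    exact (mul_le_of_le_one_left (norm_nonneg _) h1).trans h3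
  have hinj : ∑ χ ∈ Finset.univ.erase (1 : DirichletCharacter ℂ q), psiI (I χ) M ≤
      ∑ i ∈ (primSet 1 q).filter (fun i => (i.1 + 1) ∣ q), psiI i M := by
    have hio : Set.InjOn I (Finset.univ.erase (1 : DirichletCharacter ℂ q) : Finset (DirichletCharacter ℂ q)) := by
      intro χ hχ χ' hχ' h
      have h1 := (hI χ (Finset.mem_erase.1 hχ).1).2.2.2
      have h2 := (hI χ' (Finset.mem_erase.1 hχ').1).2.2.2
      refine char_ext_coprime fun n hn => ?_
      rw [← h1 n hn, ← h2 n hn, h]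
    rw [← Finset.sum_image (f := fun i => psiI i M) hio]
    refine Finset.sum_le_sum_of_subset_of_nonneg ?_ fun _ _ _ => norm_nonneg _
    intro i hi
    rw [Finset.mem_image] at hi
    obtain ⟨χ, hχ, rfl⟩ := hi
    have h1 := hI χ (Finset.mem_erase.1 hχ).1
    rw [Finset.mem_filter, mem_primSet]
    exact ⟨⟨⟨h1.1, Nat.lt_of_succ_le (Nat.le_of_dvd (NeZero.pos q) h1.2.2.1)⟩, h1.2.1⟩, h1.2.2.1⟩
  rw [← Real.norm_eq_abs, ← Complex.norm_real, hid, norm_mul, norm_div, norm_one, Complex.norm_natCast]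
  calc _ ≤ 1 / (q.totient : ℝ) * (WW q M + (∑ i ∈ (primSet 1 q).filter (fun i => (i.1 + 1) ∣ q), psiI i M + (q.totient - 1) * WW q M)) := by
        refine mul_le_mul_of_nonneg_left ?_ (by positivity)
        refine (norm_add_le _ _).trans (add_le_add hW1 ((norm_sum_le _ _).trans (hbd.trans ?_)))
        rw [Finset.sum_add_distrib, Finset.sum_const, nsmul_eq_mul]
        refine add_le_add hinj (le_of_eq ?_)
        rw [← hcard]; ring
    _ = _ := by field_simp; ring

open Complex Filter Topology

/-- weight of a residue class -/
noncomputable def cw (q a n : ℕ) : ℝ := (if n % q = a % q then 1 else 0) - 1 / (q.totient : ℝ)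

/-- discrepancy of `ψ` in a residue class -/
noncomputable def dPsi (q a M : ℕ) : ℝ := ∑ n ∈ Finset.Ioc 0 M, (ArithmeticFunction.vonMangoldt n : ℝ) * cw q a n

/-- prime power contribution -/
noncomputable def PP (M : ℕ) : ℝ := ∑ n ∈ (Finset.Ioc 0 M).filter (fun n => ¬ n.Prime), ArithmeticFunction.vonMangoldt n

theorem PP_mono {M X : ℕ} (h : M ≤ X) : PP M ≤ PP X :=
  Finset.sum_le_sum_of_subset_of_nonneg (Finset.filter_subset_filter _ (Finset.Ioc_subset_Ioc_right h))
    fun _ _ _ => ArithmeticFunction.vonMangoldt_nonneg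

theorem PP_nonneg (M : ℕ) : 0 ≤ PP M := Finset.sum_nonneg fun _ _ => ArithmeticFunction.vonMangoldt_nonneg

theorem PP_le (M : ℕ) (hM : 1 ≤ M) : PP M ≤ 2 * √M * Real.log M := by
  have h := Chebyshev.psi_sub_theta_le (x := (M : ℝ)) (by exact_mod_cast hM)
  rwa [Chebyshev.psi_sub_theta_eq_sum_not_prime, Nat.floor_natCast] at h

theorem abs_cw_le (q a n : ℕ) (hq : 0 < q) : |cw q a n| ≤ 1 := by
  have hφ : (1 : ℝ) ≤ q.totient := by exact_mod_cast Nat.totient_pos.2 hq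
  have h1 : 1 / (q.totient : ℝ) ≤ 1 := by rw [div_le_one (by linarith)]; exact hφ
  have h2 : 0 ≤ 1 / (q.totient : ℝ) := by positivity
  rw [cw, abs_le]
  split_ifs <;> constructor <;> linarith

theorem count_class_le (q a M' M : ℕ) (hq : 0 < q) (h : M' ≤ M) :
    ∑ n ∈ Finset.Ioc M' M, (if n % q = a % q then (1 : ℝ) else 0) ≤ ((M : ℝ) - M') / q + 1 := by
  have hqR : (0 : ℝ) < q := by exact_mod_cast hq
  have h1 := Nat.Ioc_filter_modEq_card M' M hq a
  rw [← Finset.sum_filter, Finset.sum_const, nsmul_eq_mul, mul_one]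
  have h2 : ((((Finset.Ioc M' M).filter (fun n => n % q = a % q)).card : ℤ) : ℝ) ≤ ((M : ℝ) - M') / q + 1 := by
    have e : ((Finset.Ioc M' M).filter (fun n => n % q = a % q)) = ((Finset.Ioc M' M).filter (fun n => n ≡ a [MOD q])) := rfl
    rw [e, h1]
    push_cast
    have hMR : (M' : ℝ) ≤ M := by exact_mod_cast h
    refine max_le ?_ ?_
    · have a1 := Int.floor_le ((((M : ℚ) - a) / q))
      have a2 := Int.lt_floor_add_one ((((M' : ℚ) - a) / q))
      have a1' : ((⌊((M : ℚ) - a) / q⌋ : ℤ) : ℝ) ≤ ((M : ℝ) - a) / q := by exact_mod_cast a1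
      have a2' : ((M' : ℝ) - a) / q < ((⌊((M' : ℚ) - a) / q⌋ : ℤ) : ℝ) + 1 := by exact_mod_cast a2
      have e2 : ((M : ℝ) - M') / q = ((M : ℝ) - a) / q - ((M' : ℝ) - a) / q := by ring
      rw [e2]; linarith
    · have : 0 ≤ ((M : ℝ) - M') / q := div_nonneg (by linarith) hqR.le
      linarith
  exact_mod_cast h2

theorem dPsi_gap (q a M' M X g : ℕ) (hq : 0 < q) (h : M' ≤ M) (hX : M ≤ X) (hg : M ≤ M' + g) :
    |dPsi q a M - dPsi q a M'| ≤ Real.log X * (g / q + 1 + g / q.totient) := by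
  have hφ : (0 : ℝ) < q.totient := by exact_mod_cast Nat.totient_pos.2 hq
  have hqR : (0 : ℝ) < q := by exact_mod_cast hq
  have hL : 0 ≤ Real.log X := Real.log_natCast_nonneg X
  rcases Nat.eq_zero_or_pos M with h0 | h0
  · have : M' = M := by omega
    rw [this, sub_self, abs_zero]; positivity
  have e : dPsi q a M - dPsi q a M' = ∑ n ∈ Finset.Ioc M' M, (ArithmeticFunction.vonMangoldt n : ℝ) * cw q a n := by
    rw [dPsi, dPsi, ← Finset.sum_Ioc_consecutive _ (Nat.zero_le M') h]; ring
  rw [e]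
  have hgR : (M : ℝ) - M' ≤ g := by
    have : (M : ℝ) ≤ M' + g := by exact_mod_cast hg
    linarith
  calc _ ≤ ∑ n ∈ Finset.Ioc M' M, Real.log X * ((if n % q = a % q then (1 : ℝ) else 0) + 1 / q.totient) := by
        refine (Finset.abs_sum_le_sum_abs _ _).trans (Finset.sum_le_sum fun n hn => ?_)
        rw [Finset.mem_Ioc] at hn
        rw [abs_mul, abs_of_nonneg ArithmeticFunction.vonMangoldt_nonneg]
        refine mul_le_mul (ArithmeticFunction.vonMangoldt_le_log.trans (nat_log_cast_le (hn.2.trans hX) (by omega))) ?_ (abs_nonneg _) hL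
        rw [cw]
        refine (abs_sub _ _).trans (le_of_eq ?_)
        rw [abs_of_pos (by positivity : (0 : ℝ) < 1 / q.totient)]
        split_ifs <;> simp
    _ = Real.log X * (∑ n ∈ Finset.Ioc M' M, (if n % q = a % q then (1 : ℝ) else 0) + ((M : ℝ) - M') / q.totient) := by
        rw [← Finset.mul_sum, Finset.sum_add_distrib, Finset.sum_const, nsmul_eq_mul, Nat.card_Ioc, Nat.cast_sub h]
        ring
    _ ≤ _ := by
        refine mul_le_mul_of_nonneg_left ?_ hL
        have h1 := count_class_le q a M' M hq h
        have h2 : ((M : ℝ) - M') / q ≤ g / q := div_le_div_of_nonneg_right hgR hqR.le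
        have h3 : ((M : ℝ) - M') / q.totient ≤ g / q.totient := div_le_div_of_nonneg_right hgR hφ.le
        linarith

theorem card_set_floor (P : ℕ → Prop) [DecidablePred P] (hP : ∀ n, P n → n ≠ 0) (x : ℝ) :
    ({p : ℕ | P p ∧ (p : ℝ) ≤ x}.ncard : ℝ) = ∑ n ∈ Finset.Ioc 0 ⌊x⌋₊, if P n then (1 : ℝ) else 0 := by
  rw [← Finset.sum_filter, Finset.sum_const, nsmul_eq_mul, mul_one]
  have : {p : ℕ | P p ∧ (p : ℝ) ≤ x} = ((Finset.Ioc 0 ⌊x⌋₊).filter P : Finset ℕ) := by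
    ext p
    simp only [Set.mem_ofPred_eq, Finset.coe_filter, Finset.mem_Ioc]
    constructor
    · rintro ⟨h1, h2⟩
      exact ⟨⟨Nat.pos_of_ne_zero (hP p h1), (Nat.le_floor_iff' (hP p h1)).2 h2⟩, h1⟩
    · rintro ⟨h1, h2⟩
      exact ⟨h2, (Nat.le_floor_iff' (hP p h2)).1 h1.2⟩
  rw [this, Set.ncard_coe_finset]

theorem Eerr_le (x : ℝ) (q : ℕ) (hq : 0 < q) {S : ℝ} (hS0 : 0 ≤ S)
    (hS : ∀ a M : ℕ, a.Coprime q → M ≤ ⌊x⌋₊ → |dPsi q a M| ≤ S) : Eerr x q ≤ 6 * (S + PP ⌊x⌋₊) := by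
  set X := ⌊x⌋₊ with hX
  have hPP := PP_nonneg X
  refine Real.sSup_le ?_ (by positivity)
  rintro r ⟨a, x', ha, hx', rfl⟩
  set N := ⌊x'⌋₊ with hN
  have hNX : N ≤ X := Nat.floor_mono hx'
  have e1 : (piAP x' q a : ℝ) - (piR x' : ℝ) / (q.totient : ℝ) = ∑ n ∈ Finset.Ioc 0 N, if n.Prime then cw q a n else 0 := by
    have h1 : (piR x' : ℝ) = ∑ n ∈ Finset.Ioc 0 N, if n.Prime then (1 : ℝ) else 0 := by
      exact card_set_floor Nat.Prime (fun n h => h.ne_zero) x'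
    have h2 : (piAP x' q a : ℝ) = ∑ n ∈ Finset.Ioc 0 N, if n.Prime ∧ n % q = a % q then (1 : ℝ) else 0 := by
      rw [← card_set_floor (fun n => n.Prime ∧ n % q = a % q) (fun n h => h.1.ne_zero) x', piAP]
      congr 2
      ext p; simp only [Set.mem_ofPred_eq]; tauto
    rw [h1, h2, Finset.sum_div, ← Finset.sum_sub_distrib]
    refine Finset.sum_congr rfl fun n _ => ?_
    rw [cw]
    by_cases hp : n.Prime <;> simp [hp]
  rw [e1]
  have hθ : ∀ M ≤ X, |∑ n ∈ Finset.Ioc 0 M, if n.Prime then Real.log n * cw q a n else 0| ≤ S + PP X := by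
    intro M hM
    have h1 : ∑ n ∈ Finset.Ioc 0 M, (if n.Prime then Real.log n * cw q a n else 0) =
        dPsi q a M - ∑ n ∈ (Finset.Ioc 0 M).filter (fun n => ¬ n.Prime), (ArithmeticFunction.vonMangoldt n : ℝ) * cw q a n := by
      rw [dPsi, Finset.sum_filter, ← Finset.sum_sub_distrib]
      refine Finset.sum_congr rfl fun n _ => ?_
      by_cases hp : n.Prime
      · simp [hp, ArithmeticFunction.vonMangoldt_apply_prime hp]
      · simp [hp]
    have h2 : |∑ n ∈ (Finset.Ioc 0 M).filter (fun n => ¬ n.Prime), (ArithmeticFunction.vonMangoldt n : ℝ) * cw q a n| ≤ PP M := by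
      refine (Finset.abs_sum_le_sum_abs _ _).trans (Finset.sum_le_sum fun n _ => ?_)
      rw [abs_mul, abs_of_nonneg ArithmeticFunction.vonMangoldt_nonneg]
      exact mul_le_of_le_one_right ArithmeticFunction.vonMangoldt_nonneg (abs_cw_le q a n hq)
    rw [h1]
    exact (abs_sub _ _).trans (add_le_add (hS a M ha hM) (h2.trans (PP_mono hM)))
  have hab := abel_bound (fun n : ℕ => 1 / Real.log ((max n 2 : ℕ) : ℝ))
    (fun n => ((if n ≤ X then (if n.Prime then Real.log n * cw q a n else 0) else 0 : ℝ) : ℂ)) (S := S + PP X) (B := 2) (Or.inr ?_) ?_ ?_ (N + 1)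
  · have e2 : ‖∑ n ∈ Finset.range (N + 1), (((1 / Real.log ((max n 2 : ℕ) : ℝ) : ℝ)) : ℂ) *
        ((if n ≤ X then (if n.Prime then Real.log n * cw q a n else 0) else 0 : ℝ) : ℂ)‖ = |∑ n ∈ Finset.Ioc 0 N, if n.Prime then cw q a n else 0| := by
      rw [sum_Ioc_eq_range _ (by simp [Nat.not_prime_zero]), ← Real.norm_eq_abs, ← Complex.norm_real, Complex.ofReal_sum]
      congr 1
      refine Finset.sum_congr rfl fun n hn => ?_
      rw [Finset.mem_range] at hn
      rw [if_pos (by omega : n ≤ X), ← Complex.ofReal_mul]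
      congr 1
      split_ifs with hp
      · rw [max_eq_left hp.two_le]
        have : Real.log n ≠ 0 := (Real.log_pos (by exact_mod_cast hp.one_lt)).ne'
        field_simp
      · simp
    rw [← e2]
    refine hab.trans (le_of_eq (by ring))
  · intro m n hmn
    have h2 : (2 : ℝ) ≤ ((max m 2 : ℕ) : ℝ) := by exact_mod_cast le_max_right m 2
    refine one_div_le_one_div_of_le (Real.log_pos (by linarith)) (Real.log_le_log (by linarith) ?_)
    exact_mod_cast max_le_max_right 2 hmn
  · intro n
    have h2 : (2 : ℝ) ≤ ((max n 2 : ℕ) : ℝ) := by exact_mod_cast le_max_right n 2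
    have h3 : Real.log 2 ≤ Real.log ((max n 2 : ℕ) : ℝ) := Real.log_le_log (by norm_num) h2
    have h4 := Real.log_two_gt_d9
    rw [abs_of_pos (by apply one_div_pos.2; linarith), div_le_iff₀ (by linarith)]
    linarith
  · intro n
    have key : ∀ k, ‖∑ n ∈ Finset.range k, ((if n ≤ X then (if n.Prime then Real.log n * cw q a n else 0) else 0 : ℝ) : ℂ)‖ ≤ S + PP X := by
      intro k
      have h1 : ∑ n ∈ Finset.range k, (if n ≤ X then (if n.Prime then Real.log n * cw q a n else 0) else 0) =
          ∑ n ∈ Finset.Ioc 0 (min (k - 1) X), (if n.Prime then Real.log n * cw q a n else 0) := by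
        symm
        refine Finset.sum_congr_of_eq_on_inter ?_ ?_ ?_
        · intro n hn hn'
          simp only [Finset.mem_Ioc, Finset.mem_range] at hn hn'
          omega
        · intro n hn hn'
          simp only [Finset.mem_Ioc, Finset.mem_range] at hn hn'
          split_ifs with h2 h3
          · have := h3.pos
            omega
          · rfl
          · rfl
        · intro n hn hn'
          simp only [Finset.mem_Ioc, Finset.mem_range] at hn hn'
          rw [if_pos (by omega : n ≤ X)]
      rw [← Complex.ofReal_sum, Complex.norm_real, Real.norm_eq_abs, h1]
      exact hθ _ (min_le_right _ _)
    exact key n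

open Complex Filter Topology

theorem psiI_nonneg (i : Σ k : ℕ, DirichletCharacter ℂ (k + 1)) (M : ℕ) : 0 ≤ psiI i M := norm_nonneg _

theorem nat_log_two_count {Q X : ℕ} (hX : 1 ≤ X) (hQ : Q ≤ X) {ℓ : ℝ} (hℓ : ℓ = 4 + Real.log X) :
    ((Nat.log 2 Q + 1 : ℕ) : ℝ) ≤ 2 * ℓ := by
  have hL : 0 ≤ Real.log X := Real.log_natCast_nonneg X
  have h1 : 2 ^ Nat.log 2 Q ≤ X := by
    rcases Nat.eq_zero_or_pos Q with rfl | h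
    · simpa using hX
    · exact (Nat.pow_log_le_self 2 (by omega)).trans hQ
  have h2 : ((Nat.log 2 Q : ℕ) : ℝ) * Real.log 2 ≤ Real.log X := by
    rw [← Real.log_pow]
    refine Real.log_le_log (by positivity) ?_
    exact_mod_cast h1
  have h3 : ((Nat.log 2 Q : ℕ) : ℝ) * (1 / 2) ≤ (Nat.log 2 Q : ℕ) * Real.log 2 := by
    refine mul_le_mul_of_nonneg_left ?_ (by positivity)
    linarith [Real.log_two_gt_d9]
  push_cast
  rw [hℓ]; linarith

/-- dyadic consequence of the mean value theorem -/
theorem dyadic_mean (D Q N X U : ℕ) (hD : 1 ≤ D) (hN : N ≤ X) (hX : 1 ≤ X) (hU : 1 ≤ U) (hQ : 2 * Q ≤ X) {ℓ : ℝ}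
    (hℓ : ℓ = 4 + Real.log X) :
    ∑ i ∈ primSet D Q, psiI i N * (1 / ((i.1 : ℝ) + 1)) ≤
      2400 * ℓ ^ 7 * (X / D + X / √U + √X * Q + Q ^ 2 * U ^ 2) := by
  have hL : 0 ≤ Real.log X := Real.log_natCast_nonneg X
  have hℓ1 : 1 ≤ ℓ := by rw [hℓ]; linarith
  have hDR : (0 : ℝ) < D := by exact_mod_cast hD
  set T : ℝ := X / D + X / √U + √X * Q + Q ^ 2 * U ^ 2 with hT
  have hT0 : 0 ≤ T := by positivity
  have hmaps : ∀ i ∈ primSet D Q, Nat.log 2 i.1 ∈ Finset.range (Nat.log 2 Q + 1) := by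
    intro i hi
    rw [mem_primSet] at hi
    rw [Finset.mem_range]
    exact Nat.lt_succ_of_le (Nat.log_mono_right hi.1.2.le)
  rw [← Finset.sum_fiberwise_of_maps_to hmaps]
  calc _ ≤ ∑ r ∈ Finset.range (Nat.log 2 Q + 1), 1200 * ℓ ^ 6 * T := by
        refine Finset.sum_le_sum fun r _ => ?_
        rcases ((primSet D Q).filter (fun i => Nat.log 2 i.1 = r)).eq_empty_or_nonempty with h0 | ⟨i0, hi0⟩
        · rw [h0, Finset.sum_empty]; positivity
        have hlo : ∀ i ∈ (primSet D Q).filter (fun i => Nat.log 2 i.1 = r), 2 ^ r ≤ i.1 ∧ i.1 < 2 ^ (r + 1) := by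
          intro i hi
          rw [Finset.mem_filter, mem_primSet] at hi
          rw [← hi.2]
          exact ⟨Nat.pow_log_le_self 2 (by omega), Nat.lt_pow_succ_log_self (by norm_num) _⟩
        have hi0' := hlo i0 hi0
        rw [Finset.mem_filter, mem_primSet] at hi0
        have hr0 : (0 : ℝ) < 2 ^ r := by positivity
        have hDr : (D : ℝ) ≤ 2 * 2 ^ r := by
          have : D ≤ 2 * 2 ^ r := by have := hi0.1.1.1; rw [pow_succ] at hi0'; omega
          exact_mod_cast this
        have hQr' : 2 ^ r ≤ Q := hi0'.1.trans hi0.1.1.2.le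
        have hQr : (2 : ℝ) ^ r ≤ Q := by exact_mod_cast hQr'
        have hmv := mean_value_psi (2 ^ r) (2 ^ (r + 1)) N X U Nat.one_le_two_pow hN hX hU (by rw [pow_succ]; omega) hℓ
        calc _ ≤ ∑ i ∈ (primSet D Q).filter (fun i => Nat.log 2 i.1 = r), psiI i N * (1 / 2 ^ r) := by
              refine Finset.sum_le_sum fun i hi => ?_
              refine mul_le_mul_of_nonneg_left ?_ (psiI_nonneg i N)
              refine one_div_le_one_div_of_le hr0 ?_
              have : ((2 ^ r : ℕ) : ℝ) ≤ i.1 := by exact_mod_cast (hlo i hi).1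
              push_cast at this
              linarith
          _ ≤ ∑ i ∈ primSet (2 ^ r) (2 ^ (r + 1)), psiI i N * (1 / 2 ^ r) := by
              refine Finset.sum_le_sum_of_subset_of_nonneg ?_ fun i _ _ => mul_nonneg (psiI_nonneg i N) (by positivity)
              intro i hi
              have := hlo i hi
              rw [Finset.mem_filter, mem_primSet] at hi
              rw [mem_primSet]
              exact ⟨this, hi.1.2⟩
          _ = (∑ i ∈ primSet (2 ^ r) (2 ^ (r + 1)), psiI i N) * (1 / 2 ^ r) := by rw [Finset.sum_mul]
          _ ≤ (150 * ℓ ^ 6 * (X + (2 ^ (r + 1) : ℕ) * X / √U + √X * (2 ^ (r + 1) : ℕ) ^ 2 + (2 ^ (r + 1) : ℕ) ^ 3 * U ^ 2)) * (1 / 2 ^ r) :=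
              mul_le_mul_of_nonneg_right hmv (by positivity)
          _ = 150 * ℓ ^ 6 * (X / 2 ^ r + 2 * (X / √U) + 4 * (√X * 2 ^ r) + 8 * ((2 ^ r) ^ 2 * U ^ 2)) := by
              push_cast
              rw [pow_succ]
              field_simp
              ring
          _ ≤ 150 * ℓ ^ 6 * (8 * (X / D) + 8 * (X / √U) + 8 * (√X * Q) + 8 * (Q ^ 2 * U ^ 2)) := by
              refine mul_le_mul_of_nonneg_left ?_ (by positivity)
              have a1 : (X : ℝ) / 2 ^ r ≤ 8 * (X / D) := by
                have h1 : 0 ≤ (X : ℝ) / D := by positivity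
                have : (X : ℝ) / 2 ^ r ≤ 2 * (X / D) := by
                  rw [div_le_iff₀ hr0, mul_div_assoc', div_mul_eq_mul_div, le_div_iff₀ hDR]
                  have := mul_le_mul_of_nonneg_left hDr (show (0 : ℝ) ≤ X by positivity)
                  linarith
                linarith
              have a2 : 0 ≤ (X : ℝ) / √U := by positivity
              have a3 : √(X : ℝ) * 2 ^ r ≤ √X * Q := mul_le_mul_of_nonneg_left hQr (Real.sqrt_nonneg _)
              have a4 : 0 ≤ √(X : ℝ) * Q := by positivity
              have a5 : ((2 : ℝ) ^ r) ^ 2 * U ^ 2 ≤ Q ^ 2 * U ^ 2 := by gcongr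
              linarith
          _ = _ := by rw [hT]; ring
    _ = ((Nat.log 2 Q + 1 : ℕ) : ℝ) * (1200 * ℓ ^ 6 * T) := by simp
    _ ≤ (2 * ℓ) * (1200 * ℓ ^ 6 * T) := mul_le_mul_of_nonneg_right (nat_log_two_count hX (by omega) hℓ) (by positivity)
    _ = _ := by ring

theorem inv_totient_le (m : ℕ) (hm : 0 < m) : 1 / (m.totient : ℝ) ≤ 2 * (1 + Real.log m) * (1 / m) := by
  have hφ : (0 : ℝ) < m.totient := by exact_mod_cast Nat.totient_pos.2 hm
  have hmR : (0 : ℝ) < m := by exact_mod_cast hm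
  have := le_totient_mul m hm
  rw [div_le_iff₀ hφ, mul_one_div, div_mul_eq_mul_div, le_div_iff₀ hmR]
  linarith

theorem sum_inv_totient (Q X : ℕ) (hQ : Q ≤ X) (hX : 1 ≤ X) {ℓ : ℝ} (hℓ : ℓ = 4 + Real.log X) :
    ∑ m ∈ Finset.Ioc 0 Q, 1 / (m.totient : ℝ) ≤ 2 * ℓ ^ 2 := by
  have hL : 0 ≤ Real.log X := Real.log_natCast_nonneg X
  calc _ ≤ ∑ m ∈ Finset.Ioc 0 Q, 2 * ℓ * (1 / (m : ℝ)) := by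
        refine Finset.sum_le_sum fun m hm => ?_
        rw [Finset.mem_Ioc] at hm
        refine (inv_totient_le m hm.1).trans (mul_le_mul_of_nonneg_right ?_ (by positivity))
        have := nat_log_cast_le (hm.2.trans hQ) hX
        rw [hℓ]; linarith
    _ = 2 * ℓ * ∑ m ∈ Finset.Ioc 0 Q, (1 / (m : ℝ)) := by rw [Finset.mul_sum]
    _ ≤ 2 * ℓ * ℓ := by
        refine mul_le_mul_of_nonneg_left ?_ (by rw [hℓ]; linarith)
        have := nat_log_cast_le hQ hX
        have := harmonic_Ioc_le Q
        rw [hℓ]; linarith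
    _ = _ := by ring

theorem sum_inv_totient_multiples (Q d : ℕ) (hd : 0 < d) :
    ∑ q ∈ (Finset.Ioc 0 Q).filter (fun q => d ∣ q), 1 / (q.totient : ℝ) ≤ 1 / (d.totient : ℝ) * ∑ m ∈ Finset.Ioc 0 Q, 1 / (m.totient : ℝ) := by
  have hφd : (0 : ℝ) < d.totient := by exact_mod_cast Nat.totient_pos.2 hd
  rw [Finset.mul_sum]
  calc ∑ a ∈ (Finset.Ioc 0 Q).filter (fun a => d ∣ a), 1 / (a.totient : ℝ)
      ≤ ∑ a ∈ (Finset.Ioc 0 Q).image (fun b => d * b), 1 / (a.totient : ℝ) := by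
        refine Finset.sum_le_sum_of_subset_of_nonneg ?_ fun _ _ _ => by positivity
        intro a ha
        simp only [Finset.mem_filter, Finset.mem_Ioc] at ha
        obtain ⟨⟨h1, h2⟩, ⟨b, rfl⟩⟩ := ha
        rw [Finset.mem_image]
        refine ⟨b, ?_, rfl⟩
        rw [Finset.mem_Ioc]
        constructor
        · exact Nat.pos_of_mul_pos_left h1
        · exact le_trans (Nat.le_mul_of_pos_left b hd) h2
    _ = ∑ b ∈ Finset.Ioc 0 Q, 1 / ((d * b).totient : ℝ) := by
        rw [Finset.sum_image (fun a _ b _ h => Nat.eq_of_mul_eq_mul_left hd h)]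
    _ ≤ _ := by
        refine Finset.sum_le_sum fun b hb => ?_
        rw [Finset.mem_Ioc] at hb
        have hφb : (0 : ℝ) < b.totient := by exact_mod_cast Nat.totient_pos.2 hb.1
        rw [one_div_mul_one_div]
        refine one_div_le_one_div_of_le (by positivity) ?_
        exact_mod_cast Nat.totient_super_multiplicative d b

/-- sum over the grid -/
noncomputable def gridSum (X g : ℕ) (i : Σ k : ℕ, DirichletCharacter ℂ (k + 1)) : ℝ :=
  ∑ j ∈ Finset.range (X / g + 1), psiI i (g * j)

theorem gridSum_nonneg (X g : ℕ) (i : Σ k : ℕ, DirichletCharacter ℂ (k + 1)) : 0 ≤ gridSum X g i :=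
  Finset.sum_nonneg fun _ _ => psiI_nonneg _ _

theorem dPsi_bound (q a M X g D Q : ℕ) (hq : 0 < q) (ha : a.Coprime q) (hM : M ≤ X) (hqQ : q ≤ Q) {V : ℝ} (hV0 : 0 ≤ V)
    (hV : ∀ i ∈ primSet 1 D, (i.1 + 1) ∣ q → ∀ N ≤ X, psiI i N ≤ V) (hg : 0 < g) :
    |dPsi q a M| ≤ Real.log X * (g / q + 1 + g / q.totient) + (PP X + Real.log Q) +
      1 / (q.totient : ℝ) * (D ^ 2 * V + ∑ i ∈ (primSet D Q).filter (fun i => (i.1 + 1) ∣ q), gridSum X g i) := by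
  classical
  haveI : NeZero q := ⟨hq.ne'⟩
  set M' := g * (M / g) with hM'
  have h1 : M' ≤ M := Nat.mul_div_le M g
  have h2 : M ≤ M' + g := by
    have := Nat.div_add_mod M g
    have := Nat.mod_lt M hg
    omega
  have hgap := dPsi_gap q a M' M X g hq h1 hM h2
  have hd := delta_psi_bound q a M' ha
  have hW : WW q M' ≤ PP X + Real.log Q := by
    refine (WW_le q M' hq).trans (add_le_add (PP_mono (h1.trans hM)) (nat_log_cast_le hqQ (by omega)))
  have hs : ∑ i ∈ (primSet 1 q).filter (fun i => (i.1 + 1) ∣ q), psiI i M' ≤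
      D ^ 2 * V + ∑ i ∈ (primSet D Q).filter (fun i => (i.1 + 1) ∣ q), gridSum X g i := by
    calc _ ≤ ∑ i ∈ (primSet 1 D).filter (fun i => (i.1 + 1) ∣ q) ∪ (primSet D Q).filter (fun i => (i.1 + 1) ∣ q), psiI i M' := by
          refine Finset.sum_le_sum_of_subset_of_nonneg ?_ fun i _ _ => psiI_nonneg i _
          intro i hi
          rw [Finset.mem_filter, mem_primSet] at hi
          rw [Finset.mem_union, Finset.mem_filter, Finset.mem_filter, mem_primSet, mem_primSet]
          obtain ⟨⟨⟨b1, b2⟩, b3⟩, b4⟩ := hi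
          rcases lt_or_ge i.1 D with h | h
          · exact Or.inl ⟨⟨⟨b1, h⟩, b3⟩, b4⟩
          · exact Or.inr ⟨⟨⟨h, by omega⟩, b3⟩, b4⟩
      _ ≤ ∑ i ∈ (primSet 1 D).filter (fun i => (i.1 + 1) ∣ q), psiI i M' + ∑ i ∈ (primSet D Q).filter (fun i => (i.1 + 1) ∣ q), psiI i M' := by
          have e := Finset.sum_union_inter (s₁ := (primSet 1 D).filter (fun i => (i.1 + 1) ∣ q)) (s₂ := (primSet D Q).filter (fun i => (i.1 + 1) ∣ q)) (f := fun i => psiI i M')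
          have h0 : 0 ≤ ∑ i ∈ (primSet 1 D).filter (fun i => (i.1 + 1) ∣ q) ∩ (primSet D Q).filter (fun i => (i.1 + 1) ∣ q), psiI i M' :=
            Finset.sum_nonneg fun i _ => psiI_nonneg i _
          linarith
      _ ≤ _ := by
          refine add_le_add ?_ (Finset.sum_le_sum fun i _ => ?_)
          · calc _ ≤ ∑ i ∈ (primSet 1 D).filter (fun i => (i.1 + 1) ∣ q), V := by
                  refine Finset.sum_le_sum fun i hi => ?_
                  rw [Finset.mem_filter] at hi
                  exact hV i hi.1 hi.2 M' (h1.trans hM)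
              _ ≤ ∑ i ∈ primSet 1 D, V := Finset.sum_le_sum_of_subset_of_nonneg (Finset.filter_subset _ _) fun _ _ _ => hV0
              _ = (primSet 1 D).card * V := by simp
              _ ≤ _ := mul_le_mul_of_nonneg_right (card_primSet_le 1 D) hV0
          · exact Finset.single_le_sum (f := fun j => psiI i (g * j)) (fun j _ => psiI_nonneg i _)
              (Finset.mem_range.2 (Nat.lt_succ_of_le (Nat.div_le_div_right hM)))
  have hd' : |dPsi q a M'| ≤ (PP X + Real.log Q) + 1 / (q.totient : ℝ) * (D ^ 2 * V + ∑ i ∈ (primSet D Q).filter (fun i => (i.1 + 1) ∣ q), gridSum X g i) :=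
    le_trans hd (add_le_add hW (mul_le_mul_of_nonneg_left hs (by positivity)))
  have := abs_add_le (dPsi q a M - dPsi q a M') (dPsi q a M')
  rw [sub_add_cancel] at this
  linarith

theorem sum_Eerr_le (x : ℝ) (X Q D U g : ℕ) (hXx : X = ⌊x⌋₊) (hX : 1 ≤ X) (hQ : 2 * Q ≤ X) (hD : 1 ≤ D) (hU : 1 ≤ U) (hg : 0 < g)
    (S : Finset ℕ) (hS : ∀ q ∈ S, 0 < q ∧ q ≤ Q) {V : ℝ} (hV0 : 0 ≤ V)
    (hV : ∀ q ∈ S, ∀ i ∈ primSet 1 D, (i.1 + 1) ∣ q → ∀ N ≤ X, psiI i N ≤ V) {ℓ : ℝ} (hℓ : ℓ = 4 + Real.log X) :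
    ∑ q ∈ S, Eerr x q ≤ 60000 * ℓ ^ 10 * (Q * √X + g + D ^ 2 * V +
      (X / g + 1 : ℕ) * (X / D + X / √U + √X * Q + Q ^ 2 * U ^ 2)) := by
  classical
  have hL : 0 ≤ Real.log X := Real.log_natCast_nonneg X
  have hℓ1 : 1 ≤ ℓ := by rw [hℓ]; linarith
  have hQX : Q ≤ X := by omega
  set T : ℝ := X / D + X / √U + √X * Q + Q ^ 2 * U ^ 2 with hT
  have hT0 : 0 ≤ T := by positivity
  have hPP := PP_nonneg X
  have hPP1 := PP_le X hX
  have hlQ : Real.log Q ≤ Real.log X := nat_log_cast_le hQX hX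
  have hlQ0 : 0 ≤ Real.log Q := Real.log_natCast_nonneg Q
  have hsX : 1 ≤ √(X : ℝ) := by rw [Real.one_le_sqrt]; exact_mod_cast hX
  set Gq : ℕ → ℝ := fun q => ∑ i ∈ (primSet D Q).filter (fun i => (i.1 + 1) ∣ q), gridSum X g i with hGq
  have hGq0 : ∀ q, 0 ≤ Gq q := fun q => Finset.sum_nonneg fun i _ => gridSum_nonneg _ _ _
  have hper : ∀ q ∈ S, Eerr x q ≤ 6 * (6 * √X * ℓ + (2 * ℓ * g + D ^ 2 * V) * (1 / (q.totient : ℝ)) + 1 / (q.totient : ℝ) * Gq q) := by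
    intro q hq
    obtain ⟨hq0, hqQ⟩ := hS q hq
    have hφ : (0 : ℝ) < q.totient := by exact_mod_cast Nat.totient_pos.2 hq0
    have hφq : (q.totient : ℝ) ≤ q := by exact_mod_cast Nat.totient_le q
    have hB0 : 0 ≤ Real.log X * (g / q + 1 + g / q.totient) + (PP X + Real.log Q) +
      1 / (q.totient : ℝ) * (D ^ 2 * V + Gq q) := by
      have := hGq0 q
      positivity
    have h := Eerr_le x q hq0 hB0 (fun a M ha hM => dPsi_bound q a M X g D Q hq0 ha (hXx ▸ hM) hqQ hV0 (hV q hq) hg)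
    rw [← hXx] at h
    refine h.trans (mul_le_mul_of_nonneg_left ?_ (by norm_num))
    have e1 : Real.log X * (g / q + 1 + g / q.totient) ≤ ℓ + 2 * ℓ * g * (1 / (q.totient : ℝ)) := by
      have : (g : ℝ) / q ≤ g / q.totient := div_le_div_of_nonneg_left (by positivity) hφ hφq
      calc _ ≤ ℓ * (1 + 2 * (g / q.totient)) := by
            refine mul_le_mul (by rw [hℓ]; linarith) (by linarith) (by positivity) (by linarith)
        _ = _ := by ring
    have e2 : ℓ ≤ √X * ℓ := le_mul_of_one_le_left (by linarith) hsX
    have e3 : Real.log Q ≤ √X * ℓ := by refine le_trans ?_ e2; rw [hℓ]; linarith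
    have e4 : PP X ≤ 2 * (√X * ℓ) := by
      refine hPP1.trans ?_
      have : √(X : ℝ) * Real.log X ≤ √X * ℓ := mul_le_mul_of_nonneg_left (by rw [hℓ]; linarith) (by linarith)
      linarith
    linarith
  have hsub : S ⊆ Finset.Ioc 0 Q := by
    intro q hq
    rw [Finset.mem_Ioc]
    exact hS q hq
  have hΦ := sum_inv_totient Q X hQX hX hℓ
  have hΦ0 : 0 ≤ ∑ m ∈ Finset.Ioc 0 Q, 1 / (m.totient : ℝ) := Finset.sum_nonneg fun _ _ => by positivity
  have hcard : (S.card : ℝ) ≤ Q := by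
    have := Finset.card_le_card hsub
    rw [Nat.card_Ioc, Nat.sub_zero] at this
    exact_mod_cast this
  have hφS : ∑ q ∈ S, 1 / (q.totient : ℝ) ≤ 2 * ℓ ^ 2 :=
    (Finset.sum_le_sum_of_subset_of_nonneg hsub fun _ _ _ => by positivity).trans hΦ
  have hlarge : ∑ q ∈ S, 1 / (q.totient : ℝ) * Gq q ≤ 9600 * ℓ ^ 10 * ((X / g + 1 : ℕ) * T) := by
    calc _ ≤ ∑ q ∈ Finset.Ioc 0 Q, 1 / (q.totient : ℝ) * Gq q :=
          Finset.sum_le_sum_of_subset_of_nonneg hsub fun q _ _ => mul_nonneg (by positivity) (hGq0 q)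
      _ = ∑ q ∈ Finset.Ioc 0 Q, ∑ i ∈ primSet D Q, (if (i.1 + 1) ∣ q then 1 / (q.totient : ℝ) else 0) * gridSum X g i := by
          refine Finset.sum_congr rfl fun q _ => ?_
          simp only [hGq]
          rw [Finset.mul_sum, Finset.sum_filter]
          refine Finset.sum_congr rfl fun i _ => ?_
          split_ifs <;> ring
      _ = ∑ i ∈ primSet D Q, (∑ q ∈ (Finset.Ioc 0 Q).filter (fun q => (i.1 + 1) ∣ q), 1 / (q.totient : ℝ)) * gridSum X g i := by
          rw [Finset.sum_comm]
          refine Finset.sum_congr rfl fun i _ => ?_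
          rw [Finset.sum_filter, Finset.sum_mul]
      _ ≤ ∑ i ∈ primSet D Q, (4 * ℓ ^ 3 * (1 / ((i.1 : ℝ) + 1))) * gridSum X g i := by
          refine Finset.sum_le_sum fun i hi => ?_
          refine mul_le_mul_of_nonneg_right ?_ (gridSum_nonneg _ _ _)
          rw [mem_primSet] at hi
          have hiX : i.1 + 1 ≤ X := by omega
          have hl := nat_log_cast_le hiX hX
          calc _ ≤ _ := sum_inv_totient_multiples Q (i.1 + 1) (Nat.succ_pos _)
            _ ≤ (2 * ℓ * (1 / ((i.1 : ℝ) + 1))) * (2 * ℓ ^ 2) := by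
                refine mul_le_mul ?_ hΦ hΦ0 (by positivity)
                refine (inv_totient_le _ (Nat.succ_pos _)).trans ?_
                push_cast at hl ⊢
                refine mul_le_mul_of_nonneg_right ?_ (by positivity)
                rw [hℓ]; linarith
            _ = _ := by ring
      _ = 4 * ℓ ^ 3 * ∑ j ∈ Finset.range (X / g + 1), ∑ i ∈ primSet D Q, psiI i (g * j) * (1 / ((i.1 : ℝ) + 1)) := by
          rw [Finset.sum_comm, Finset.mul_sum]
          refine Finset.sum_congr rfl fun i _ => ?_
          rw [gridSum, Finset.mul_sum, Finset.mul_sum]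
          refine Finset.sum_congr rfl fun j _ => by ring
      _ ≤ 4 * ℓ ^ 3 * ∑ j ∈ Finset.range (X / g + 1), 2400 * ℓ ^ 7 * T := by
          refine mul_le_mul_of_nonneg_left (Finset.sum_le_sum fun j hj => ?_) (by positivity)
          rw [Finset.mem_range] at hj
          refine dyadic_mean D Q (g * j) X U hD ?_ hX hU hQ hℓ
          exact (Nat.mul_le_mul_left g (Nat.le_of_lt_succ hj)).trans (Nat.mul_div_le X g)
      _ = _ := by rw [Finset.sum_const, Finset.card_range, nsmul_eq_mul]; ring
  calc ∑ q ∈ S, Eerr x q ≤ ∑ q ∈ S, 6 * (6 * √X * ℓ + (2 * ℓ * g + D ^ 2 * V) * (1 / (q.totient : ℝ)) + 1 / (q.totient : ℝ) * Gq q) := Finset.sum_le_sum hper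
    _ = 6 * (S.card * (6 * √X * ℓ) + (2 * ℓ * g + D ^ 2 * V) * ∑ q ∈ S, 1 / (q.totient : ℝ) + ∑ q ∈ S, 1 / (q.totient : ℝ) * Gq q) := by
        rw [← Finset.mul_sum, Finset.sum_add_distrib, Finset.sum_add_distrib, Finset.sum_const, nsmul_eq_mul, Finset.mul_sum S (fun q : ℕ => 1 / (q.totient : ℝ)) (2 * ℓ * g + D ^ 2 * V)]
    _ ≤ 6 * (Q * (6 * √X * ℓ) + (2 * ℓ * g + D ^ 2 * V) * (2 * ℓ ^ 2) + 9600 * ℓ ^ 10 * ((X / g + 1 : ℕ) * T)) := by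
        refine mul_le_mul_of_nonneg_left (add_le_add (add_le_add ?_ ?_) hlarge) (by norm_num)
        · exact mul_le_mul_of_nonneg_right hcard (by positivity)
        · exact mul_le_mul_of_nonneg_left hφS (by positivity)
    _ ≤ _ := by
        have p1 : ℓ ≤ ℓ ^ 10 := le_self_pow₀ hℓ1 (by norm_num)
        have p2 : ℓ ^ 2 ≤ ℓ ^ 10 := pow_le_pow_right₀ hℓ1 (by norm_num)
        have p3 : ℓ ^ 3 ≤ ℓ ^ 10 := pow_le_pow_right₀ hℓ1 (by norm_num)
        have q1 := mul_le_mul_of_nonneg_left p1 (show 0 ≤ (Q : ℝ) * √X by positivity)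
        have q2 := mul_le_mul_of_nonneg_left p2 (show 0 ≤ (D : ℝ) ^ 2 * V by positivity)
        have q3 := mul_le_mul_of_nonneg_left p3 (show 0 ≤ (g : ℝ) by positivity)
        have r1 : 0 ≤ ℓ ^ 10 * (Q * √X) := by positivity
        have r2 : 0 ≤ ℓ ^ 10 * ((D : ℝ) ^ 2 * V) := by positivity
        have r3 : 0 ≤ ℓ ^ 10 * (g : ℝ) := by positivity
        have r4 : 0 ≤ ℓ ^ 10 * ((X / g + 1 : ℕ) * T) := by positivity
        linarith

open Complex Filter Topology

theorem ceil_le_two_mul {y : ℝ} (hy : 1 ≤ y) : ((⌈y⌉₊ : ℕ) : ℝ) ≤ 2 * y := by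
  have := Nat.ceil_lt_add_one (zero_le_one.trans hy)
  linarith

/-- the numerical optimisation at the end of the proof, with `A = exp (η l)` -/
theorem param_ineq {x A Q sX X D U sU g V m H : ℝ} (hA : 1 ≤ A) (hx : 0 < x)
    (hm1 : m ≤ 2 * A)
    (h1 : Q * sX ≤ 2 * x / A ^ 2) (h2 : g ≤ 2 * x / A) (h3 : D ^ 2 * V ≤ 4 * x / A)
    (h4 : X / D ≤ x / A ^ 2) (h5 : X / sU ≤ x / A ^ 2) (h6 : Q ^ 2 * U ^ 2 ≤ 16 * x / A ^ 2)
    (hH : H = X / D + X / sU + sX * Q + Q ^ 2 * U ^ 2) (hH0 : 0 ≤ H) :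
    Q * sX + g + D ^ 2 * V + m * H ≤ 48 * x / A := by
  have hA0 : 0 < A := by linarith
  have e : H ≤ 20 * (x / A ^ 2) := by
    have h1' : Q * sX ≤ 2 * (x / A ^ 2) := by rw [← mul_div_assoc]; exact h1
    have h6' : Q ^ 2 * U ^ 2 ≤ 16 * (x / A ^ 2) := by rw [← mul_div_assoc]; exact h6
    rw [hH, mul_comm sX Q]; linarith
  have e2 : m * H ≤ 40 * (x / A) := by
    calc m * H ≤ (2 * A) * (20 * (x / A ^ 2)) := mul_le_mul hm1 e hH0 (by positivity)
      _ = 40 * (x / A) := by field_simp; ring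
  have e3 : 2 * x / A ^ 2 ≤ 2 * (x / A) := by
    rw [← mul_div_assoc]
    exact div_le_div_of_nonneg_left (by positivity) hA0 (by nlinarith)
  have e4 : 2 * x / A = 2 * (x / A) := by ring
  have e5 : 4 * x / A = 4 * (x / A) := by ring
  have e6 : 48 * x / A = 48 * (x / A) := by ring
  rw [e4] at h2; rw [e5] at h3; rw [e6]
  linarith

theorem psiI_le_of_good {l : ℝ} (p0 : ℕ) {V : ℝ}
    (hps : ∀ (q : ℕ) [NeZero q] (χ : DirichletCharacter ℂ q), (q : ℝ) ≤ Real.exp l → Nat.Coprime q p0 →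
      χ.IsPrimitive → χ ≠ 1 → ∀ N : ℕ, (N : ℝ) ≤ Real.exp (l ^ 2) →
      ‖∑ n ∈ Finset.range (N + 1), χ n * ((ArithmeticFunction.vonMangoldt n : ℝ) : ℂ)‖ ≤ V)
    {D X q : ℕ} (hD : (D : ℝ) ≤ Real.exp l) (hX : (X : ℝ) ≤ Real.exp (l ^ 2)) (hq : Nat.gcd q p0 = 1) :
    ∀ i ∈ primSet 1 D, (i.1 + 1) ∣ q → ∀ N ≤ X, psiI i N ≤ V := by
  intro i hi hdvd N hN
  rw [mem_primSet] at hi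
  have h := hps (i.1 + 1) i.2 ?_ (Nat.Coprime.coprime_dvd_left hdvd hq) hi.2 (prim_ne_one hi.2 hi.1.1) N ?_
  · rw [psiI, sum_Ioc_eq_range (fun n => ((ArithmeticFunction.vonMangoldt n : ℝ) : ℂ) * pEval i n) (by simp)]
    refine le_trans (le_of_eq ?_) h
    congr 1
    refine Finset.sum_congr rfl fun n _ => ?_
    rw [pEval, mul_comm]
  · refine le_trans ?_ hD
    exact_mod_cast hi.1.2
  · exact le_trans (by exact_mod_cast hN) hX

theorem pow_ten_le {η : ℝ} (hη : 0 < η) : ∃ K : ℝ, 0 < K ∧ ∀ {l y : ℝ}, 3 ≤ l → 0 ≤ y → y ≤ l ^ 2 →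
    (4 + y) ^ 10 ≤ K * Real.exp (η / 2 * l) := by
  obtain ⟨k, hk⟩ : ∃ k : ℕ, k = 20 := ⟨20, rfl⟩
  refine ⟨5 ^ 10 * ((k.factorial : ℝ) * (2 / η) ^ k), by positivity, fun {l y} hl hy hyl => ?_⟩
  have hl0 : 0 < l := by linarith
  have h1 : 4 + y ≤ 5 * l ^ 2 := by nlinarith
  have h2 : (5 * l ^ 2) ^ 10 = 5 ^ 10 * l ^ k := by rw [hk, mul_pow, ← pow_mul]
  have h3 := Real.pow_div_factorial_le_exp (η / 2 * l) (by positivity) k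
  rw [div_le_iff₀ (by positivity)] at h3
  calc (4 + y) ^ 10 ≤ (5 * l ^ 2) ^ 10 := pow_le_pow_left₀ (by linarith) h1 10
    _ = 5 ^ 10 * ((2 / η) ^ k * (η / 2 * l) ^ k) := by
        rw [h2, ← mul_pow, show 2 / η * (η / 2 * l) = l by field_simp]
    _ ≤ 5 ^ 10 * ((2 / η) ^ k * (Real.exp (η / 2 * l) * k.factorial)) := by
        refine mul_le_mul_of_nonneg_left (mul_le_mul_of_nonneg_left h3 (by positivity)) (by positivity)
    _ = _ := by ring

set_option maxHeartbeats 1000000 in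
theorem bv_large {κ : ℝ} (hκ0 : 0 < κ) (hκ1 : κ ≤ 1 / 100) :
    ∃ C : ℝ, 0 < C ∧ ∀ ε : ℝ, 0 < ε → ε ≤ 1 / 4 → ∃ l₃ : ℝ, 1 ≤ l₃ ∧ ∀ l : ℝ, l₃ ≤ l →
      ∀ p0 : ℕ, GoodMod κ l p0 → ∀ S : Finset ℕ,
      (∀ q ∈ S, 0 < q ∧ (q : ℝ) < Real.exp ((1 / 2 - ε) * l ^ 2) ∧ Nat.gcd q p0 = 1) →
      ∑ q ∈ S, Eerr (Real.exp (l ^ 2)) q ≤ C * Real.exp (l ^ 2) * Real.exp (-(κ / 80) * l) := by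
  obtain ⟨l₂, hl₂, hpsi⟩ := psi_small hκ0 hκ1
  set η : ℝ := κ / 40 with hη
  have hη0 : 0 < η := by positivity
  have hη1 : η ≤ 1 / 4000 := by rw [hη]; linarith
  obtain ⟨K, hK0, hK⟩ := pow_ten_le hη0
  refine ⟨60000 * 48 * K, by positivity, fun ε hε hε1 => ?_⟩
  refine ⟨max (max l₂ 3) (1 / ε), le_max_of_le_left (le_max_of_le_left hl₂), fun l hl p0 hgood S hS => ?_⟩
  have hl2 : l₂ ≤ l := (le_max_left _ _).trans ((le_max_left _ _).trans hl)
  have hl3 : 3 ≤ l := (le_max_right _ _).trans ((le_max_left _ _).trans hl)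
  have hlε : 1 ≤ ε * l := by
    have := (le_max_right _ _).trans hl
    rw [div_le_iff₀ hε] at this; linarith
  have hl0 : 0 < l := by linarith
  have hεll : l ≤ ε * l ^ 2 := by nlinarith
  have hηl : 0 ≤ η * l := by positivity
  have hηl' : η * l ≤ l / 4000 := by nlinarith
  have hll : 3 * l ≤ l ^ 2 := by nlinarith
  set x := Real.exp (l ^ 2) with hx
  have hx0 : 0 < x := Real.exp_pos _
  set A := Real.exp (η * l) with hA
  have hA1 : 1 ≤ A := Real.one_le_exp hηl
  have hA0 : 0 < A := by linarith
  have hA2 : x / A ^ 2 = Real.exp (l ^ 2 - 2 * (η * l)) := by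
    rw [hx, hA, ← Real.exp_nat_mul, ← Real.exp_sub]; norm_num
  have hAinv : x / A = Real.exp (l ^ 2 - η * l) := by
    rw [hx, hA, ← Real.exp_sub]
  have exp2 : (2 : ℝ) ≤ Real.exp 1 := by linarith [Real.add_one_le_exp (1 : ℝ)]
  have exp8 : (8 : ℝ) ≤ Real.exp 3 := by
    calc (8 : ℝ) = 2 ^ 3 := by norm_num
      _ ≤ Real.exp 1 ^ 3 := by gcongr
      _ = Real.exp 3 := by rw [← Real.exp_nat_mul]; norm_num
  set X := ⌊x⌋₊ with hXdef
  set yQ := Real.exp ((1 / 2 - ε) * l ^ 2) with hyQ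
  set yU := Real.exp (ε / 2 * l ^ 2) with hyU
  set yD := Real.exp (2 * (η * l)) with hyD
  set yg := Real.exp (l ^ 2 - η * l) with hyg
  have hyQ1 : 1 ≤ yQ := Real.one_le_exp (mul_nonneg (by linarith) (by positivity))
  have hyU1 : 1 ≤ yU := Real.one_le_exp (by positivity)
  have hyD1 : 1 ≤ yD := Real.one_le_exp (by positivity)
  have hyg1 : 1 ≤ yg := Real.one_le_exp (by linarith)
  have hx8 : 8 ≤ x := exp8.trans (Real.exp_le_exp.2 (by linarith))
  have hXx : (X : ℝ) ≤ x := Nat.floor_le hx0.le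
  have hXx' : x / 2 ≤ X := by
    have := Nat.lt_floor_add_one x
    linarith
  have hX1 : 1 ≤ X := by
    have : (1 : ℝ) ≤ X := by linarith
    exact_mod_cast this
  have hQ2 := ceil_le_two_mul hyQ1
  have hU2 := ceil_le_two_mul hyU1
  have hD2 := ceil_le_two_mul hyD1
  have hg2 := ceil_le_two_mul hyg1
  have hQ1 := Nat.le_ceil yQ
  have hU1 := Nat.le_ceil yU
  have hD1 := Nat.le_ceil yD
  have hg1 := Nat.le_ceil yg
  set Q := ⌈yQ⌉₊ with hQ
  set U := ⌈yU⌉₊ with hU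
  set D := ⌈yD⌉₊ with hD
  set g := ⌈yg⌉₊ with hg
  have hQX : 2 * Q ≤ X := by
    have h : 8 * yQ ≤ x := by
      calc 8 * yQ ≤ Real.exp 3 * yQ := by gcongr
        _ = Real.exp (3 + (1 / 2 - ε) * l ^ 2) := by rw [hyQ, ← Real.exp_add]
        _ ≤ x := Real.exp_le_exp.2 (by nlinarith)
    have : (2 : ℝ) * Q ≤ X := by linarith
    exact_mod_cast this
  have hDe : (D : ℝ) ≤ Real.exp l := by
    calc (D : ℝ) ≤ 2 * yD := hD2
      _ ≤ Real.exp 1 * yD := by gcongr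
      _ = Real.exp (1 + 2 * (η * l)) := by rw [hyD, ← Real.exp_add]
      _ ≤ _ := Real.exp_le_exp.2 (by linarith)
  set V := Real.exp (l ^ 2 - κ / 8 * l) with hV
  have hmain := sum_Eerr_le x X Q D U g hXdef hX1 hQX (Nat.ceil_pos.2 (by linarith)) (Nat.ceil_pos.2 (by linarith))
    (Nat.ceil_pos.2 (by linarith)) S (fun q hq => ⟨(hS q hq).1, by
      have := ((hS q hq).2.1.le.trans hQ1)
      exact_mod_cast this⟩) (Real.exp_pos _).le
    (fun q hq => psiI_le_of_good (V := V) p0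
      (fun q' _ χ h1 h2 h3 h4 => hpsi l hl2 p0 hgood q' χ h1 h2 h3 h4) hDe hXx (hS q hq).2.2) rfl
  have hsX : √(X : ℝ) ≤ Real.exp (l ^ 2 / 2) := by
    refine (Real.sqrt_le_sqrt hXx).trans (le_of_eq ?_)
    rw [hx, Real.exp_half]
  have hsU : Real.exp (ε / 4 * l ^ 2) ≤ √(U : ℝ) := by
    refine le_trans (le_of_eq ?_) (Real.sqrt_le_sqrt hU1)
    rw [hyU, ← Real.exp_half]; congr 1; ring
  have hsX0 : 0 ≤ √(X : ℝ) := Real.sqrt_nonneg _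
  have hXg : ((X / g : ℕ) : ℝ) ≤ A := by
    refine Nat.cast_div_le.trans ?_
    calc (X : ℝ) / g ≤ x / yg := div_le_div₀ hx0.le hXx (by linarith) hg1
      _ = A := by rw [← hAinv]; field_simp
  have hpar := param_ineq (x := x) (A := A) (Q := (Q : ℝ)) (sX := √(X : ℝ)) (X := (X : ℝ)) (D := (D : ℝ)) (U := (U : ℝ))
    (sU := √(U : ℝ)) (g := (g : ℝ)) (V := V) (m := ((X / g + 1 : ℕ) : ℝ)) hA1 hx0
    (by push_cast; linarith) ?_ ?_ ?_ ?_ ?_ ?_ rfl (by positivity)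
  · have hlogX : Real.log X ≤ l ^ 2 := by
      rw [← Real.log_exp (l ^ 2)]
      exact Real.log_le_log (by exact_mod_cast hX1) hXx
    have hlogX0 : 0 ≤ Real.log X := Real.log_natCast_nonneg X
    have hl10 := hK hl3 hlogX0 hlogX
    calc _ ≤ _ := hmain
      _ ≤ 60000 * (K * Real.exp (η / 2 * l)) * (48 * x / A) := by
          refine mul_le_mul ?_ hpar (by positivity) (by positivity)
          exact mul_le_mul_of_nonneg_left hl10 (by norm_num)
      _ = 60000 * 48 * K * x * (Real.exp (η / 2 * l) / A) := by ring
      _ = _ := by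
          rw [hA, ← Real.exp_sub]
          congr 2
          rw [hη]; ring
  · calc (Q : ℝ) * √X ≤ (2 * yQ) * Real.exp (l ^ 2 / 2) := mul_le_mul hQ2 hsX hsX0 (by positivity)
      _ = 2 * Real.exp ((1 / 2 - ε) * l ^ 2 + l ^ 2 / 2) := by rw [hyQ, Real.exp_add]; ring
      _ ≤ 2 * Real.exp (l ^ 2 - 2 * (η * l)) := by
          refine mul_le_mul_of_nonneg_left (Real.exp_le_exp.2 ?_) (by norm_num)
          linarith
      _ = _ := by rw [← hA2]; ring
  · rw [mul_div_assoc, hAinv]; exact hg2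
  · calc (D : ℝ) ^ 2 * V ≤ (2 * yD) ^ 2 * V := by gcongr
      _ = 4 * Real.exp (2 * (2 * (η * l)) + (l ^ 2 - κ / 8 * l)) := by
          rw [Real.exp_add, hyD, hV, mul_pow, ← Real.exp_nat_mul]; norm_num; ring
      _ = _ := by
          rw [mul_div_assoc, hAinv]
          congr 2
          rw [hη]; ring
  · calc (X : ℝ) / D ≤ x / yD := div_le_div₀ hx0.le hXx (by linarith) hD1
      _ = _ := by rw [hA2, hx, hyD, ← Real.exp_sub]
  · calc (X : ℝ) / √U ≤ x / Real.exp (ε / 4 * l ^ 2) := div_le_div₀ hx0.le hXx (Real.exp_pos _) hsU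
      _ = Real.exp (l ^ 2 - ε / 4 * l ^ 2) := by rw [hx, ← Real.exp_sub]
      _ ≤ _ := by
          rw [hA2]
          refine Real.exp_le_exp.2 ?_
          linarith
  · calc (Q : ℝ) ^ 2 * U ^ 2 ≤ (2 * yQ) ^ 2 * (2 * yU) ^ 2 := by gcongr
      _ = 16 * Real.exp (2 * ((1 / 2 - ε) * l ^ 2) + 2 * (ε / 2 * l ^ 2)) := by
          rw [Real.exp_add, hyQ, hyU, mul_pow, mul_pow, ← Real.exp_nat_mul, ← Real.exp_nat_mul]; norm_num; ring
      _ ≤ 16 * Real.exp (l ^ 2 - 2 * (η * l)) := by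
          refine mul_le_mul_of_nonneg_left (Real.exp_le_exp.2 ?_) (by norm_num)
          linarith
      _ = _ := by rw [← hA2]; ring

theorem Eerr_nonneg (x : ℝ) (q : ℕ) : 0 ≤ Eerr x q := by
  refine Real.sSup_nonneg ?_
  rintro r ⟨a, x', -, -, rfl⟩
  exact abs_nonneg _

theorem Eerr_trivial (x : ℝ) (hx : 0 ≤ x) (q : ℕ) : Eerr x q ≤ 2 * x := by
  have key : ∀ x' : ℝ, x' ≤ x → (piR x' : ℝ) ≤ x ∧ ∀ a, (piAP x' q a : ℝ) ≤ piR x' := by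
    intro x' hx'
    have hfin : {p : ℕ | p.Prime ∧ (p : ℝ) ≤ x'} ⊆ (Finset.Ioc 0 ⌊x⌋₊ : Finset ℕ) := by
      rintro p ⟨hp, hpx⟩
      simp only [Finset.coe_Ioc, Set.mem_Ioc]
      exact ⟨hp.pos, Nat.le_floor (hpx.trans hx')⟩
    constructor
    · have h1 := Set.ncard_le_ncard hfin (Finset.finite_toSet _)
      rw [Set.ncard_coe_finset, Nat.card_Ioc, Nat.sub_zero] at h1
      exact le_trans (by exact_mod_cast h1) (Nat.floor_le hx)
    · intro a
      have h1 : piAP x' q a ≤ piR x' := by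
        refine Set.ncard_le_ncard ?_ ((Finset.finite_toSet _).subset hfin)
        rintro p ⟨h1, h2, -⟩
        exact ⟨h1, h2⟩
      exact_mod_cast h1
  refine Real.sSup_le ?_ (by positivity)
  rintro r ⟨a, x', -, hx', rfl⟩
  obtain ⟨h1, h2⟩ := key x' hx'
  have h3 := h2 a
  have h4 : (piR x' : ℝ) / (q.totient : ℝ) ≤ piR x' := by
    rcases Nat.eq_zero_or_pos q.totient with h | h
    · rw [h]; simp
    · exact div_le_self (Nat.cast_nonneg _) (by exact_mod_cast h)
  have h5 : 0 ≤ (piR x' : ℝ) / (q.totient : ℝ) := by positivity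
  have h6 : (0 : ℝ) ≤ piAP x' q a := Nat.cast_nonneg _
  rw [abs_le]; constructor <;> linarith

theorem bombieri_vinogradov_avoiding_one_prime :
    ∃ c0 : ℝ, 0 < c0 ∧ ∀ ε : ℝ, 0 < ε → ∃ C : ℝ, 0 < C ∧
      ∀ x : ℝ, 10 < x → ∃ p0 : ℕ, p0.Prime ∧
        Real.log (Real.log x) / 2 ≤ (p0 : ℝ) ∧ (p0 : ℝ) ≤ x ∧
        ∑ q ∈ (Finset.range (⌈x⌉₊ + 1)).filter
            (fun q : ℕ => (q : ℝ) < x ^ ((1 : ℝ) / 2 - ε) ∧ Nat.gcd q p0 = 1),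
          Eerr x q ≤ C * x * Real.exp (-c0 * Real.sqrt (Real.log x)) := by
  obtain ⟨κ, hκ0, hκ1, l₁, hl₁, hp0⟩ := exists_p0
  obtain ⟨C₁, hC₁, hbig⟩ := bv_large hκ0 hκ1
  refine ⟨κ / 80, by positivity, fun ε hε => ?_⟩
  obtain ⟨l₃, hl₃, hbig⟩ := hbig (min ε (1 / 4)) (lt_min hε (by norm_num)) (min_le_right _ _)
  set L := max l₁ l₃ with hL
  have hL1 : 1 ≤ L := hl₁.trans (le_max_left _ _)
  set x₀ := Real.exp (L ^ 2) with hx₀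
  set C₂ : ℝ := (x₀ + 2) * 2 * Real.exp (κ / 80 * L) with hC₂
  have hC₂0 : 0 < C₂ := by positivity
  refine ⟨C₁ + C₂, by positivity, fun x hx => ?_⟩
  have hx0 : 0 < x := by linarith
  have hlog0 : 0 < Real.log x := Real.log_pos (by linarith)
  set l := √(Real.log x) with hl
  have hl0 : 0 < l := Real.sqrt_pos.2 hlog0
  have hlsq : l ^ 2 = Real.log x := Real.sq_sqrt hlog0.le
  have hxl : x = Real.exp (l ^ 2) := by rw [hlsq, Real.exp_log hx0]
  have hE : 0 < Real.exp (-(κ / 80) * l) := Real.exp_pos _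
  rcases le_or_gt L l with hLl | hLl
  · obtain ⟨p0, hp, h1, h2, hgood⟩ := hp0 l ((le_max_left _ _).trans hLl)
    have hl1 : 1 ≤ l := hL1.trans hLl
    refine ⟨p0, hp, ?_, ?_, ?_⟩
    · rw [← hlsq, Real.log_pow]
      push_cast
      linarith
    · rw [hxl]
      exact h2.trans (Real.exp_le_exp.2 (by nlinarith))
    · have h := hbig l ((le_max_right _ _).trans hLl) p0 hgood ((Finset.range (⌈x⌉₊ + 1)).filter
            (fun q : ℕ => (q : ℝ) < x ^ ((1 : ℝ) / 2 - ε) ∧ Nat.gcd q p0 = 1)) ?_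
      · rw [← hxl] at h
        refine h.trans ?_
        have : 0 ≤ C₂ * x * Real.exp (-(κ / 80) * l) := by positivity
        linarith
      · intro q hq
        rw [Finset.mem_filter] at hq
        refine ⟨?_, ?_, hq.2.2⟩
        · rcases Nat.eq_zero_or_pos q with h | h
          · exfalso
            have := hq.2.2
            rw [h, Nat.gcd_zero_left] at this
            exact hp.one_lt.ne' this
          · exact h
        · refine hq.2.1.trans_le ?_
          rw [Real.rpow_def_of_pos hx0, ← hlsq]
          refine Real.exp_le_exp.2 ?_
          rw [mul_comm]
          refine mul_le_mul_of_nonneg_right ?_ (by positivity)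
          linarith [min_le_left ε (1 / 4)]
  · obtain ⟨p0, hp, h1, h2⟩ := Nat.exists_prime_lt_and_le_two_mul ⌊x / 2⌋₊ (Nat.floor_pos.2 (by linarith)).ne'
    have hxx₀ : x ≤ x₀ := by
      rw [hxl, hx₀]
      exact Real.exp_le_exp.2 (pow_le_pow_left₀ hl0.le hLl.le 2)
    have hfl := Nat.floor_le (show 0 ≤ x / 2 by linarith)
    have hp1 : x / 2 < p0 := (Nat.lt_floor_add_one _).trans_le (by exact_mod_cast h1)
    refine ⟨p0, hp, ?_, ?_, ?_⟩
    · have a1 := Real.log_le_sub_one_of_pos hx0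
      have a2 := Real.log_le_sub_one_of_pos hlog0
      linarith
    · have : (p0 : ℝ) ≤ 2 * (⌊x / 2⌋₊ : ℝ) := by exact_mod_cast h2
      linarith
    · have hceil := Nat.ceil_lt_add_one hx0.le
      calc _ ≤ ∑ q ∈ Finset.range (⌈x⌉₊ + 1), Eerr x q :=
            Finset.sum_le_sum_of_subset_of_nonneg (Finset.filter_subset _ _) fun _ _ _ => Eerr_nonneg _ _
        _ ≤ ∑ q ∈ Finset.range (⌈x⌉₊ + 1), 2 * x := Finset.sum_le_sum fun q _ => Eerr_trivial x hx0.le q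
        _ = (⌈x⌉₊ + 1) * (2 * x) := by rw [Finset.sum_const, Finset.card_range, nsmul_eq_mul]; push_cast; ring
        _ ≤ (x₀ + 2) * (2 * x) := mul_le_mul_of_nonneg_right (by linarith) (by positivity)
        _ = (x₀ + 2) * 2 * x * 1 := by ring
        _ ≤ (x₀ + 2) * 2 * x * Real.exp (κ / 80 * L + -(κ / 80) * l) := by
            refine mul_le_mul_of_nonneg_left (Real.one_le_exp ?_) (by positivity)
            have := mul_le_mul_of_nonneg_left hLl.le (show 0 ≤ κ / 80 by positivity)
            linarith
        _ = C₂ * x * Real.exp (-(κ / 80) * l) := by rw [Real.exp_add, hC₂]; ring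
        _ ≤ _ := by
            have : 0 ≤ C₁ * x * Real.exp (-(κ / 80) * l) := by positivity
            linarith
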